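/- arXiv:2405.03203 — 2 statements merged into one kernel-verified Lean document; each statement's English description precedes it below -/
import Mathlib

section
/- Let N ≥ 3, p ∈ (1, N/(N−2)), and let w be a nonnegative classical solution of −Δw = [w−1]_+^p in R^N with ∫_{R^N}[w−1]_+^p < +∞. Then either w ≡ c for some constant c ∈ [0,1], or, up to a translation, w = w_a for some a ∈ [0,1), where w_a is the unique solution of: −Δw = [w−1]_+^p in R^N, w > a, w(0) = max w > 1, and w(x) → a as |x| → +∞. Explicitly, w_a(r) = 1 + R_a^{2/(1−p)} u(r/R_a) for r ∈ [0,R_a] and w_a(r) = a + (R_a/r)^{N−2}(1−a) for r ≥ R_a, where u is the unique positive solution of −Δu = u^p in B₁(0) with u = 0 on ∂B₁(0), and R_a = (−u′(1)/((N−2)(1−a)))^{(p−1)/2}. -/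
open MeasureTheory Metric Filter Real Set
noncomputable section

/-- The Laplacian of `f : ℝᴺ → ℝ` as the sum of second partial derivatives. -/
def lap {N : ℕ} (f : EuclideanSpace ℝ (Fin N) → ℝ) (x : EuclideanSpace ℝ (Fin N)) : ℝ :=
  ∑ i : Fin N, fderiv ℝ (fun y => fderiv ℝ f y (EuclideanSpace.single i 1)) x
    (EuclideanSpace.single i 1)

/-- The compactly supported function `y ↦ (1 - |y|²)₊`. -/
def cap {N : ℕ} (y : EuclideanSpace ℝ (Fin N)) : ℝ := max (1 - ‖y‖ ^ 2) 0

lemma cap_nonneg {N : ℕ} (y : EuclideanSpace ℝ (Fin N)) : 0 ≤ cap y := le_max_right _ _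

lemma cap_eq_zero {N : ℕ} {y : EuclideanSpace ℝ (Fin N)} (hy : 1 ≤ ‖y‖) : cap y = 0 := by
  unfold cap
  exact max_eq_right (by nlinarith)

lemma continuous_cap {N : ℕ} : Continuous (cap (N := N)) := by
  unfold cap
  fun_prop

lemma hasCompactSupport_cap {N : ℕ} : HasCompactSupport (cap (N := N)) := by
  refine HasCompactSupport.intro (isCompact_closedBall 0 1) fun y hy => cap_eq_zero ?_
  simp only [mem_closedBall, dist_zero_right, not_le] at hy
  exact hy.le

lemma hasDerivAt_sq_max_zero (t : ℝ) :
    HasDerivAt (fun t : ℝ => max t 0 ^ 2) (2 * max t 0) t := by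
  rcases lt_trichotomy t 0 with ht | rfl | ht
  · rw [max_eq_right ht.le, mul_zero]
    refine (hasDerivAt_const t (0 : ℝ)).congr_of_eventuallyEq ?_
    filter_upwards [gt_mem_nhds ht] with s hs
    simp [max_eq_right (le_of_lt hs)]
  · have h : HasDerivAt (fun t : ℝ => t ^ 2) 0 0 := by simpa using hasDerivAt_pow 2 (0 : ℝ)
    rw [hasDerivAt_iff_isLittleO] at h ⊢
    simp only [sub_zero, max_self, mul_zero, smul_zero, ne_eq, OfNat.ofNat_ne_zero,
      not_false_eq_true, zero_pow] at h ⊢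
    refine (Asymptotics.isBigO_of_le _ fun s => ?_).trans_isLittleO h
    rw [Real.norm_of_nonneg (by positivity), Real.norm_of_nonneg (by positivity)]
    rcases le_total s 0 with hs | hs
    · simp [max_eq_right hs, sq_nonneg]
    · rw [max_eq_left hs]
  · rw [max_eq_left ht.le]
    refine ((hasDerivAt_pow 2 t).congr_of_eventuallyEq ?_).congr_deriv (by simp)
    filter_upwards [lt_mem_nhds ht] with s hs
    rw [max_eq_left (le_of_lt hs)]

lemma hasFDerivAt_cap_sq {N : ℕ} (y : EuclideanSpace ℝ (Fin N)) :
    HasFDerivAt (fun y : EuclideanSpace ℝ (Fin N) => cap y ^ 2)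
      ((-(4 * cap y)) • innerSL ℝ y) y := by
  have h1 : HasFDerivAt (fun y : EuclideanSpace ℝ (Fin N) => 1 - ‖y‖ ^ 2)
      (-((2 : ℕ) • innerSL ℝ y)) y := by
    simpa using ((hasStrictFDerivAt_norm_sq y).hasFDerivAt).const_sub 1
  refine ((hasDerivAt_sq_max_zero (1 - ‖y‖ ^ 2)).comp_hasFDerivAt y h1).congr_fderiv ?_
  ext v
  simp [cap]
  ring

lemma fderiv_cap_sq_single {N : ℕ} (y : EuclideanSpace ℝ (Fin N)) (i : Fin N) :
    fderiv ℝ (fun y : EuclideanSpace ℝ (Fin N) => cap y ^ 2) y (EuclideanSpace.single i 1)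
      = -(4 * cap y) * y i := by
  rw [(hasFDerivAt_cap_sq y).fderiv]
  simp [EuclideanSpace.inner_single_right]

lemma contDiff_partial {N : ℕ} {w : EuclideanSpace ℝ (Fin N) → ℝ} (hw : ContDiff ℝ 2 w)
    (v : EuclideanSpace ℝ (Fin N)) : ContDiff ℝ 1 (fun y => fderiv ℝ w y v) :=
  (hw.fderiv_right (by norm_num)).clm_apply contDiff_const

lemma continuous_lap {N : ℕ} {w : EuclideanSpace ℝ (Fin N) → ℝ} (hw : ContDiff ℝ 2 w) :
    Continuous (lap w) := by
  unfold lap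
  refine continuous_finsetSum _ fun i _ => ?_
  exact ((contDiff_partial hw _).continuous_fderiv (by norm_num)).clm_apply continuous_const

lemma fderiv_apply_eq_sum {N : ℕ} (L : EuclideanSpace ℝ (Fin N) →L[ℝ] ℝ)
    (y : EuclideanSpace ℝ (Fin N)) : L y = ∑ i, L (EuclideanSpace.single i 1) * y i := by
  have h : y = ∑ i, y i • EuclideanSpace.single i (1 : ℝ) := by
    ext j
    simp [Finset.sum_apply, Pi.single_apply]
  conv_lhs => rw [h]
  simp [mul_comm]

lemma integrable_mul_cap {N : ℕ} {f : EuclideanSpace ℝ (Fin N) → ℝ} (hf : Continuous f) :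
    Integrable (fun y => f y * cap y) :=
  (hf.mul continuous_cap).integrable_of_hasCompactSupport hasCompactSupport_cap.mul_left

lemma integrable_mul_cap_sq {N : ℕ} {f : EuclideanSpace ℝ (Fin N) → ℝ} (hf : Continuous f) :
    Integrable (fun y => f y * cap y ^ 2) := by
  have := integrable_mul_cap (hf.mul continuous_cap)
  simpa [sq, mul_assoc] using this

lemma integral_radial_deriv_mul_cap {N : ℕ} {w : EuclideanSpace ℝ (Fin N) → ℝ}
    (hw : ContDiff ℝ 2 w) (x : EuclideanSpace ℝ (Fin N)) (s : ℝ) :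
    ∫ y, fderiv ℝ w (x + s • y) y * cap y = s / 4 * ∫ y, lap w (x + s • y) * cap y ^ 2 := by
  have hc : ∀ v, Continuous (fun y => fderiv ℝ w (x + s • y) v) := fun v =>
    (contDiff_partial hw v).continuous.comp (by fun_prop)
  have hcy : ∀ i : Fin N, Continuous (fun y : EuclideanSpace ℝ (Fin N) => y i) := fun i => by
    fun_prop
  have hd : ∀ (i : Fin N) (y : EuclideanSpace ℝ (Fin N)),
      HasFDerivAt (fun y => fderiv ℝ w (x + s • y) (EuclideanSpace.single i 1))
        (s • fderiv ℝ (fun y => fderiv ℝ w y (EuclideanSpace.single i 1)) (x + s • y)) y := by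
    intro i y
    have h1 := ((contDiff_partial hw (EuclideanSpace.single i 1)).differentiable
      (by norm_num) (x + s • y)).hasFDerivAt
    have h2 : HasFDerivAt (fun y : EuclideanSpace ℝ (Fin N) => x + s • y)
        (s • ContinuousLinearMap.id ℝ _) y :=
      ((hasFDerivAt_id y).const_smul s).const_add x
    refine (h1.comp y h2).congr_fderiv ?_
    ext v
    simp
  have hcl : ∀ i : Fin N, Continuous (fun y => fderiv ℝ (fun y => fderiv ℝ w y
      (EuclideanSpace.single i 1)) (x + s • y) (EuclideanSpace.single i 1)) := fun i =>
    (((contDiff_partial hw _).continuous_fderiv (by norm_num)).comp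
      (by fun_prop)).clm_apply continuous_const
  have hparts : ∀ i : Fin N,
      ∫ y, fderiv ℝ w (x + s • y) (EuclideanSpace.single i 1) * (y i * cap y)
        = s / 4 * ∫ y, fderiv ℝ (fun y => fderiv ℝ w y (EuclideanSpace.single i 1))
            (x + s • y) (EuclideanSpace.single i 1) * cap y ^ 2 := by
    intro i
    have hI1 := integrable_mul_cap_sq ((hcl i).const_smul s)
    have hI2 := (integrable_mul_cap (((hc (EuclideanSpace.single i 1)).mul (hcy i)))).const_mul
      (-4)
    have key := integral_mul_fderiv_eq_neg_fderiv_mul_of_integrable (μ := volume)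
      (f := fun y => fderiv ℝ w (x + s • y) (EuclideanSpace.single i 1))
      (g := fun y => cap y ^ 2) (v := EuclideanSpace.single i 1)
      (by simpa [(hd i _).fderiv] using hI1)
      (by
        refine hI2.congr (Eventually.of_forall fun y => ?_)
        simp only [fderiv_cap_sq_single, Pi.mul_apply]
        ring)
      (integrable_mul_cap_sq (hc _))
      (fun y _ => (hd i y).differentiableAt)
      (fun y _ => (hasFDerivAt_cap_sq y).differentiableAt)
    simp only [fderiv_cap_sq_single, (hd i _).fderiv, smul_apply,
      smul_eq_mul, mul_assoc, integral_const_mul] at key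
    have e1 : ∫ y, fderiv ℝ w (x + s • y) (EuclideanSpace.single i 1) * (-(4 * cap y) * y i)
        = -4 * ∫ y, fderiv ℝ w (x + s • y) (EuclideanSpace.single i 1) * (y i * cap y) := by
      rw [← integral_const_mul]
      congr 1
      ext y
      ring
    rw [e1] at key
    linarith
  have hsum : ∀ y, fderiv ℝ w (x + s • y) y * cap y
      = ∑ i, fderiv ℝ w (x + s • y) (EuclideanSpace.single i 1) * (y i * cap y) := by
    intro y
    rw [fderiv_apply_eq_sum, Finset.sum_mul]
    simp [mul_assoc]
  simp only [hsum]
  rw [integral_finsetSum]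
  · simp only [hparts, lap, Finset.sum_mul]
    rw [integral_finsetSum _ fun i _ => integrable_mul_cap_sq (hcl i), Finset.mul_sum]
  · intro i _
    simpa [mul_assoc] using integrable_mul_cap ((hc (EuclideanSpace.single i 1)).mul (hcy i))

/-- The average of `w` over the ball of radius `s` about `x` with (unnormalised) weight `cap`. -/
def capAverage {N : ℕ} (w : EuclideanSpace ℝ (Fin N) → ℝ) (x : EuclideanSpace ℝ (Fin N))
    (s : ℝ) : ℝ := ∫ y, w (x + s • y) * cap y

lemma hasDerivAt_capAverage {N : ℕ} {w : EuclideanSpace ℝ (Fin N) → ℝ}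
    (hw : ContDiff ℝ 2 w) (x : EuclideanSpace ℝ (Fin N)) (s : ℝ) :
    HasDerivAt (capAverage w x) (s / 4 * ∫ y, lap w (x + s • y) * cap y ^ 2) s := by
  have hwc := hw.continuous
  have hdc : Continuous (fderiv ℝ w) := hw.continuous_fderiv (by norm_num)
  have hjoint : Continuous (fun q : ℝ × EuclideanSpace ℝ (Fin N) =>
      fderiv ℝ w (x + q.1 • q.2) q.2 * cap q.2) :=
    ((hdc.comp (by fun_prop)).clm_apply continuous_snd).mul
      (continuous_cap.comp continuous_snd)
  obtain ⟨C, hC⟩ := ((isCompact_Icc (a := s - 1) (b := s + 1)).prod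
    (isCompact_closedBall (0 : EuclideanSpace ℝ (Fin N)) 1)).exists_bound_of_continuousOn
      hjoint.continuousOn
  have hval := integral_radial_deriv_mul_cap hw x s
  have hcont : ∀ t : ℝ, Continuous (fun y : EuclideanSpace ℝ (Fin N) => w (x + t • y)) :=
    fun t => hwc.comp (by fun_prop)
  have := (hasDerivAt_integral_of_dominated_loc_of_deriv_le (μ := volume)
    (F := fun t y => w (x + t • y) * cap y)
    (F' := fun t y => fderiv ℝ w (x + t • y) y * cap y)
    (bound := (closedBall (0 : EuclideanSpace ℝ (Fin N)) 1).indicator fun _ => C)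
    (Icc_mem_nhds (sub_one_lt s) (lt_add_one s))
    (Eventually.of_forall fun t => ((hcont t).mul continuous_cap).aestronglyMeasurable)
    (integrable_mul_cap (hcont s))
    (hjoint.comp (by fun_prop : Continuous fun y : EuclideanSpace ℝ (Fin N) =>
      (s, y))).aestronglyMeasurable
    (Eventually.of_forall fun y t ht => ?_)
    ((integrable_indicator_iff measurableSet_closedBall).2
      (integrableOn_const (isCompact_closedBall _ _).measure_lt_top.ne))
    (Eventually.of_forall fun y t _ => ?_)).2
  · rw [hval] at this
    exact this
  · by_cases hy : y ∈ closedBall (0 : EuclideanSpace ℝ (Fin N)) 1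
    · rw [indicator_of_mem hy]
      exact hC (t, y) ⟨ht, hy⟩
    · rw [indicator_of_notMem hy]
      simp only [mem_closedBall, dist_zero_right, not_le] at hy
      simp [cap_eq_zero hy.le]
  · have h1 := (hw.differentiable (by norm_num) (x + t • y)).hasFDerivAt
    have h2 : HasDerivAt (fun t : ℝ => x + t • y) y t := by
      simpa using ((hasDerivAt_id t).smul_const y).const_add x
    exact (h1.comp_hasDerivAt t h2).mul_const _

lemma capAverage_zero {N : ℕ} (w : EuclideanSpace ℝ (Fin N) → ℝ)
    (x : EuclideanSpace ℝ (Fin N)) :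
    capAverage w x 0 = w x * ∫ y : EuclideanSpace ℝ (Fin N), cap y := by
  simp [capAverage, integral_const_mul]

lemma integral_cap_pos {N : ℕ} : 0 < ∫ y : EuclideanSpace ℝ (Fin N), cap y := by
  refine continuous_cap.integral_pos_of_hasCompactSupport_nonneg_nonzero
    hasCompactSupport_cap cap_nonneg (x := 0) ?_
  simp [cap]

lemma capAverage_nonneg {N : ℕ} {w : EuclideanSpace ℝ (Fin N) → ℝ} (hpos : ∀ x, 0 ≤ w x)
    (x : EuclideanSpace ℝ (Fin N)) (s : ℝ) : 0 ≤ capAverage w x s :=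
  integral_nonneg fun y => mul_nonneg (hpos _) (cap_nonneg y)

lemma continuous_deriv_capAverage {N : ℕ} {f : EuclideanSpace ℝ (Fin N) → ℝ}
    (hf : Continuous f) (x : EuclideanSpace ℝ (Fin N)) :
    Continuous (fun s : ℝ => s / 4 * ∫ y, f (x + s • y) * cap y ^ 2) := by
  have h := continuous_parametric_integral_of_continuous (μ := volume)
    (f := fun (s : ℝ) (y : EuclideanSpace ℝ (Fin N)) => f (x + s • y) * cap y ^ 2)
    ((hf.comp (by fun_prop)).mul ((continuous_cap.comp continuous_snd).pow 2))
    (isCompact_closedBall (0 : EuclideanSpace ℝ (Fin N)) 1)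
  have e : ∀ s : ℝ, ∫ y in closedBall (0 : EuclideanSpace ℝ (Fin N)) 1,
      f (x + s • y) * cap y ^ 2 = ∫ y, f (x + s • y) * cap y ^ 2 := by
    intro s
    refine setIntegral_eq_integral_of_forall_compl_eq_zero fun y hy => ?_
    simp only [mem_closedBall, dist_zero_right, not_le] at hy
    simp [cap_eq_zero hy.le]
  simp only [e] at h
  exact (continuous_id.div_const 4).mul h

lemma integral_deriv_capAverage {N : ℕ} {w : EuclideanSpace ℝ (Fin N) → ℝ}
    (hw : ContDiff ℝ 2 w) (x : EuclideanSpace ℝ (Fin N)) (r : ℝ) :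
    ∫ s in (0 : ℝ)..r, s / 4 * ∫ y, lap w (x + s • y) * cap y ^ 2
      = capAverage w x r - capAverage w x 0 :=
  intervalIntegral.integral_eq_sub_of_hasDerivAt (fun s _ => hasDerivAt_capAverage hw x s)
    ((continuous_deriv_capAverage (continuous_lap hw) x).intervalIntegrable _ _)

lemma antitoneOn_capAverage {N : ℕ} {w : EuclideanSpace ℝ (Fin N) → ℝ}
    (hw : ContDiff ℝ 2 w) (hlap : ∀ x, lap w x ≤ 0) (x : EuclideanSpace ℝ (Fin N)) :
    AntitoneOn (capAverage w x) (Ici 0) := by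
  refine antitoneOn_of_deriv_nonpos (convex_Ici 0)
    (fun s _ => (hasDerivAt_capAverage hw x s).continuousAt.continuousWithinAt)
    (fun s _ => (hasDerivAt_capAverage hw x s).differentiableAt.differentiableWithinAt) ?_
  intro s hs
  rw [interior_Ici] at hs
  rw [(hasDerivAt_capAverage hw x s).deriv]
  refine mul_nonpos_of_nonneg_of_nonpos (div_nonneg (le_of_lt hs) (by norm_num)) ?_
  exact integral_nonpos fun y => mul_nonpos_of_nonpos_of_nonneg (hlap _) (sq_nonneg _)

lemma abs_cap_sub_cap_le {N : ℕ} (u v : EuclideanSpace ℝ (Fin N)) (h : ‖u - v‖ ≤ 1 / 4) :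
    |cap u - cap v| ≤ 6 * ‖u - v‖ * cap ((1 / 2 : ℝ) • u) := by
  have h1 : |‖u‖ - ‖v‖| ≤ ‖u - v‖ := abs_norm_sub_norm_le u v
  have hle := abs_le.1 h1
  have hu := norm_nonneg u
  have hv := norm_nonneg v
  rcases le_or_gt ‖u‖ (5 / 4) with hu1 | hu1
  · have hc : 1 / 2 ≤ cap ((1 / 2 : ℝ) • u) := by
      unfold cap
      refine le_max_of_le_left ?_
      rw [norm_smul, Real.norm_of_nonneg (by norm_num)]
      nlinarith
    have h2 : |cap u - cap v| ≤ |(1 - ‖u‖ ^ 2) - (1 - ‖v‖ ^ 2)| := by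
      unfold cap
      exact abs_max_sub_max_le_abs _ _ _
    have h3 : |(1 - ‖u‖ ^ 2) - (1 - ‖v‖ ^ 2)| ≤ ‖u - v‖ * 3 := by
      have : (1 - ‖u‖ ^ 2) - (1 - ‖v‖ ^ 2) = -((‖u‖ - ‖v‖) * (‖u‖ + ‖v‖)) := by ring
      rw [this, abs_neg, abs_mul, abs_of_nonneg (a := ‖u‖ + ‖v‖) (by positivity)]
      exact mul_le_mul h1 (by linarith) (by positivity) (norm_nonneg _)
    nlinarith [norm_nonneg (u - v)]
  · rw [cap_eq_zero (by linarith), cap_eq_zero (y := v) (by linarith)]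
    simpa using mul_nonneg (mul_nonneg (by norm_num) (norm_nonneg (u - v)))
      (cap_nonneg ((1 / 2 : ℝ) • u))

lemma abs_capAverage_sub_le {N : ℕ} {w : EuclideanSpace ℝ (Fin N) → ℝ}
    (hw : Continuous w) (hpos : ∀ x, 0 ≤ w x) (x x' : EuclideanSpace ℝ (Fin N)) {r : ℝ}
    (hr : 0 < r) (hxr : 4 * ‖x - x'‖ ≤ r) :
    |capAverage w x r - capAverage w x' r|
      ≤ 6 * (‖x - x'‖ / r) * (2 ^ N * capAverage w x (2 * r)) := by
  set d : EuclideanSpace ℝ (Fin N) := r⁻¹ • (x - x') with hd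
  have hdn : ‖d‖ = ‖x - x'‖ / r := by
    rw [hd, norm_smul, Real.norm_of_nonneg (by positivity), div_eq_inv_mul]
  have hd4 : ‖d‖ ≤ 1 / 4 := by
    rw [hdn, div_le_iff₀ hr]; linarith
  have hcont : ∀ t : ℝ, Continuous (fun y : EuclideanSpace ℝ (Fin N) => w (x + t • y)) :=
    fun t => hw.comp (by fun_prop)
  have hshift : capAverage w x' r = ∫ y, w (x + r • y) * cap (y + d) := by
    rw [capAverage, ← integral_add_right_eq_self _ d]
    congr 1
    ext y
    congr 2
    rw [hd, smul_add, smul_smul, mul_inv_cancel₀ hr.ne', one_smul]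
    abel
  have hint2 : Integrable (fun y => w (x + r • y) * cap (y + d)) := by
    refine ((hcont r).mul (continuous_cap.comp (by fun_prop))).integrable_of_hasCompactSupport ?_
    exact (hasCompactSupport_cap.comp_homeomorph (Homeomorph.addRight d)).mul_left
  have hhalf : Continuous fun y : EuclideanSpace ℝ (Fin N) => cap ((1 / 2 : ℝ) • y) :=
    continuous_cap.comp (by fun_prop)
  have hint3 : Integrable (fun y => w (x + r • y) * cap ((1 / 2 : ℝ) • y)) := by
    refine ((hcont r).mul hhalf).integrable_of_hasCompactSupport ?_
    exact (hasCompactSupport_cap.comp_smul (by norm_num : (1 / 2 : ℝ) ≠ 0)).mul_left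
  have hscale : ∫ y, w (x + r • y) * cap ((1 / 2 : ℝ) • y)
      = 2 ^ N * capAverage w x (2 * r) := by
    have := Measure.integral_comp_smul (volume : Measure (EuclideanSpace ℝ (Fin N)))
      (fun y => w (x + (2 * r) • y) * cap y) (1 / 2)
    simp only [smul_smul, finrank_euclideanSpace, Fintype.card_fin, smul_eq_mul] at this
    rw [show 2 * r * (1 / 2) = r by ring] at this
    rw [this, capAverage, abs_of_pos (by positivity)]
    simp
  rw [hshift, capAverage, ← integral_sub (integrable_mul_cap (hcont r)) hint2, ← hscale, ← hdn,
    ← integral_const_mul]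
  refine (abs_integral_le_integral_abs).trans (integral_mono ?_ (hint3.const_mul _) fun y => ?_)
  · exact ((integrable_mul_cap (hcont r)).sub hint2).abs
  · simp only
    rw [← mul_sub, abs_mul, abs_of_nonneg (hpos _)]
    have := abs_cap_sub_cap_le y (y + d) (by simpa using hd4)
    simp only [sub_add_cancel_left, norm_neg] at this
    calc _ ≤ w (x + r • y) * (6 * ‖d‖ * cap ((1 / 2 : ℝ) • y)) :=
          mul_le_mul_of_nonneg_left this (hpos _)
      _ = _ := by ring

lemma exists_tendsto_capAverage {N : ℕ} {w : EuclideanSpace ℝ (Fin N) → ℝ}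
    (hw : ContDiff ℝ 2 w) (hpos : ∀ x, 0 ≤ w x) (hlap : ∀ x, lap w x ≤ 0) :
    ∃ L : ℝ, 0 ≤ L ∧ ∀ x, Tendsto (capAverage w x) atTop (nhds L) := by
  have hx : ∀ x, ∃ L : ℝ, 0 ≤ L ∧ Tendsto (capAverage w x) atTop (nhds L) := by
    intro x
    have hanti : Antitone (fun s => capAverage w x (max s 0)) := fun s t hst =>
      antitoneOn_capAverage hw hlap x (mem_Ici.2 (le_max_right _ _))
        (mem_Ici.2 (le_max_right _ _)) (max_le_max_right _ hst)
    have hbdd : BddBelow (range fun s => capAverage w x (max s 0)) :=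
      ⟨0, by rintro _ ⟨s, rfl⟩; exact capAverage_nonneg hpos _ _⟩
    refine ⟨_, le_ciInf fun s => capAverage_nonneg hpos _ _,
      (tendsto_atTop_ciInf hanti hbdd).congr' ?_⟩
    filter_upwards [eventually_ge_atTop 0] with s hs
    rw [max_eq_left hs]
  obtain ⟨L, hL, hL0⟩ := hx 0
  refine ⟨L, hL, fun x => ?_⟩
  have hdiff : Tendsto (fun r => capAverage w 0 r - capAverage w x r) atTop (nhds 0) := by
    have hbd : Tendsto (fun r : ℝ => 6 * (‖0 - x‖ / r) * (2 ^ N * capAverage w 0 0)) atTop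
        (nhds 0) := by
      have : Tendsto (fun r : ℝ => ‖0 - x‖ / r) atTop (nhds 0) :=
        tendsto_const_nhds.div_atTop tendsto_id
      simpa using (this.const_mul 6).mul_const (2 ^ N * capAverage w 0 0)
    refine squeeze_zero_norm' ?_ hbd
    filter_upwards [eventually_gt_atTop 0, eventually_ge_atTop (4 * ‖0 - x‖)] with r hr hr4
    refine (abs_capAverage_sub_le hw.continuous hpos 0 x hr hr4).trans ?_
    gcongr
    exact antitoneOn_capAverage hw hlap 0 (mem_Ici.2 le_rfl)
      (mem_Ici.2 (by positivity)) (by positivity)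
  simpa using hL0.sub hdiff

/-- The radial weight whose integral over `(0, ∞)` is the constant in front of the Newtonian
kernel. -/
def capWeight (N : ℕ) (t : ℝ) : ℝ := t / 4 * (t ^ N)⁻¹ * max (1 - t⁻¹ ^ 2) 0 ^ 2

lemma capWeight_nonneg {N : ℕ} {t : ℝ} (ht : 0 ≤ t) : 0 ≤ capWeight N t := by
  unfold capWeight
  positivity

lemma capWeight_eq_zero {N : ℕ} {t : ℝ} (ht : 0 < t) (ht1 : t ≤ 1) : capWeight N t = 0 := by
  have h : 1 ≤ t⁻¹ := (one_le_inv₀ ht).2 ht1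
  unfold capWeight
  rw [max_eq_right (by nlinarith)]
  simp

lemma capWeight_pos {N : ℕ} {t : ℝ} (ht : 1 < t) : 0 < capWeight N t := by
  have h : t⁻¹ < 1 := inv_lt_one_of_one_lt₀ ht
  have h0 : 0 < t⁻¹ := by positivity
  unfold capWeight
  rw [max_eq_left (by nlinarith)]
  have : 0 < 1 - t⁻¹ ^ 2 := by nlinarith
  positivity

lemma measurable_capWeight (N : ℕ) : Measurable (capWeight N) := by
  unfold capWeight
  fun_prop

lemma integrableOn_capWeight {N : ℕ} (hN : 3 ≤ N) : IntegrableOn (capWeight N) (Ioi 0) := by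
  rw [← Ioc_union_Ioi_eq_Ioi (zero_le_one' ℝ)]
  refine IntegrableOn.union ?_ ?_
  · refine integrableOn_zero.congr_fun (fun t ht => ?_) measurableSet_Ioc
    exact (capWeight_eq_zero ht.1 ht.2).symm
  · refine Integrable.mono' (integrableOn_Ioi_rpow_of_lt (by norm_num : (-2 : ℝ) < -1) one_pos)
      (measurable_capWeight N).aestronglyMeasurable ?_
    refine (ae_restrict_iff' measurableSet_Ioi).2 (Eventually.of_forall fun t ht => ?_)
    have ht1 : (1 : ℝ) < t := ht
    have ht0 : 0 < t := one_pos.trans ht1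
    rw [Real.norm_of_nonneg (capWeight_nonneg ht0.le), rpow_neg ht0.le, rpow_two]
    have h1 : max (1 - t⁻¹ ^ 2) 0 ^ 2 ≤ 1 := by
      refine pow_le_one₀ (le_max_right _ _) (max_le ?_ zero_le_one)
      linarith [sq_nonneg t⁻¹]
    have h2 : t / 4 * (t ^ N)⁻¹ ≤ (t ^ 2)⁻¹ := by
      have h3 : (t ^ N)⁻¹ ≤ (t ^ 3)⁻¹ :=
        inv_anti₀ (by positivity) (pow_le_pow_right₀ ht1.le hN)
      calc t / 4 * (t ^ N)⁻¹ ≤ t / 4 * (t ^ 3)⁻¹ := by gcongr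
        _ = (t ^ 2)⁻¹ / 4 := by field_simp
        _ ≤ (t ^ 2)⁻¹ := by
          have : 0 ≤ (t ^ 2)⁻¹ := by positivity
          linarith
    calc capWeight N t ≤ t / 4 * (t ^ N)⁻¹ * 1 := by
          unfold capWeight
          gcongr
      _ ≤ _ := by linarith

lemma integral_capWeight_pos {N : ℕ} (hN : 3 ≤ N) : 0 < ∫ t in Ioi 0, capWeight N t := by
  rw [setIntegral_pos_iff_support_of_nonneg_ae
    ((ae_restrict_iff' measurableSet_Ioi).2 (Eventually.of_forall fun t ht =>
      capWeight_nonneg (le_of_lt ht))) (integrableOn_capWeight hN)]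
  refine lt_of_lt_of_le ?_ (measure_mono (s := Ioi (1 : ℝ)) fun t ht => ?_)
  · simp
  · exact ⟨(capWeight_pos ht).ne', mem_Ioi.2 (one_pos.trans ht)⟩

lemma lintegral_kernel_eq {N : ℕ} (hN : 3 ≤ N) {z : EuclideanSpace ℝ (Fin N)} (hz : z ≠ 0) :
    ∫⁻ s in Ioi (0 : ℝ), ENNReal.ofReal (s / 4 * (s ^ N)⁻¹ * cap (s⁻¹ • z) ^ 2)
      = ENNReal.ofReal ((∫ t in Ioi 0, capWeight N t) * (‖z‖ ^ (N - 2))⁻¹) := by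
  have hz0 : 0 < ‖z‖ := norm_pos_iff.2 hz
  have e : ∀ s ∈ Ioi (0 : ℝ), s / 4 * (s ^ N)⁻¹ * cap (s⁻¹ • z) ^ 2
      = (‖z‖ ^ (N - 1))⁻¹ * capWeight N (‖z‖⁻¹ * s) := by
    intro s hs
    have hs0 : (0 : ℝ) < s := hs
    have hpow : ‖z‖ ^ N = ‖z‖ ^ (N - 1) * ‖z‖ := by
      rw [← pow_succ]
      congr 1
      omega
    unfold capWeight cap
    rw [norm_smul, norm_inv, Real.norm_of_nonneg hs0.le, mul_inv, inv_inv, mul_pow _ _ N,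
      inv_pow ‖z‖ N, hpow, mul_comm s⁻¹ ‖z‖]
    field_simp
  have hint : IntegrableOn (fun s => (‖z‖ ^ (N - 1))⁻¹ * capWeight N (‖z‖⁻¹ * s)) (Ioi 0) := by
    have := (integrableOn_Ioi_comp_mul_left_iff (capWeight N) 0 (inv_pos.2 hz0)).2
      (by simpa using integrableOn_capWeight hN)
    exact this.const_mul _
  rw [setLIntegral_congr_fun measurableSet_Ioi (g := fun s =>
      ENNReal.ofReal ((‖z‖ ^ (N - 1))⁻¹ * capWeight N (‖z‖⁻¹ * s))) fun s hs => by
        simp only [e s hs],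
    ← ofReal_integral_eq_lintegral_ofReal hint]
  · congr 1
    rw [integral_const_mul, integral_comp_mul_left_Ioi _ _ (inv_pos.2 hz0)]
    simp only [inv_inv, mul_zero, smul_eq_mul]
    rw [show N - 1 = (N - 2) + 1 by omega, pow_succ]
    field_simp
  · refine (ae_restrict_iff' measurableSet_Ioi).2 (Eventually.of_forall fun s hs => ?_)
    exact mul_nonneg (by positivity)
      (capWeight_nonneg (mul_nonneg (by positivity) (le_of_lt hs)))

lemma deriv_capAverage_eq {N : ℕ} (f : EuclideanSpace ℝ (Fin N) → ℝ)
    (x : EuclideanSpace ℝ (Fin N)) {s : ℝ} (hs : 0 < s) :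
    s / 4 * ∫ y, f (x + s • y) * cap y ^ 2
      = ∫ z, f (x + z) * (s / 4 * (s ^ N)⁻¹ * cap (s⁻¹ • z) ^ 2) := by
  have := Measure.integral_comp_smul (volume : Measure (EuclideanSpace ℝ (Fin N)))
    (fun z => f (x + z) * cap (s⁻¹ • z) ^ 2) s
  simp only [smul_smul, inv_mul_cancel₀ hs.ne', one_smul, finrank_euclideanSpace,
    Fintype.card_fin, smul_eq_mul] at this
  rw [this, abs_of_pos (by positivity), ← mul_assoc, ← integral_const_mul]
  congr 1
  ext z
  ring

lemma lintegral_mul_newton_eq {N : ℕ} (hN : 3 ≤ N) {w : EuclideanSpace ℝ (Fin N) → ℝ}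
    (hw : ContDiff ℝ 2 w) (hlap : ∀ x, lap w x ≤ 0) {L : ℝ} (x : EuclideanSpace ℝ (Fin N))
    (hL : Tendsto (capAverage w x) atTop (nhds L)) :
    ∫⁻ z, ENNReal.ofReal (-lap w (x + z) *
        ((∫ t in Ioi 0, capWeight N t) * (‖z‖ ^ (N - 2))⁻¹))
      = ENNReal.ofReal (capAverage w x 0 - L) := by
  have : Nonempty (Fin N) := ⟨⟨0, by omega⟩⟩
  set f : EuclideanSpace ℝ (Fin N) → ℝ := fun x => -lap w x with hf
  have hfc : Continuous f := (continuous_lap hw).neg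
  have hf0 : ∀ x, 0 ≤ f x := fun x => neg_nonneg.2 (hlap x)
  set P : ℝ → EuclideanSpace ℝ (Fin N) → ℝ := fun s z => s / 4 * (s ^ N)⁻¹ * cap (s⁻¹ • z) ^ 2
    with hP
  have hP0 : ∀ s ∈ Ioi (0 : ℝ), ∀ z, 0 ≤ P s z := fun s hs z => by
    have : (0 : ℝ) < s := hs
    simp only [hP]
    positivity
  have hPm : Measurable (Function.uncurry P) := by
    have h1 : Measurable fun q : ℝ × EuclideanSpace ℝ (Fin N) => q.1⁻¹ • q.2 :=
      measurable_fst.inv.smul measurable_snd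
    have h2 : Measurable fun q : ℝ × EuclideanSpace ℝ (Fin N) => cap (q.1⁻¹ • q.2) :=
      continuous_cap.measurable.comp h1
    simp only [hP, Function.uncurry_def]
    fun_prop
  have hD : ∀ s ∈ Ioi (0 : ℝ), ENNReal.ofReal (s / 4 * ∫ y, f (x + s • y) * cap y ^ 2)
      = ∫⁻ z, ENNReal.ofReal (f (x + z)) * ENNReal.ofReal (P s z) := by
    intro s hs
    have hint : Integrable fun z => f (x + z) * P s z := by
      have hs0 : (0 : ℝ) < s := hs
      refine Continuous.integrable_of_hasCompactSupport ?_ ?_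
      · exact (hfc.comp (by fun_prop)).mul
          (continuous_const.mul ((continuous_cap.comp (by fun_prop)).pow 2))
      · refine HasCompactSupport.intro (isCompact_closedBall 0 s) fun z hz => ?_
        simp only [mem_closedBall, dist_zero_right, not_le] at hz
        have : 1 ≤ ‖s⁻¹ • z‖ := by
          rw [norm_smul, norm_inv, Real.norm_of_nonneg hs0.le, ← div_eq_inv_mul, one_le_div hs0]
          exact hz.le
        simp [hP, cap_eq_zero this]
    rw [deriv_capAverage_eq f x hs, ofReal_integral_eq_lintegral_ofReal hint
      (Eventually.of_forall fun z => mul_nonneg (hf0 _) (hP0 s hs z))]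
    congr 1
    ext z
    rw [ENNReal.ofReal_mul (hf0 _)]
  have hIoc : ∀ r ∈ Ioi (0 : ℝ), ∫⁻ s in Ioc 0 r,
      ∫⁻ z, ENNReal.ofReal (f (x + z)) * ENNReal.ofReal (P s z)
        = ENNReal.ofReal (capAverage w x 0 - capAverage w x r) := by
    intro r hr
    have hcont := continuous_deriv_capAverage hfc x
    rw [← setLIntegral_congr_fun measurableSet_Ioc (fun s hs => hD s hs.1),
      ← ofReal_integral_eq_lintegral_ofReal
        ((hcont.intervalIntegrable 0 r).1) ((ae_restrict_iff' measurableSet_Ioc).2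
          (Eventually.of_forall fun s hs => ?_)),
      ← intervalIntegral.integral_of_le (le_of_lt hr)]
    · congr 1
      have := integral_deriv_capAverage hw x r
      rw [← neg_sub, ← this, ← intervalIntegral.integral_neg]
      congr 1
      ext s
      simp [hf, integral_neg]
    · exact mul_nonneg (div_nonneg hs.1.le (by norm_num))
        (integral_nonneg fun y => mul_nonneg (hf0 _) (sq_nonneg _))
  have hjoint : Measurable (Function.uncurry fun (s : ℝ) (z : EuclideanSpace ℝ (Fin N)) =>
      ENNReal.ofReal (f (x + z)) * ENNReal.ofReal (P s z)) := by
    refine Measurable.mul ?_ hPm.ennreal_ofReal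
    exact ((hfc.comp (by fun_prop : Continuous fun q : ℝ × EuclideanSpace ℝ (Fin N) =>
      x + q.2)).measurable).ennreal_ofReal
  have hlim1 : Tendsto (fun r : ℝ => ∫⁻ s in Ioc 0 r,
      ∫⁻ z, ENNReal.ofReal (f (x + z)) * ENNReal.ofReal (P s z)) atTop
      (nhds (∫⁻ s in Ioi 0, ∫⁻ z, ENNReal.ofReal (f (x + z)) * ENNReal.ofReal (P s z))) :=
    by
      have h := ((aecover_Iic (μ := (volume : Measure ℝ)) (tendsto_id (α := ℝ)
        (x := atTop))).restrict (s := Ioi 0)).lintegral_tendsto_of_countably_generated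
          (hjoint.lintegral_prod_right' (ν := volume)).aemeasurable
      refine h.congr fun r => ?_
      rw [Measure.restrict_restrict measurableSet_Iic, inter_comm, id, Ioi_inter_Iic]
      rfl
  have hlim2 : Tendsto (fun r : ℝ => ∫⁻ s in Ioc 0 r,
      ∫⁻ z, ENNReal.ofReal (f (x + z)) * ENNReal.ofReal (P s z)) atTop
      (nhds (ENNReal.ofReal (capAverage w x 0 - L))) := by
    refine (ENNReal.tendsto_ofReal (hL.const_sub _)).congr' ?_
    filter_upwards [eventually_gt_atTop 0] with r hr
    exact (hIoc r hr).symm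
  rw [← tendsto_nhds_unique hlim1 hlim2, lintegral_lintegral_swap hjoint.aemeasurable]
  refine lintegral_congr_ae ?_
  have hne : ∀ᵐ z : EuclideanSpace ℝ (Fin N), z ≠ 0 := by
    simp [ae_iff]
  filter_upwards [hne] with z hz
  have hPz : Measurable fun s => P s z := hPm.comp measurable_prodMk_right
  rw [lintegral_const_mul _ hPz.ennreal_ofReal, lintegral_kernel_eq hN hz,
    ENNReal.ofReal_mul (hf0 _)]

/-- The Newtonian kernel `|z|^{2-N}`, without normalisation. -/
def newtonKernel {N : ℕ} (z : EuclideanSpace ℝ (Fin N)) : ℝ := (‖z‖ ^ (N - 2))⁻¹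

lemma newtonKernel_nonneg {N : ℕ} (z : EuclideanSpace ℝ (Fin N)) : 0 ≤ newtonKernel z := by
  unfold newtonKernel
  positivity

lemma newtonKernel_neg {N : ℕ} (z : EuclideanSpace ℝ (Fin N)) :
    newtonKernel (-z) = newtonKernel z := by
  simp [newtonKernel]

lemma measurable_newtonKernel {N : ℕ} : Measurable (newtonKernel (N := N)) := by
  unfold newtonKernel
  fun_prop

/-- A nonnegative superharmonic function on `ℝᴺ`, `N ≥ 3`, is a constant plus the Newtonian
potential of `-Δw`. -/
theorem exists_newton_representation {N : ℕ} (hN : 3 ≤ N) {w : EuclideanSpace ℝ (Fin N) → ℝ}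
    (hw : ContDiff ℝ 2 w) (hpos : ∀ x, 0 ≤ w x) (hlap : ∀ x, lap w x ≤ 0) :
    ∃ a : ℝ, 0 ≤ a ∧ ∃ c : ℝ, 0 < c ∧ ∀ x,
      Integrable (fun y => -lap w y * newtonKernel (x - y)) ∧
      w x = a + c * ∫ y, -lap w y * newtonKernel (x - y) := by
  obtain ⟨L, hL0, hL⟩ := exists_tendsto_capAverage hw hpos hlap
  set m : ℝ := ∫ y : EuclideanSpace ℝ (Fin N), cap y with hm
  have hm0 : 0 < m := integral_cap_pos
  set c : ℝ := ∫ t in Ioi 0, capWeight N t with hc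
  have hc0 : 0 < c := integral_capWeight_pos hN
  have hLm : ∀ x, L ≤ capAverage w x 0 := by
    intro x
    refine le_of_tendsto (hL x) ?_
    filter_upwards [eventually_ge_atTop 0] with r hr
    exact antitoneOn_capAverage hw hlap x (mem_Ici.2 le_rfl) (mem_Ici.2 hr) hr
  have hmeas : ∀ x, AEStronglyMeasurable
      (fun z => -lap w (x + z) * (c * (‖z‖ ^ (N - 2))⁻¹)) volume := by
    intro x
    refine (((continuous_lap hw).comp (by fun_prop)).neg.measurable.mul
      (measurable_newtonKernel.const_mul c)).aestronglyMeasurable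
  have hnn : ∀ x z, 0 ≤ -lap w (x + z) * (c * (‖z‖ ^ (N - 2))⁻¹) := fun x z =>
    mul_nonneg (neg_nonneg.2 (hlap _)) (mul_nonneg hc0.le (newtonKernel_nonneg z))
  refine ⟨L / m, by positivity, c / m, by positivity, fun x => ?_⟩
  have hlint := lintegral_mul_newton_eq hN hw hlap x (hL x)
  have hint : Integrable (fun z => -lap w (x + z) * (c * (‖z‖ ^ (N - 2))⁻¹)) := by
    refine ⟨hmeas x, ?_⟩
    rw [hasFiniteIntegral_iff_ofReal (Eventually.of_forall (hnn x)), hlint]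
    exact ENNReal.ofReal_lt_top
  have hval : ∫ z, -lap w (x + z) * (c * (‖z‖ ^ (N - 2))⁻¹) = capAverage w x 0 - L := by
    rw [integral_eq_lintegral_of_nonneg_ae (Eventually.of_forall (hnn x)) (hmeas x), hlint,
      ENNReal.toReal_ofReal (sub_nonneg.2 (hLm x))]
  have e : ∀ z, -lap w (x + z) * (c * (‖z‖ ^ (N - 2))⁻¹)
      = c * (fun y => -lap w y * newtonKernel (x - y)) (x + z) := by
    intro z
    simp only [sub_add_cancel_left, newtonKernel_neg]
    simp only [newtonKernel]
    ring
  simp only [e] at hint hval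
  rw [integral_const_mul, integral_add_left_eq_self
    (fun y => -lap w y * newtonKernel (x - y)) x, capAverage_zero] at hval
  constructor
  · have h1 := (integrable_const_mul_iff (isUnit_iff_ne_zero.2 hc0.ne') _).1 hint
    have h2 := h1.comp_add_left (-x)
    simpa using h2
  · rw [div_mul_eq_mul_div, hval, ← hm, ← add_div]
    field_simp
    ring

lemma newtonKernel_le_of_le {N : ℕ} {z : EuclideanSpace ℝ (Fin N)} {r : ℝ} (hr : 0 < r)
    (h : r ≤ ‖z‖) : newtonKernel z ≤ (r ^ (N - 2))⁻¹ := by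
  unfold newtonKernel
  gcongr

lemma integrableOn_newtonKernel {N : ℕ} (hN : 3 ≤ N) (r : ℝ) :
    IntegrableOn (newtonKernel (N := N)) (ball 0 r) := by
  have : Nonempty (Fin N) := ⟨⟨0, by omega⟩⟩
  have : Nontrivial (EuclideanSpace ℝ (Fin N)) := inferInstance
  refine (integrableOn_fun_norm_addHaar (volume : Measure (EuclideanSpace ℝ (Fin N)))
    (f := fun t : ℝ => (t ^ (N - 2))⁻¹)).2 ?_
  have h : IntegrableOn (fun t : ℝ => t) (Ioo 0 r) :=
    (continuous_id.integrableOn_Icc (a := 0) (b := r)).mono_set Ioo_subset_Icc_self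
  refine h.congr_fun (fun t ht => ?_) measurableSet_Ioo
  have ht0 : t ≠ 0 := ht.1.ne'
  simp only [finrank_euclideanSpace, Fintype.card_fin, smul_eq_mul]
  rw [show N - 1 = (N - 2) + 1 by omega, pow_succ]
  field_simp

/-- The integral of the Newtonian kernel over the unit ball. -/
def newtonMass (N : ℕ) : ℝ := ∫ z in ball (0 : EuclideanSpace ℝ (Fin N)) 1, newtonKernel z

lemma newtonMass_nonneg (N : ℕ) : 0 ≤ newtonMass N :=
  integral_nonneg fun z => newtonKernel_nonneg z

lemma integral_indicator_newtonKernel {N : ℕ} (hN : 3 ≤ N) {r : ℝ} (hr : 0 < r) :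
    ∫ z, (ball (0 : EuclideanSpace ℝ (Fin N)) r).indicator newtonKernel z
      = newtonMass N * r ^ 2 := by
  have := Measure.integral_comp_smul (volume : Measure (EuclideanSpace ℝ (Fin N)))
    ((ball (0 : EuclideanSpace ℝ (Fin N)) r).indicator newtonKernel) r
  have e : ∀ z : EuclideanSpace ℝ (Fin N),
      (ball (0 : EuclideanSpace ℝ (Fin N)) r).indicator newtonKernel (r • z)
      = (r ^ (N - 2))⁻¹ * (ball (0 : EuclideanSpace ℝ (Fin N)) 1).indicator newtonKernel z := by
    intro z
    have hmem : r • z ∈ ball (0 : EuclideanSpace ℝ (Fin N)) r ↔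
        z ∈ ball (0 : EuclideanSpace ℝ (Fin N)) 1 := by
      simp only [mem_ball, dist_zero_right, norm_smul, Real.norm_of_nonneg hr.le]
      exact mul_lt_iff_lt_one_right hr
    by_cases hz : z ∈ ball (0 : EuclideanSpace ℝ (Fin N)) 1
    · rw [indicator_of_mem hz, indicator_of_mem (hmem.2 hz)]
      simp [newtonKernel, norm_smul, abs_of_pos hr, mul_pow, mul_comm]
    · rw [indicator_of_notMem hz, indicator_of_notMem (mt hmem.1 hz), mul_zero]
  simp only [e, finrank_euclideanSpace, Fintype.card_fin, smul_eq_mul] at this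
  rw [integral_const_mul, integral_indicator measurableSet_ball, abs_of_pos (by positivity)]
    at this
  rw [newtonMass]
  have hpow : r ^ N = r ^ (N - 2) * r ^ 2 := by
    rw [← pow_add]
    congr 1
    omega
  rw [hpow] at this
  field_simp at this
  linarith

lemma integrable_indicator_newtonKernel {N : ℕ} (hN : 3 ≤ N) (r : ℝ)
    (x : EuclideanSpace ℝ (Fin N)) :
    Integrable fun y => (ball (0 : EuclideanSpace ℝ (Fin N)) r).indicator newtonKernel (x - y) :=
  ((integrable_indicator_iff measurableSet_ball).2
    (integrableOn_newtonKernel hN r)).comp_sub_left x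

/-- Splitting of a Newtonian potential into its near part and a bounded far part. -/
lemma integral_mul_newtonKernel_le {N : ℕ} (hN : 3 ≤ N) {f g : EuclideanSpace ℝ (Fin N) → ℝ}
    (x : EuclideanSpace ℝ (Fin N)) {B r : ℝ} (hr : 0 < r)
    (hB : ∀ y ∈ ball x r, f y ≤ B) (hg : Integrable g) (hg0 : ∀ y, 0 ≤ g y)
    (hfg : ∀ y ∉ ball x r, f y * newtonKernel (x - y) ≤ g y)
    (hint : Integrable fun y => f y * newtonKernel (x - y)) :
    ∫ y, f y * newtonKernel (x - y) ≤ B * (newtonMass N * r ^ 2) + ∫ y, g y := by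
  have hI := (integrable_indicator_newtonKernel hN r x).const_mul B
  have e : ∫ y, (ball (0 : EuclideanSpace ℝ (Fin N)) r).indicator newtonKernel (x - y)
      = newtonMass N * r ^ 2 := by
    rw [integral_sub_left_eq_self
      ((ball (0 : EuclideanSpace ℝ (Fin N)) r).indicator newtonKernel) volume x,
      integral_indicator_newtonKernel hN hr]
  rw [← e, ← integral_const_mul, ← integral_add hI hg]
  refine integral_mono hint (hI.add hg) fun y => ?_
  have hmem : x - y ∈ ball (0 : EuclideanSpace ℝ (Fin N)) r ↔ y ∈ ball x r := by
    rw [mem_ball_zero_iff, mem_ball, dist_comm, dist_eq_norm]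
  by_cases hy : y ∈ ball x r
  · simp only [indicator_of_mem (hmem.2 hy)]
    have := mul_le_mul_of_nonneg_right (hB y hy) (newtonKernel_nonneg (x - y))
    linarith [hg0 y]
  · simp only [indicator_of_notMem (mt hmem.1 hy), mul_zero, zero_add]
    exact hfg y hy

lemma integral_mul_newtonKernel_le_of_bound {N : ℕ} (hN : 3 ≤ N)
    {f : EuclideanSpace ℝ (Fin N) → ℝ} (hf0 : ∀ y, 0 ≤ f y) (hf : Integrable f)
    (x : EuclideanSpace ℝ (Fin N)) {B r : ℝ} (hr : 0 < r) (hB : ∀ y ∈ ball x r, f y ≤ B)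
    (hint : Integrable fun y => f y * newtonKernel (x - y)) :
    ∫ y, f y * newtonKernel (x - y)
      ≤ B * (newtonMass N * r ^ 2) + (r ^ (N - 2))⁻¹ * ∫ y, f y := by
  rw [← integral_const_mul]
  refine integral_mul_newtonKernel_le hN x hr hB (hf.const_mul _)
    (fun y => mul_nonneg (by positivity) (hf0 y)) (fun y hy => ?_) hint
  rw [mul_comm]
  refine mul_le_mul_of_nonneg_right (newtonKernel_le_of_le hr ?_) (hf0 y)
  rw [mem_ball, not_lt, dist_comm, dist_eq_norm] at hy
  exact hy

lemma tendsto_integral_mul_newtonKernel {N : ℕ} (hN : 3 ≤ N)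
    {f : EuclideanSpace ℝ (Fin N) → ℝ} (hf0 : ∀ y, 0 ≤ f y) (hf : Integrable f) {B : ℝ}
    (hB : ∀ y, f y ≤ B)
    (hint : ∀ x, Integrable fun y => f y * newtonKernel (x - y)) :
    Tendsto (fun x => ∫ y, f y * newtonKernel (x - y)) (cocompact _) (nhds 0) := by
  have : (cocompact (EuclideanSpace ℝ (Fin N))).IsCountablyGenerated := by
    rw [← Metric.cobounded_eq_cocompact, ← comap_norm_atTop]
    infer_instance
  have hfar : ∀ r : ℝ, 0 < r → Tendsto (fun x => ∫ y, f y * min (newtonKernel (x - y))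
      (r ^ (N - 2))⁻¹) (cocompact _) (nhds 0) := by
    intro r hr
    have h := tendsto_integral_filter_of_dominated_convergence (μ := volume)
      (l := cocompact (EuclideanSpace ℝ (Fin N)))
      (F := fun x y => f y * min (newtonKernel (x - y)) (r ^ (N - 2))⁻¹) (f := fun _ => (0 : ℝ))
      (fun y => (r ^ (N - 2))⁻¹ * f y)
      (Eventually.of_forall fun x => ?_) (Eventually.of_forall fun x =>
        Eventually.of_forall fun y => ?_) (hf.const_mul _) (Eventually.of_forall fun y => ?_)
    · simpa using h
    · exact hf.aestronglyMeasurable.mul (((measurable_newtonKernel.comp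
        (measurable_const.sub measurable_id)).min measurable_const).aestronglyMeasurable)
    · rw [Real.norm_of_nonneg (mul_nonneg (hf0 y)
        (le_min (newtonKernel_nonneg _) (by positivity))), mul_comm]
      exact mul_le_mul_of_nonneg_right (min_le_right _ _) (hf0 y)
    · have hk : Tendsto (fun x => newtonKernel (x - y)) (cocompact _) (nhds 0) := by
        have h1 : Tendsto (fun x : EuclideanSpace ℝ (Fin N) => ‖x - y‖) (cocompact _) atTop :=
          tendsto_norm_cocompact_atTop.comp
            (Homeomorph.subRight y).isClosedEmbedding.tendsto_cocompact
        exact ((tendsto_pow_atTop (by omega : N - 2 ≠ 0)).comp h1).inv_tendsto_atTop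
      have h2 : Tendsto (fun x => min (newtonKernel (x - y)) (r ^ (N - 2))⁻¹) (cocompact _)
          (nhds 0) := by
        have := hk.min (tendsto_const_nhds (x := (r ^ (N - 2))⁻¹))
        rwa [min_eq_left (by positivity)] at this
      simpa using h2.const_mul (f y)
  have hnn : ∀ x, 0 ≤ ∫ y, f y * newtonKernel (x - y) := fun x =>
    integral_nonneg fun y => mul_nonneg (hf0 y) (newtonKernel_nonneg _)
  have hmin : ∀ (r : ℝ), 0 < r → ∀ x : EuclideanSpace ℝ (Fin N), Integrable fun y =>
      f y * min (newtonKernel (x - y)) (r ^ (N - 2))⁻¹ := fun r hr x => by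
    refine (hint x).mono (hf.aestronglyMeasurable.mul (((measurable_newtonKernel.comp
        (measurable_const.sub measurable_id)).min measurable_const).aestronglyMeasurable))
        (Eventually.of_forall fun y => ?_)
    rw [Real.norm_of_nonneg (mul_nonneg (hf0 y)
        (le_min (newtonKernel_nonneg _) (by positivity))),
      Real.norm_of_nonneg (mul_nonneg (hf0 y) (newtonKernel_nonneg _))]
    exact mul_le_mul_of_nonneg_left (min_le_left _ _) (hf0 y)
  have hB0 : 0 ≤ B := (hf0 0).trans (hB 0)
  rw [Metric.tendsto_nhds]
  intro ε hε
  obtain ⟨r, hr, hrε⟩ : ∃ r : ℝ, 0 < r ∧ B * (newtonMass N * r ^ 2) < ε / 2 := by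
    have ht : Tendsto (fun r : ℝ => B * (newtonMass N * r ^ 2)) (nhdsWithin 0 (Ioi 0))
        (nhds 0) := by
      have : Continuous fun r : ℝ => B * (newtonMass N * r ^ 2) := by fun_prop
      simpa using (this.tendsto 0).mono_left nhdsWithin_le_nhds
    obtain ⟨r, h1, h2⟩ := ((ht.eventually (gt_mem_nhds (half_pos hε))).and
      self_mem_nhdsWithin).exists
    exact ⟨r, h2, h1⟩
  filter_upwards [(hfar r hr).eventually (gt_mem_nhds (half_pos hε))] with x hx
  rw [Real.dist_eq, sub_zero, abs_of_nonneg (hnn x)]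
  have := integral_mul_newtonKernel_le hN x hr (fun y _ => hB y) (hmin r hr x)
    (fun y => mul_nonneg (hf0 y) (le_min (newtonKernel_nonneg _) (by positivity)))
    (fun y hy => by
      rw [mem_ball, not_lt, dist_comm, dist_eq_norm] at hy
      rw [min_eq_left (newtonKernel_le_of_le hr hy)]) (hint x)
  linarith

/-- Bound for a subsolution of the integral Emden equation below the Serrin exponent. -/
lemma bounded_of_le_newton_potential {N : ℕ} (hN : 3 ≤ N) {p : ℝ} (hp : 1 < p)
    (hpN : p < (N : ℝ) / ((N : ℝ) - 2)) {v : EuclideanSpace ℝ (Fin N) → ℝ}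
    (hv : Continuous v) (hv0 : ∀ x, 0 ≤ v x) (hint : Integrable fun x => v x ^ p)
    (hpot : ∀ x, Integrable fun y => v y ^ p * newtonKernel (x - y)) {c : ℝ} (hc : 0 < c)
    (hle : ∀ x, v x ≤ c * ∫ y, v y ^ p * newtonKernel (x - y)) :
    ∃ B : ℝ, ∀ x, v x ≤ B := by
  have hN2 : (0 : ℝ) < (N : ℝ) - 2 := by
    have : (3 : ℝ) ≤ N := by exact_mod_cast hN
    linarith
  set F : ℝ := ∫ y, v y ^ p with hF
  have hF0 : 0 ≤ F := integral_nonneg fun y => rpow_nonneg (hv0 y) p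
  set α : ℝ := 2 / (p - 1) with hα
  have hp1 : 0 < p - 1 := by linarith
  have hα0 : 0 < α := by positivity
  set D : ℝ := c * ((2 ^ α) ^ p * (newtonMass N + 1)) with hD
  have hD0 : 0 < D := by
    have := newtonMass_nonneg N
    positivity
  set θ : ℝ := (p - 1) * (N - 2) / 2 with hθ
  have hθ1 : 0 < 1 - θ := by
    rw [lt_div_iff₀ hN2] at hpN
    rw [hθ]
    linarith
  set K : ℝ := 2 * (c * F * (2 * D) ^ (((N : ℝ) - 2) / 2)) with hK
  have hK0 : 0 ≤ K := by positivity
  refine ⟨max (K ^ (1 / (1 - θ))) (2 ^ α * (2 * D) ^ (-(1 / (p - 1)))), fun x => ?_⟩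
  obtain ⟨y₀, hy₀, hmax⟩ := (isCompact_closedBall x 1).exists_isMaxOn
    ⟨x, mem_closedBall_self zero_le_one⟩ (f := fun y => (1 - dist y x) ^ α * v y) (by
      refine ContinuousOn.mul (ContinuousOn.rpow_const (by fun_prop) ?_) hv.continuousOn
      intro _ _
      exact Or.inr hα0.le)
  set M := v y₀ with hM
  set d := 1 - dist y₀ x with hd
  have hd1 : d ≤ 1 := by
    have : 0 ≤ dist y₀ x := dist_nonneg
    linarith
  have hd0 : 0 ≤ d := sub_nonneg.2 hy₀
  have hx : v x ≤ d ^ α * M := by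
    have := hmax (mem_closedBall_self zero_le_one)
    simpa using this
  rcases (hv0 x).eq_or_lt with h0 | hvx
  · rw [← h0]
    exact le_max_of_le_left (by positivity)
  have hM0 : 0 < M := by
    refine (hv0 y₀).lt_of_ne fun h => ?_
    rw [hM, ← h, mul_zero] at hx
    linarith
  have hdpos : 0 < d := by
    refine hd0.lt_of_ne fun h => ?_
    rw [← h, zero_rpow hα0.ne', zero_mul] at hx
    linarith
  set σ : ℝ := (2 * D * M ^ (p - 1)) ^ (-(1 / 2) : ℝ) with hσ
  have hσ0 : 0 < σ := by positivity
  rcases le_or_gt σ (d / 2) with hsd | hsd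
  · refine le_max_of_le_left ?_
    have hball : ∀ y ∈ ball y₀ σ, v y ^ p ≤ (2 ^ α * M) ^ p := by
      intro y hy
      have hy1 : dist y y₀ < d / 2 := (mem_ball.1 hy).trans_le hsd
      have hyx : dist y x ≤ dist y y₀ + dist y₀ x := dist_triangle _ _ _
      have hdy : d / 2 ≤ 1 - dist y x := by linarith
      have h1 := hmax (show y ∈ closedBall x 1 from mem_closedBall.2 (by linarith))
      have h2 : (d / 2) ^ α * v y ≤ d ^ α * M :=
        (mul_le_mul_of_nonneg_right (rpow_le_rpow (by positivity) hdy hα0.le) (hv0 y)).trans h1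
      rw [div_rpow hd0 (by norm_num), div_mul_eq_mul_div, div_le_iff₀ (by positivity),
        mul_assoc, mul_comm M] at h2
      exact rpow_le_rpow (hv0 y) (le_of_mul_le_mul_left h2 (by positivity)) (by linarith)
    have h1 := integral_mul_newtonKernel_le_of_bound hN (fun y => rpow_nonneg (hv0 y) p) hint y₀
      hσ0 hball (hpot y₀)
    have h2 : M ≤ c * ((2 ^ α * M) ^ p * (newtonMass N * σ ^ 2) + (σ ^ (N - 2))⁻¹ * F) :=
      (hle y₀).trans (mul_le_mul_of_nonneg_left h1 hc.le)
    have hσ2 : σ ^ 2 = (2 * D * M ^ (p - 1))⁻¹ := by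
      rw [hσ, ← rpow_natCast, ← rpow_mul (by positivity)]
      rw [show (-(1 / 2) : ℝ) * ((2 : ℕ) : ℝ) = -1 by norm_num, rpow_neg_one]
    have hσN : (σ ^ (N - 2))⁻¹ = (2 * D) ^ (((N : ℝ) - 2) / 2) * M ^ θ := by
      rw [hσ, ← rpow_natCast, ← rpow_mul (by positivity), ← rpow_neg (by positivity),
        mul_rpow (by positivity) (by positivity), ← rpow_mul hM0.le,
        Nat.cast_sub (by omega : 2 ≤ N)]
      rw [show -(-(1 / 2) * ((N : ℝ) - (2 : ℕ))) = ((N : ℝ) - 2) / 2 by push_cast; ring,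
        show (p - 1) * (((N : ℝ) - 2) / 2) = θ by rw [hθ]; ring]
    have hnear : c * ((2 ^ α * M) ^ p * (newtonMass N * σ ^ 2)) ≤ M / 2 := by
      have hMp : M ^ p = M ^ (p - 1) * M := by
        rw [rpow_sub_one hM0.ne']
        field_simp
      calc c * ((2 ^ α * M) ^ p * (newtonMass N * σ ^ 2))
          ≤ c * ((2 ^ α * M) ^ p * ((newtonMass N + 1) * σ ^ 2)) := by
            gcongr
            linarith
        _ = D * M ^ p * σ ^ 2 := by
            rw [mul_rpow (by positivity) hM0.le, hD]
            ring
        _ = M / 2 := by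
            rw [hσ2, hMp]
            field_simp
    have hMK : M ≤ K * M ^ θ := by
      rw [hσN] at h2
      rw [hK]
      linarith
    have hMK' : M ^ (1 - θ) ≤ K := by
      rw [rpow_sub hM0, rpow_one, div_le_iff₀ (by positivity)]
      exact hMK
    calc v x ≤ d ^ α * M := hx
      _ ≤ 1 * M := by
        gcongr
        exact rpow_le_one hd0 hd1 hα0.le
      _ = (M ^ (1 - θ)) ^ (1 / (1 - θ)) := by
        rw [← rpow_mul hM0.le, mul_one_div_cancel hθ1.ne', rpow_one, one_mul]
      _ ≤ K ^ (1 / (1 - θ)) := rpow_le_rpow (by positivity) hMK' (by positivity)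
  · refine le_max_of_le_right (hx.trans ?_)
    have h1 : d ^ α ≤ (2 * σ) ^ α := rpow_le_rpow hd0 (by linarith) hα0.le
    have h2 : (2 * σ) ^ α * M = 2 ^ α * (2 * D) ^ (-(1 / (p - 1))) := by
      rw [mul_rpow (by positivity) hσ0.le, hσ, ← rpow_mul (by positivity),
        mul_rpow (by positivity) (by positivity), ← rpow_mul hM0.le]
      have e1 : -(1 / 2) * α = -(1 / (p - 1)) := by
        rw [hα]
        field_simp
      have e2 : (p - 1) * (-(1 / 2) * α) = -1 := by
        rw [hα]
        field_simp
      rw [e2, e1, rpow_neg_one]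
      field_simp
    rw [← h2]
    gcongr

lemma continuous_plasma {N : ℕ} {p : ℝ} (hp : 1 < p) {w : EuclideanSpace ℝ (Fin N) → ℝ}
    (hw : Continuous w) : Continuous fun x => max (w x - 1) 0 ^ p :=
  Continuous.rpow_const (by fun_prop) fun _ => Or.inr (by linarith)

lemma not_integrable_of_one_le_add_potential {N : ℕ} (hN : 3 ≤ N) {p : ℝ} (hp : 1 < p)
    (hpN : p < (N : ℝ) / ((N : ℝ) - 2)) {w : EuclideanSpace ℝ (Fin N) → ℝ}
    (hw : Continuous w) {a c : ℝ} (ha : 1 ≤ a) (hc : 0 < c)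
    (hpot : ∀ x, Integrable fun y => max (w y - 1) 0 ^ p * newtonKernel (x - y))
    (hrep : ∀ x, w x = a + c * ∫ y, max (w y - 1) 0 ^ p * newtonKernel (x - y))
    {x₁ : EuclideanSpace ℝ (Fin N)} (hx₁ : 1 < w x₁) :
    ¬ Integrable fun x => max (w x - 1) 0 ^ p := by
  intro hint
  have : Nonempty (Fin N) := ⟨⟨0, by omega⟩⟩
  set f : EuclideanSpace ℝ (Fin N) → ℝ := fun x => max (w x - 1) 0 ^ p with hf
  have hf0 : ∀ x, 0 ≤ f x := fun x => rpow_nonneg (le_max_right _ _) p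
  have hfc : Continuous f := continuous_plasma hp hw
  have hN2 : (0 : ℝ) < (N : ℝ) - 2 := by
    have : (3 : ℝ) ≤ N := by exact_mod_cast hN
    linarith
  set ρ : ℝ := ‖x₁‖ + 1 with hρ
  have hρ0 : 0 < ρ := by positivity
  set m : ℝ := ∫ y in ball (0 : EuclideanSpace ℝ (Fin N)) ρ, f y with hm
  have hm0 : 0 < m := by
    rw [hm, setIntegral_pos_iff_support_of_nonneg_ae (Eventually.of_forall hf0)
      hint.integrableOn]
    refine IsOpen.measure_pos _ ((hfc.isOpen_support).inter isOpen_ball) ⟨x₁, ?_, ?_⟩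
    · have : 0 < f x₁ := rpow_pos_of_pos (lt_max_of_lt_left (by linarith)) p
      exact this.ne'
    · simp [hρ]
  have hlow : ∀ x, c * m * ((‖x‖ + ρ) ^ (N - 2))⁻¹ ≤ w x - 1 := by
    intro x
    have h1 : m * ((‖x‖ + ρ) ^ (N - 2))⁻¹ ≤ ∫ y, f y * newtonKernel (x - y) := by
      rw [hm, ← integral_mul_const]
      refine le_trans ?_ (setIntegral_le_integral (s := ball 0 ρ) (hpot x)
        (Eventually.of_forall fun y => mul_nonneg (hf0 y) (newtonKernel_nonneg _)))
      have hne : ∀ᵐ y : EuclideanSpace ℝ (Fin N), y ≠ x := by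
        simp [ae_iff]
      refine setIntegral_mono_on_ae (hint.integrableOn.mul_const _) (hpot x).integrableOn
        measurableSet_ball ?_
      filter_upwards [hne] with y hyx hy
      refine mul_le_mul_of_nonneg_left ?_ (hf0 y)
      unfold newtonKernel
      have hpos : 0 < ‖x - y‖ := norm_pos_iff.2 (sub_ne_zero.2 hyx.symm)
      have hle : ‖x - y‖ ≤ ‖x‖ + ρ := by
        have := norm_sub_le x y
        rw [mem_ball_zero_iff] at hy
        linarith
      gcongr
    have h2 := hrep x
    have h3 := mul_le_mul_of_nonneg_left h1 hc.le
    rw [← mul_assoc] at h3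
    linarith
  set q : ℝ := ((N : ℝ) - 2) * p with hq
  have hqN : 0 < N - q := by
    rw [lt_div_iff₀ hN2] at hpN
    rw [hq]
    linarith
  set A : ℝ := volume.real (ball (0 : EuclideanSpace ℝ (Fin N)) 1) with hA
  have hA0 : 0 < A := by
    refine ENNReal.toReal_pos (measure_ball_pos _ _ one_pos).ne' measure_ball_lt_top.ne
  have hgrow : ∀ R : ℝ, ρ ≤ R → A * (c * m) ^ p * 2 ^ (-q) * R ^ (N - q) ≤ ∫ x, f x := by
    intro R hR
    have hR0 : 0 < R := hρ0.trans_le hR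
    have h1 : ∀ x ∈ ball (0 : EuclideanSpace ℝ (Fin N)) R,
        (c * m) ^ p * (2 * R) ^ (-q) ≤ f x := by
      intro x hx
      rw [mem_ball_zero_iff] at hx
      have h2 : c * m * ((2 * R) ^ (N - 2))⁻¹ ≤ max (w x - 1) 0 := by
        refine le_max_of_le_left (le_trans ?_ (hlow x))
        gcongr
        linarith
      refine le_trans (le_of_eq ?_) (rpow_le_rpow (by positivity) h2 (by linarith))
      have h3 : (c * m * ((2 * R) ^ (N - 2))⁻¹) ^ p = (c * m) ^ p * (((2 * R) ^ (N - 2))⁻¹) ^ p :=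
        mul_rpow (by positivity) (by positivity)
      rw [h3, ← rpow_natCast, ← rpow_neg (by positivity),
        ← rpow_mul (by positivity), Nat.cast_sub (by omega : 2 ≤ N), hq]
      congr 2
      push_cast
      ring
    calc A * (c * m) ^ p * 2 ^ (-q) * R ^ (N - q)
        = ∫ x in ball (0 : EuclideanSpace ℝ (Fin N)) R, (c * m) ^ p * (2 * R) ^ (-q) := by
          rw [setIntegral_const, measureReal_def, Measure.addHaar_ball_of_pos _ _ hR0,
            ENNReal.toReal_mul, ENNReal.toReal_ofReal (by positivity)]
          rw [finrank_euclideanSpace, Fintype.card_fin, mul_rpow (by norm_num) hR0.le,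
            sub_eq_add_neg, rpow_add hR0, rpow_natCast, hA, measureReal_def, smul_eq_mul]
          ring
      _ ≤ ∫ x in ball (0 : EuclideanSpace ℝ (Fin N)) R, f x :=
          setIntegral_mono_on (integrableOn_const measure_ball_lt_top.ne) hint.integrableOn
            measurableSet_ball h1
      _ ≤ _ := setIntegral_le_integral hint (Eventually.of_forall hf0)
  have ht : Tendsto (fun R : ℝ => A * (c * m) ^ p * 2 ^ (-q) * R ^ (N - q)) atTop atTop :=
    (tendsto_rpow_atTop hqN).const_mul_atTop (by positivity)
  obtain ⟨R, h1, h2⟩ := ((ht.eventually_gt_atTop (∫ x, f x)).and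
    (eventually_ge_atTop ρ)).exists
  exact absurd (hgrow R h2) (not_le.2 h1)

/-- Either `w` is constant, or it is `a < 1` plus a Newtonian potential and tends to `a`
at infinity. -/
lemma const_or_newton_potential {N : ℕ} (hN : 3 ≤ N) {p : ℝ} (hp : 1 < p)
    (hpN : p < (N : ℝ) / ((N : ℝ) - 2)) {w : EuclideanSpace ℝ (Fin N) → ℝ}
    (hsmooth : ContDiff ℝ 2 w) (hpos : ∀ x, 0 ≤ w x)
    (hpde : ∀ x, -lap w x = max (w x - 1) 0 ^ p)
    (hint : Integrable (fun x => max (w x - 1) 0 ^ p)) :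
    (∃ c : ℝ, c ∈ Set.Icc (0 : ℝ) 1 ∧ ∀ x, w x = c) ∨
    ∃ a : ℝ, a ∈ Set.Ico (0 : ℝ) 1 ∧ (∃ x₁, 1 < w x₁) ∧ Tendsto w (cocompact _) (nhds a) ∧
      ∃ c : ℝ, 0 < c ∧ ∀ x, Integrable (fun y => max (w y - 1) 0 ^ p * newtonKernel (x - y)) ∧
        w x = a + c * ∫ y, max (w y - 1) 0 ^ p * newtonKernel (x - y) := by
  have hf0 : ∀ x, 0 ≤ max (w x - 1) 0 ^ p := fun x => rpow_nonneg (le_max_right _ _) p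
  obtain ⟨a, ha, c, hc, hrep⟩ := exists_newton_representation hN hsmooth hpos
    (fun x => by linarith [hpde x, hf0 x])
  simp only [hpde] at hrep
  by_cases h1 : ∃ x₁, 1 < w x₁
  · right
    obtain ⟨x₁, hx₁⟩ := h1
    have ha1 : a < 1 := by
      by_contra! h
      exact not_integrable_of_one_le_add_potential hN hp hpN hsmooth.continuous h hc
        (fun x => (hrep x).1) (fun x => (hrep x).2) hx₁ hint
    refine ⟨a, ⟨ha, ha1⟩, ⟨x₁, hx₁⟩, ?_, c, hc, hrep⟩
    have hI0 : ∀ x, 0 ≤ c * ∫ y, max (w y - 1) 0 ^ p * newtonKernel (x - y) := fun x =>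
      mul_nonneg hc.le
        (integral_nonneg fun y => mul_nonneg (hf0 y) (newtonKernel_nonneg _))
    obtain ⟨B, hB⟩ := bounded_of_le_newton_potential hN hp hpN (v := fun x => max (w x - 1) 0)
      (by have := hsmooth.continuous; fun_prop) (fun x => le_max_right _ _) hint
      (fun x => (hrep x).1) hc (fun x => max_le (by linarith [(hrep x).2]) (hI0 x))
    have ht := tendsto_integral_mul_newtonKernel hN hf0 hint (B := B ^ p)
      (fun y => rpow_le_rpow (le_max_right _ _) (hB y) (by linarith)) (fun x => (hrep x).1)
    have := (ht.const_mul c).const_add a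
    rw [mul_zero, add_zero] at this
    exact this.congr fun x => ((hrep x).2).symm
  · left
    push Not at h1
    have hz : ∀ x, max (w x - 1) 0 ^ p = 0 := fun x => by
      rw [max_eq_right (by linarith [h1 x]), zero_rpow (by linarith)]
    have hwa : ∀ x, w x = a := fun x => by simpa [hz] using (hrep x).2
    exact ⟨a, ⟨ha, hwa 0 ▸ h1 0⟩, hwa⟩

/-- The reflection in the hyperplane `⟪e, x⟫ = t`, for a unit vector `e`. -/
def planeReflection {N : ℕ} (e : EuclideanSpace ℝ (Fin N)) (t : ℝ)
    (x : EuclideanSpace ℝ (Fin N)) : EuclideanSpace ℝ (Fin N) :=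
  x - (2 * (inner ℝ e x - t)) • e

lemma inner_planeReflection {N : ℕ} {e : EuclideanSpace ℝ (Fin N)} (he : ‖e‖ = 1) (t : ℝ)
    (x : EuclideanSpace ℝ (Fin N)) :
    inner ℝ e (planeReflection e t x) = 2 * t - inner ℝ e x := by
  unfold planeReflection
  rw [inner_sub_right, inner_smul_right, real_inner_self_eq_norm_sq, he]
  ring

lemma planeReflection_planeReflection {N : ℕ} {e : EuclideanSpace ℝ (Fin N)} (he : ‖e‖ = 1)
    (t : ℝ) (x : EuclideanSpace ℝ (Fin N)) :
    planeReflection e t (planeReflection e t x) = x := by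
  rw [planeReflection.eq_def e t (planeReflection e t x), inner_planeReflection he,
    planeReflection]
  module

lemma planeReflection_of_inner_eq {N : ℕ} {e x : EuclideanSpace ℝ (Fin N)} {t : ℝ}
    (h : inner ℝ e x = t) : planeReflection e t x = x := by
  simp [planeReflection, h]

lemma continuous_planeReflection {N : ℕ} (e : EuclideanSpace ℝ (Fin N)) :
    Continuous fun q : ℝ × EuclideanSpace ℝ (Fin N) => planeReflection e q.1 q.2 := by
  unfold planeReflection
  fun_prop

lemma measurePreserving_planeReflection {N : ℕ} {e : EuclideanSpace ℝ (Fin N)} (he : ‖e‖ = 1)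
    (t : ℝ) : MeasurePreserving (planeReflection e t) := by
  have h := (measurePreserving_add_left (volume : Measure (EuclideanSpace ℝ (Fin N)))
    ((2 * t) • e)).comp (LinearIsometryEquiv.measurePreserving (ℝ ∙ e)ᗮ.reflection)
  have hfun : planeReflection e t = (fun x => (2 * t) • e + x) ∘ (ℝ ∙ e)ᗮ.reflection := by
    funext x
    simp only [Function.comp_apply, Submodule.reflection_orthogonal_apply,
      Submodule.reflection_singleton_apply, he, planeReflection]
    simp only [RCLike.ofReal_real_eq_id, id_eq, one_pow, div_one]
    module
  rw [hfun]
  exact h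

lemma norm_sub_planeReflection_sq {N : ℕ} {e : EuclideanSpace ℝ (Fin N)} (he : ‖e‖ = 1) (t : ℝ)
    (x y : EuclideanSpace ℝ (Fin N)) :
    ‖x - planeReflection e t y‖ ^ 2
      = ‖x - y‖ ^ 2 + 4 * ((inner ℝ e x - t) * (inner ℝ e y - t)) := by
  have h : x - planeReflection e t y = (x - y) + (2 * (inner ℝ e y - t)) • e := by
    unfold planeReflection
    abel
  rw [h, norm_add_sq_real, inner_smul_right, norm_smul, he, inner_sub_left,
    real_inner_comm x e, real_inner_comm y e]
  rw [mul_one, norm_eq_abs, sq_abs]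
  ring

lemma norm_planeReflection_sub {N : ℕ} {e : EuclideanSpace ℝ (Fin N)} (he : ‖e‖ = 1) (t : ℝ)
    (x y : EuclideanSpace ℝ (Fin N)) :
    ‖planeReflection e t x - y‖ = ‖x - planeReflection e t y‖ := by
  rw [← sq_eq_sq₀ (norm_nonneg _) (norm_nonneg _), norm_sub_rev, norm_sub_planeReflection_sq he,
    norm_sub_planeReflection_sq he, norm_sub_rev]
  ring

lemma newtonKernel_planeReflection_sub {N : ℕ} {e : EuclideanSpace ℝ (Fin N)} (he : ‖e‖ = 1)
    (t : ℝ) (x y : EuclideanSpace ℝ (Fin N)) :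
    newtonKernel (planeReflection e t x - y) = newtonKernel (x - planeReflection e t y) := by
  rw [newtonKernel, newtonKernel, norm_planeReflection_sub he]

/-- The Green function of the half space `⟪e, x⟫ > t`, up to a constant. -/
def halfSpaceKernel {N : ℕ} (e : EuclideanSpace ℝ (Fin N)) (t : ℝ)
    (x y : EuclideanSpace ℝ (Fin N)) : ℝ :=
  newtonKernel (x - y) - newtonKernel (planeReflection e t x - y)

lemma halfSpaceKernel_planeReflection {N : ℕ} {e : EuclideanSpace ℝ (Fin N)} (he : ‖e‖ = 1)
    (t : ℝ) (x y : EuclideanSpace ℝ (Fin N)) :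
    halfSpaceKernel e t x (planeReflection e t y) = -halfSpaceKernel e t x y := by
  unfold halfSpaceKernel
  rw [newtonKernel_planeReflection_sub he, planeReflection_planeReflection he,
    newtonKernel_planeReflection_sub he]
  ring

lemma halfSpaceKernel_pos {N : ℕ} (hN : 3 ≤ N) {e : EuclideanSpace ℝ (Fin N)} (he : ‖e‖ = 1)
    {t : ℝ} {x y : EuclideanSpace ℝ (Fin N)} (hx : t < inner ℝ e x) (hy : t < inner ℝ e y)
    (hxy : y ≠ x) : 0 < halfSpaceKernel e t x y := by
  have h1 : 0 < ‖x - y‖ := norm_pos_iff.2 (sub_ne_zero.2 hxy.symm)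
  have h2 : ‖x - y‖ < ‖planeReflection e t x - y‖ := by
    refine lt_of_pow_lt_pow_left₀ 2 (norm_nonneg _) ?_
    rw [norm_planeReflection_sub he, norm_sub_planeReflection_sq he]
    have := mul_pos (sub_pos.2 hx) (sub_pos.2 hy)
    linarith
  unfold halfSpaceKernel newtonKernel
  refine sub_pos.2 (inv_strictAnti₀ (by positivity) (pow_lt_pow_left₀ h2 h1.le (by omega)))

lemma halfSpaceKernel_nonneg {N : ℕ} {e : EuclideanSpace ℝ (Fin N)} (he : ‖e‖ = 1)
    {t : ℝ} {x y : EuclideanSpace ℝ (Fin N)} (hx : t ≤ inner ℝ e x) (hy : t ≤ inner ℝ e y)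
    (hxy : y ≠ x) : 0 ≤ halfSpaceKernel e t x y := by
  have h1 : 0 < ‖x - y‖ := norm_pos_iff.2 (sub_ne_zero.2 hxy.symm)
  have h2 : ‖x - y‖ ≤ ‖planeReflection e t x - y‖ := by
    refine le_of_sq_le_sq ?_ (norm_nonneg _)
    rw [norm_planeReflection_sub he, norm_sub_planeReflection_sq he]
    have := mul_nonneg (sub_nonneg.2 hx) (sub_nonneg.2 hy)
    linarith
  unfold halfSpaceKernel newtonKernel
  refine sub_nonneg.2 ?_
  gcongr

/-- `w` is a constant plus the Newtonian potential of `φ ∘ w`, where `φ` vanishes below level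
`1` and `w` is at most `1` outside of a ball. -/
structure IsPlasmaPotential {N : ℕ} (φ : ℝ → ℝ) (w : EuclideanSpace ℝ (Fin N) → ℝ)
    (a c L ρ : ℝ) : Prop where
  monotone : Monotone φ
  continuous_source : Continuous φ
  eq_zero : ∀ s ≤ 1, φ s = 0
  L_pos : 0 < L
  sub_le : ∀ x y, φ (w x) - φ (w y) ≤ L * max (w x - w y) 0
  continuous_w : Continuous w
  le_one : ∀ x, ρ ≤ ‖x‖ → w x ≤ 1
  c_pos : 0 < c
  integrable : ∀ x, Integrable fun y => φ (w y) * newtonKernel (x - y)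
  eq_potential : ∀ x, w x = a + c * ∫ y, φ (w y) * newtonKernel (x - y)

namespace IsPlasmaPotential

variable {N : ℕ} {φ : ℝ → ℝ} {w : EuclideanSpace ℝ (Fin N) → ℝ} {a c L ρ : ℝ}

lemma source_eq_zero (H : IsPlasmaPotential φ w a c L ρ) {x : EuclideanSpace ℝ (Fin N)}
    (hx : ρ ≤ ‖x‖) : φ (w x) = 0 := H.eq_zero _ (H.le_one x hx)

lemma source_nonneg (H : IsPlasmaPotential φ w a c L ρ) (s : ℝ) : 0 ≤ φ s := by
  have h := H.monotone (min_le_left s 1)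
  rwa [H.eq_zero _ (min_le_right s 1)] at h

lemma continuous_source_comp (H : IsPlasmaPotential φ w a c L ρ) :
    Continuous fun x => φ (w x) := H.continuous_source.comp H.continuous_w

lemma hasCompactSupport (H : IsPlasmaPotential φ w a c L ρ) :
    HasCompactSupport fun x => φ (w x) := by
  refine HasCompactSupport.intro (isCompact_closedBall 0 ρ) fun x hx => H.source_eq_zero ?_
  simpa using (not_le.1 (by simpa using hx)).le

lemma integrable_mul_halfSpaceKernel (H : IsPlasmaPotential φ w a c L ρ)
    (e : EuclideanSpace ℝ (Fin N)) (t : ℝ) (x : EuclideanSpace ℝ (Fin N)) :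
    Integrable fun y => φ (w y) * halfSpaceKernel e t x y := by
  simp only [halfSpaceKernel, mul_sub]
  exact (H.integrable x).sub (H.integrable _)

lemma integrable_reflected (H : IsPlasmaPotential φ w a c L ρ)
    {e : EuclideanSpace ℝ (Fin N)} (he : ‖e‖ = 1) (t : ℝ) (x : EuclideanSpace ℝ (Fin N)) :
    Integrable fun y => (φ (w y) - φ (w (planeReflection e t y))) * halfSpaceKernel e t x y := by
  have h1 := H.integrable_mul_halfSpaceKernel e t x
  have h2 := (measurePreserving_planeReflection he t).integrable_comp_of_integrable h1
  simp only [Function.comp_def, halfSpaceKernel_planeReflection he] at h2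
  refine (h1.add h2).congr (Eventually.of_forall fun y => ?_)
  simp only [Pi.add_apply]
  ring

lemma two_mul_sub_eq (H : IsPlasmaPotential φ w a c L ρ)
    {e : EuclideanSpace ℝ (Fin N)} (he : ‖e‖ = 1) (t : ℝ) (x : EuclideanSpace ℝ (Fin N)) :
    2 * (w x - w (planeReflection e t x)) = c * ∫ y,
      (φ (w y) - φ (w (planeReflection e t y))) * halfSpaceKernel e t x y := by
  have h1 := H.integrable_mul_halfSpaceKernel e t x
  have hmp := measurePreserving_planeReflection he t
  have h2 := hmp.integrable_comp_of_integrable h1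
  have hinv : Function.Involutive (planeReflection e t) := planeReflection_planeReflection he t
  have hcont : Continuous (planeReflection e t) :=
    (continuous_planeReflection e).comp (continuous_const.prodMk continuous_id)
  have hemb : MeasurableEmbedding (planeReflection e t) :=
    hcont.measurableEmbedding hinv.injective
  have h3 := hmp.integral_comp hemb fun y => φ (w y) * halfSpaceKernel e t x y
  simp only [Function.comp_def, halfSpaceKernel_planeReflection he] at h2 h3
  have h4 : w x - w (planeReflection e t x) = c * ∫ y, φ (w y) * halfSpaceKernel e t x y := by
    simp only [halfSpaceKernel, mul_sub]
    rw [integral_sub (H.integrable x) (H.integrable _), H.eq_potential x,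
      H.eq_potential (planeReflection e t x)]
    ring
  have h5 : ∫ y, (φ (w y) - φ (w (planeReflection e t y))) * halfSpaceKernel e t x y
      = (∫ y, φ (w y) * halfSpaceKernel e t x y)
        + ∫ y, φ (w (planeReflection e t y)) * -halfSpaceKernel e t x y := by
    rw [← integral_add h1 h2]
    congr 1
    ext y
    ring
  rw [h5, h3, two_mul, h4]
  ring

/-- The set where the moving plane inequality fails. -/
def badSet {N : ℕ} (w : EuclideanSpace ℝ (Fin N) → ℝ) (e : EuclideanSpace ℝ (Fin N)) (t : ℝ) :
    Set (EuclideanSpace ℝ (Fin N)) :=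
  {y | t ≤ inner ℝ e y ∧ 1 < w y ∧ w (planeReflection e t y) < w y}

lemma measurableSet_badSet (H : IsPlasmaPotential φ w a c L ρ) (e : EuclideanSpace ℝ (Fin N))
    (t : ℝ) : MeasurableSet (badSet w e t) := by
  have hw := H.continuous_w
  have hcont : Continuous (planeReflection e t) :=
    (continuous_planeReflection e).comp (continuous_const.prodMk continuous_id)
  have hi : Continuous fun y : EuclideanSpace ℝ (Fin N) => inner ℝ e y := by fun_prop
  exact (isClosed_le continuous_const hi).measurableSet.inter
    ((isOpen_lt continuous_const hw).measurableSet.inter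
      (isOpen_lt (hw.comp hcont) hw).measurableSet)

lemma badSet_subset_ball (H : IsPlasmaPotential φ w a c L ρ) (e : EuclideanSpace ℝ (Fin N))
    (t : ℝ) : badSet w e t ⊆ ball 0 ρ := by
  intro y hy
  rw [mem_ball_zero_iff]
  by_contra! h
  exact absurd hy.2.1 (not_lt.2 (H.le_one y h))

lemma integral_indicator_mul_newtonKernel_le (hN : 3 ≤ N) {S : Set (EuclideanSpace ℝ (Fin N))}
    (hS : MeasurableSet S) (hS' : volume S ≠ ⊤) (x : EuclideanSpace ℝ (Fin N)) {r : ℝ}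
    (hr : 0 < r) :
    (Integrable fun y => S.indicator (fun _ => (1 : ℝ)) y * newtonKernel (x - y)) ∧
    ∫ y, S.indicator (fun _ => (1 : ℝ)) y * newtonKernel (x - y)
      ≤ newtonMass N * r ^ 2 + (r ^ (N - 2))⁻¹ * volume.real S := by
  have hi : Integrable (S.indicator fun _ => (1 : ℝ)) :=
    (integrable_indicator_iff hS).2 (integrableOn_const hS')
  have h0 : ∀ y, 0 ≤ S.indicator (fun _ => (1 : ℝ)) y := fun y =>
    indicator_nonneg (fun _ _ => zero_le_one) y
  have h1 : ∀ y, S.indicator (fun _ => (1 : ℝ)) y ≤ 1 := fun y =>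
    indicator_le_self' (fun _ _ => zero_le_one) y
  have hint : Integrable fun y => S.indicator (fun _ => (1 : ℝ)) y * newtonKernel (x - y) := by
    refine Integrable.mono' ((integrable_indicator_newtonKernel hN 1 x).add hi)
      (hi.aestronglyMeasurable.mul ((measurable_newtonKernel.comp
        (measurable_const.sub measurable_id)).aestronglyMeasurable))
      (Eventually.of_forall fun y => ?_)
    rw [norm_of_nonneg (mul_nonneg (h0 y) (newtonKernel_nonneg _)), Pi.add_apply]
    by_cases hy : x - y ∈ ball (0 : EuclideanSpace ℝ (Fin N)) 1
    · rw [indicator_of_mem hy]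
      nlinarith [h0 y, h1 y, newtonKernel_nonneg (x - y)]
    · rw [indicator_of_notMem hy, zero_add]
      have h2 : 1 ≤ ‖x - y‖ := by simpa using hy
      have h3 := newtonKernel_le_of_le one_pos h2
      simp only [one_pow, inv_one] at h3
      exact mul_le_of_le_one_right (h0 y) h3
  refine ⟨hint, ?_⟩
  have h := integral_mul_newtonKernel_le_of_bound hN h0 hi x hr (fun y _ => h1 y) hint
  rwa [one_mul, integral_indicator_const _ hS, smul_eq_mul, mul_one] at h

lemma sub_reflected_le (H : IsPlasmaPotential φ w a c L ρ) (hN : 3 ≤ N)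
    {e : EuclideanSpace ℝ (Fin N)} (he : ‖e‖ = 1) {t M r : ℝ} (hr : 0 < r) (hM0 : 0 ≤ M)
    (hM : ∀ y, t ≤ inner ℝ e y → w y - w (planeReflection e t y) ≤ M)
    {x : EuclideanSpace ℝ (Fin N)} (hx : t ≤ inner ℝ e x) :
    w x - w (planeReflection e t x)
      ≤ c * L * M * (newtonMass N * r ^ 2 +
        (r ^ (N - 2))⁻¹ * (2 * volume.real (badSet w e t))) := by
  have : Nontrivial (EuclideanSpace ℝ (Fin N)) := by
    have : Nonempty (Fin N) := ⟨⟨0, by omega⟩⟩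
    infer_instance
  have hmp := measurePreserving_planeReflection he t
  have hBm := H.measurableSet_badSet e t
  have hBf : volume (badSet w e t) ≠ ⊤ :=
    measure_ne_top_of_subset (H.badSet_subset_ball e t) measure_ball_lt_top.ne
  set S := badSet w e t ∪ planeReflection e t ⁻¹' badSet w e t with hSdef
  have hSm : MeasurableSet S := hBm.union (hmp.measurable hBm)
  have hvol : volume (planeReflection e t ⁻¹' badSet w e t) = volume (badSet w e t) :=
    hmp.measure_preimage hBm.nullMeasurableSet
  have hSf : volume S ≠ ⊤ := by
    refine ((measure_union_le _ _).trans_lt ?_).ne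
    rw [hvol]
    exact ENNReal.add_lt_top.2 ⟨hBf.lt_top, hBf.lt_top⟩
  have hSv : volume.real S ≤ 2 * volume.real (badSet w e t) := by
    refine (measureReal_union_le _ _).trans_eq ?_
    rw [measureReal_def, measureReal_def, hvol]
    ring
  have hne : ∀ z : EuclideanSpace ℝ (Fin N), ∀ᵐ y : EuclideanSpace ℝ (Fin N), y ≠ z := by
    intro z
    simp [ae_iff]
  -- the source inequality on the half space
  have hkey : ∀ y, t ≤ inner ℝ e y → y ≠ x →
      (φ (w y) - φ (w (planeReflection e t y))) * halfSpaceKernel e t x y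
        ≤ L * M * (S.indicator (fun _ => (1 : ℝ)) y * newtonKernel (x - y)
          + S.indicator (fun _ => (1 : ℝ)) y * newtonKernel (planeReflection e t x - y)) := by
    intro y hy hyx
    have hD := halfSpaceKernel_nonneg he hx hy hyx
    have hk1 := newtonKernel_nonneg (x - y)
    have hk2 := newtonKernel_nonneg (planeReflection e t x - y)
    by_cases hyB : y ∈ badSet w e t
    · rw [indicator_of_mem (show y ∈ S from Or.inl hyB), one_mul, one_mul]
      have h1 : φ (w y) - φ (w (planeReflection e t y)) ≤ L * M :=
        (H.sub_le _ _).trans (mul_le_mul_of_nonneg_left (max_le (hM y hy) hM0) H.L_pos.le)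
      have h2 : halfSpaceKernel e t x y
          ≤ newtonKernel (x - y) + newtonKernel (planeReflection e t x - y) := by
        unfold halfSpaceKernel
        linarith
      exact mul_le_mul h1 h2 hD (mul_nonneg H.L_pos.le hM0)
    · have h1 : φ (w y) - φ (w (planeReflection e t y)) ≤ 0 := by
        by_cases h1y : 1 < w y
        · refine sub_nonpos.2 (H.monotone ?_)
          by_contra! h
          exact hyB ⟨hy, h1y, h⟩
        · rw [H.eq_zero _ (not_lt.1 h1y)]
          linarith [H.source_nonneg (w (planeReflection e t y))]
      refine (mul_nonpos_of_nonpos_of_nonneg h1 hD).trans ?_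
      have h0 : 0 ≤ S.indicator (fun _ => (1 : ℝ)) y :=
        indicator_nonneg (fun _ _ => zero_le_one) y
      have := H.L_pos.le
      positivity
  have hSsymm : ∀ y, S.indicator (fun _ => (1 : ℝ)) (planeReflection e t y)
      = S.indicator (fun _ => (1 : ℝ)) y := by
    intro y
    have : planeReflection e t y ∈ S ↔ y ∈ S := by
      rw [hSdef]
      simp only [mem_union, mem_preimage, planeReflection_planeReflection he]
      exact or_comm
    by_cases hy : y ∈ S
    · rw [indicator_of_mem hy, indicator_of_mem (this.2 hy)]
    · rw [indicator_of_notMem hy, indicator_of_notMem (mt this.1 hy)]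
  have hall : ∀ᵐ y, (φ (w y) - φ (w (planeReflection e t y))) * halfSpaceKernel e t x y
        ≤ L * M * (S.indicator (fun _ => (1 : ℝ)) y * newtonKernel (x - y)
          + S.indicator (fun _ => (1 : ℝ)) y * newtonKernel (planeReflection e t x - y)) := by
    filter_upwards [hne x, hne (planeReflection e t x)] with y hy1 hy2
    rcases le_total t (inner ℝ e y) with hy | hy
    · exact hkey y hy hy1
    · have h1 : t ≤ inner ℝ e (planeReflection e t y) := by
        rw [inner_planeReflection he]
        linarith
      have h2 : planeReflection e t y ≠ x := by
        rintro rfl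
        exact hy2 (planeReflection_planeReflection he t y).symm
      have h3 := hkey _ h1 h2
      rw [halfSpaceKernel_planeReflection he, planeReflection_planeReflection he, hSsymm,
        newtonKernel_planeReflection_sub he, planeReflection_planeReflection he,
        ← newtonKernel_planeReflection_sub he] at h3
      linarith
  obtain ⟨hi1, hb1⟩ := integral_indicator_mul_newtonKernel_le hN hSm hSf x hr
  obtain ⟨hi2, hb2⟩ :=
    integral_indicator_mul_newtonKernel_le hN hSm hSf (planeReflection e t x) hr
  have hI := integral_mono_ae (H.integrable_reflected he t x) ((hi1.add hi2).const_mul (L * M)) hall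
  rw [integral_const_mul, integral_add' hi1 hi2] at hI
  have hE := H.two_mul_sub_eq he t x
  have hT : newtonMass N * r ^ 2 + (r ^ (N - 2))⁻¹ * volume.real S
      ≤ newtonMass N * r ^ 2 + (r ^ (N - 2))⁻¹ * (2 * volume.real (badSet w e t)) := by gcongr
  have hLM : 0 ≤ L * M := mul_nonneg H.L_pos.le hM0
  have hfin := mul_le_mul_of_nonneg_left (hI.trans (mul_le_mul_of_nonneg_left
    (add_le_add (hb1.trans hT) (hb2.trans hT)) hLM)) H.c_pos.le
  rw [← hE] at hfin
  linarith

lemma exists_bound (H : IsPlasmaPotential φ w a c L ρ) :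
    ∃ M, 0 ≤ M ∧ ∀ x y, w x - w y ≤ M := by
  have hK := (isCompact_closedBall (0 : EuclideanSpace ℝ (Fin N)) ρ).bddAbove_image
    H.continuous_w.continuousOn
  obtain ⟨B, hB⟩ := hK
  have hlow : ∀ y, a ≤ w y := fun y => by
    rw [H.eq_potential y]
    have : 0 ≤ ∫ z, φ (w z) * newtonKernel (y - z) := integral_nonneg fun z =>
      mul_nonneg (H.source_nonneg (w z)) (newtonKernel_nonneg (y - z))
    nlinarith [H.c_pos]
  have hup : ∀ x, w x ≤ max B 1 := fun x => by
    rcases le_total ρ ‖x‖ with h | h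
    · exact (H.le_one x h).trans (le_max_right _ _)
    · exact (hB ⟨x, by simpa using h, rfl⟩).trans (le_max_left _ _)
  refine ⟨max B 1 - a, by linarith [hlow 0, hup 0], fun x y => ?_⟩
  linarith [hlow y, hup x]

/-- The moving plane inequality holds as soon as it fails on a small set only. -/
lemma exists_small_badSet (H : IsPlasmaPotential φ w a c L ρ) (hN : 3 ≤ N) :
    ∃ v : ℝ, 0 < v ∧ ∀ e : EuclideanSpace ℝ (Fin N), ‖e‖ = 1 → ∀ t,
      volume.real (badSet w e t) ≤ v → ∀ x, t ≤ inner ℝ e x → w x ≤ w (planeReflection e t x) := by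
  have hcL : 0 < c * L := mul_pos H.c_pos H.L_pos
  have hlim : Tendsto (fun r : ℝ => c * L * (newtonMass N * r ^ 2)) (nhdsWithin 0 (Ioi 0))
      (nhds 0) := by
    have : Continuous fun r : ℝ => c * L * (newtonMass N * r ^ 2) := by fun_prop
    simpa using (this.tendsto 0).mono_left nhdsWithin_le_nhds
  obtain ⟨r, hr1, hr⟩ := ((hlim.eventually_lt_const (show (0 : ℝ) < 1 / 4 by norm_num)).and
    self_mem_nhdsWithin).exists
  have hr0 : (0 : ℝ) < r := hr
  refine ⟨r ^ (N - 2) / (8 * (c * L)), by positivity, fun e he t hv => ?_⟩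
  obtain ⟨M, hM0, hM⟩ := H.exists_bound
  have hhalf : c * L * (newtonMass N * r ^ 2
      + (r ^ (N - 2))⁻¹ * (2 * volume.real (badSet w e t))) ≤ 1 / 2 := by
    have h1 : c * L * ((r ^ (N - 2))⁻¹ * (2 * volume.real (badSet w e t)))
        ≤ c * L * ((r ^ (N - 2))⁻¹ * (2 * (r ^ (N - 2) / (8 * (c * L))))) := by gcongr
    have h2 : c * L * ((r ^ (N - 2))⁻¹ * (2 * (r ^ (N - 2) / (8 * (c * L))))) = 1 / 4 := by
      have := H.c_pos.ne'
      have := H.L_pos.ne'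
      field_simp
      norm_num
    rw [mul_add]
    linarith
  have hiter : ∀ n : ℕ, ∀ x, t ≤ inner ℝ e x →
      w x - w (planeReflection e t x) ≤ M * (1 / 2) ^ n := by
    intro n
    induction n with
    | zero => intro x _; simpa using hM x _
    | succ n ih =>
      intro x hx
      refine (H.sub_reflected_le hN he hr0 (by positivity) ih hx).trans ?_
      rw [pow_succ (1 / 2 : ℝ) n, ← mul_assoc]
      have := mul_le_mul_of_nonneg_left hhalf (by positivity : 0 ≤ M * (1 / 2) ^ n)
      linarith
  intro x hx
  have hl : Tendsto (fun n : ℕ => M * (1 / 2 : ℝ) ^ n) atTop (nhds (M * 0)) :=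
    (tendsto_pow_atTop_nhds_zero_of_lt_one (by norm_num) (by norm_num)).const_mul M
  rw [mul_zero] at hl
  exact sub_nonpos.1 (ge_of_tendsto' hl fun n => hiter n x hx)

/-- The barycenter of the source. -/
def barycenter {N : ℕ} (f : EuclideanSpace ℝ (Fin N) → ℝ) : EuclideanSpace ℝ (Fin N) :=
  (∫ y, f y)⁻¹ • ∫ y, f y • y

lemma inner_barycenter (H : IsPlasmaPotential φ w a c L ρ) (e : EuclideanSpace ℝ (Fin N)) :
    inner ℝ e (barycenter fun y => φ (w y))
      = (∫ y, φ (w y))⁻¹ * ∫ y, φ (w y) * inner ℝ e y := by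
  have hi : Integrable fun y => φ (w y) • y :=
    (H.continuous_source_comp.smul continuous_id).integrable_of_hasCompactSupport
      H.hasCompactSupport.smul_right
  rw [barycenter, inner_smul_right, ← integral_inner hi]
  simp only [inner_smul_right]

lemma inner_barycenter_eq_of_symm (H : IsPlasmaPotential φ w a c L ρ)
    (hmass : 0 < ∫ y, φ (w y)) {e : EuclideanSpace ℝ (Fin N)} (he : ‖e‖ = 1) {t : ℝ}
    (hsymm : ∀ᵐ y, φ (w y) = φ (w (planeReflection e t y))) :
    inner ℝ e (barycenter fun y => φ (w y)) = t := by
  have hmp := measurePreserving_planeReflection he t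
  have hcont : Continuous (planeReflection e t) :=
    (continuous_planeReflection e).comp (continuous_const.prodMk continuous_id)
  have hinv : Function.Involutive (planeReflection e t) := planeReflection_planeReflection he t
  have hemb : MeasurableEmbedding (planeReflection e t) :=
    hcont.measurableEmbedding hinv.injective
  have hi0 : Integrable fun y => φ (w y) :=
    H.continuous_source_comp.integrable_of_hasCompactSupport H.hasCompactSupport
  have hi1 : Integrable fun y => φ (w y) * inner ℝ e y :=
    (H.continuous_source_comp.mul (by fun_prop)).integrable_of_hasCompactSupport
      H.hasCompactSupport.mul_right
  have h1 := hmp.integral_comp hemb fun y => φ (w y) * inner ℝ e y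
  have h2 : ∫ y, φ (w (planeReflection e t y)) * inner ℝ e (planeReflection e t y)
      = 2 * t * (∫ y, φ (w y)) - ∫ y, φ (w y) * inner ℝ e y := by
    rw [← integral_const_mul, ← integral_sub (hi0.const_mul _) hi1]
    refine integral_congr_ae ?_
    filter_upwards [hsymm] with y hy
    rw [← hy, inner_planeReflection he]
    ring
  rw [H.inner_barycenter, ← div_eq_inv_mul, div_eq_iff hmass.ne']
  linarith

lemma lt_reflected (H : IsPlasmaPotential φ w a c L ρ) (hN : 3 ≤ N)
    (hmass : 0 < ∫ y, φ (w y)) {e : EuclideanSpace ℝ (Fin N)} (he : ‖e‖ = 1) {t : ℝ}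
    (ht : inner ℝ e (barycenter fun y => φ (w y)) < t)
    (hle : ∀ x, t ≤ inner ℝ e x → w x ≤ w (planeReflection e t x))
    {x : EuclideanSpace ℝ (Fin N)} (hx : t < inner ℝ e x) :
    w x < w (planeReflection e t x) := by
  refine (hle x hx.le).lt_of_ne fun heq => ht.ne ?_
  refine H.inner_barycenter_eq_of_symm hmass he ?_
  have : Nontrivial (EuclideanSpace ℝ (Fin N)) := by
    have : Nonempty (Fin N) := ⟨⟨0, by omega⟩⟩
    infer_instance
  have hne : ∀ z : EuclideanSpace ℝ (Fin N), ∀ᵐ y : EuclideanSpace ℝ (Fin N), y ≠ z := by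
    intro z
    simp [ae_iff]
  have hsrc : ∀ y, t ≤ inner ℝ e y → φ (w y) - φ (w (planeReflection e t y)) ≤ 0 := fun y hy =>
    sub_nonpos.2 (H.monotone (hle y hy))
  have hneg : ∀ y, inner ℝ e y < t → t < inner ℝ e (planeReflection e t y) := fun y hy => by
    rw [inner_planeReflection he]
    linarith
  have hE := H.two_mul_sub_eq he t x
  rw [heq, sub_self, mul_zero, eq_comm, mul_eq_zero, or_iff_right H.c_pos.ne', ← neg_eq_zero,
    ← integral_neg] at hE
  rw [integral_eq_zero_iff_of_nonneg_ae (f := fun y =>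
    -((φ (w y) - φ (w (planeReflection e t y))) * halfSpaceKernel e t x y)) ?_
    (H.integrable_reflected he t x).neg] at hE
  · filter_upwards [hE, hne x, hne (planeReflection e t x)] with y hy hy1 hy2
    have hy : (φ (w y) - φ (w (planeReflection e t y))) * halfSpaceKernel e t x y = 0 := by
      simpa using hy
    rcases lt_trichotomy t (inner ℝ e y) with h | h | h
    · have := halfSpaceKernel_pos hN he hx h hy1
      rcases mul_eq_zero.1 hy with h1 | h1
      · exact sub_eq_zero.1 h1
      · exact absurd h1 this.ne'
    · rw [planeReflection_of_inner_eq h.symm]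
    · have h2 : planeReflection e t y ≠ x := by
        rintro rfl
        exact hy2 (planeReflection_planeReflection he t y).symm
      have := halfSpaceKernel_pos hN he hx (hneg y h) h2
      rw [halfSpaceKernel_planeReflection he] at this
      rcases mul_eq_zero.1 hy with h1 | h1
      · exact sub_eq_zero.1 h1
      · linarith
  · filter_upwards [hne x, hne (planeReflection e t x)] with y hy1 hy2
    rw [Pi.zero_apply]
    rcases le_or_gt t (inner ℝ e y) with h | h
    · have h1 := halfSpaceKernel_nonneg he hx.le h hy1
      nlinarith [hsrc y h]
    · have h2 : planeReflection e t y ≠ x := by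
        rintro rfl
        exact hy2 (planeReflection_planeReflection he t y).symm
      have h1 := halfSpaceKernel_nonneg he hx.le (hneg y h).le h2
      have h3 := hsrc _ (hneg y h).le
      rw [planeReflection_planeReflection he] at h3
      rw [halfSpaceKernel_planeReflection he] at h1
      nlinarith

lemma tendsto_volume_badSet (H : IsPlasmaPotential φ w a c L ρ)
    {e : EuclideanSpace ℝ (Fin N)} (he : ‖e‖ = 1) {t : ℝ}
    (hlt : ∀ x, t < inner ℝ e x → w x < w (planeReflection e t x)) :
    Tendsto (fun s => volume.real (badSet w e s)) (nhds t) (nhds 0) := by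
  have hplane : volume {y : EuclideanSpace ℝ (Fin N) | inner ℝ e y = t} = 0 := by
    have hs := Measure.addHaar_affineSubspace (volume : Measure (EuclideanSpace ℝ (Fin N)))
      (AffineSubspace.mk' (t • e) (ℝ ∙ e)ᗮ) ?_
    · convert hs using 2
      ext y
      simp only [mem_ofPred_eq, SetLike.mem_coe, AffineSubspace.mem_mk', vsub_eq_sub,
        Submodule.mem_orthogonal_singleton_iff_inner_right, inner_sub_right, inner_smul_right,
        real_inner_self_eq_norm_sq, he]
      constructor <;> intro h <;> linarith
    · intro h
      have h1 : (t + 1) • e ∈ AffineSubspace.mk' (t • e) (ℝ ∙ e)ᗮ := by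
        rw [h]
        trivial
      simp [AffineSubspace.mem_mk', Submodule.mem_orthogonal_singleton_iff_inner_right,
        inner_sub_right, inner_smul_right, he] at h1
  have hlim : ∀ᵐ y : EuclideanSpace ℝ (Fin N), ∀ᶠ s in nhds t,
      y ∈ badSet w e s ↔ y ∈ (∅ : Set (EuclideanSpace ℝ (Fin N))) := by
    have hae : ∀ᵐ y : EuclideanSpace ℝ (Fin N), ¬ inner ℝ e y = t := by
      simpa [ae_iff] using hplane
    filter_upwards [hae] with y hy
    rcases lt_or_gt_of_ne hy with h | h
    · filter_upwards [lt_mem_nhds h] with s hs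
      simp only [mem_empty_iff_false, iff_false]
      exact fun hb => absurd hb.1 (not_le.2 hs)
    · have hcont : Continuous fun s => w (planeReflection e s y) :=
        H.continuous_w.comp ((continuous_planeReflection e).comp
          (continuous_id.prodMk continuous_const))
      filter_upwards [(hcont.tendsto t).eventually_const_lt (hlt y h)] with s hs
      simp only [mem_empty_iff_false, iff_false]
      exact fun hb => absurd hb.2.2 (not_lt.2 hs.le)
  have h := tendsto_measure_of_ae_tendsto_indicator (nhds t) MeasurableSet.empty
    (fun s => H.measurableSet_badSet e s) measurableSet_ball
    (measure_ball_lt_top (μ := (volume : Measure (EuclideanSpace ℝ (Fin N))))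
      (x := 0) (r := ρ)).ne
    (Eventually.of_forall fun s => H.badSet_subset_ball e s) hlim
  rw [measure_empty] at h
  simpa [measureReal_def, Function.comp_def] using (ENNReal.tendsto_toReal ENNReal.zero_ne_top).comp
    h

/-- The moving plane inequality for all planes up to the barycenter of the source. -/
lemma le_reflected (H : IsPlasmaPotential φ w a c L ρ) (hN : 3 ≤ N)
    (hmass : 0 < ∫ y, φ (w y)) {e : EuclideanSpace ℝ (Fin N)} (he : ‖e‖ = 1) {t : ℝ}
    (ht : inner ℝ e (barycenter fun y => φ (w y)) ≤ t)
    {x : EuclideanSpace ℝ (Fin N)} (hx : t ≤ inner ℝ e x) :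
    w x ≤ w (planeReflection e t x) := by
  obtain ⟨v, hv, hsmall⟩ := H.exists_small_badSet hN
  set b := inner ℝ e (barycenter fun y => φ (w y)) with hb
  set G : Set ℝ := {s | ∀ x, s ≤ inner ℝ e x → w x ≤ w (planeReflection e s x)} with hG
  have hclosed : IsClosed G := by
    rw [isClosed_iff_frequently]
    intro s hs x hsx
    rcases hsx.lt_or_eq with h | h
    · have hcont : Continuous fun s => w (planeReflection e s x) :=
        H.continuous_w.comp ((continuous_planeReflection e).comp
          (continuous_id.prodMk continuous_const))
      refine ge_of_tendsto_of_frequently (hcont.tendsto s) ?_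
      refine (hs.and_eventually (gt_mem_nhds h)).mono fun τ hτ => hτ.1 x (le_of_lt hτ.2)
    · rw [planeReflection_of_inner_eq h.symm]
  have hopen : IsOpen (Ioi b ∩ G) := by
    rw [isOpen_iff_mem_nhds]
    rintro s ⟨hs1, hs2⟩
    have hlt : ∀ x, s < inner ℝ e x → w x < w (planeReflection e s x) := fun x hx =>
      H.lt_reflected hN hmass he hs1 hs2 hx
    filter_upwards [Ioi_mem_nhds hs1,
      (H.tendsto_volume_badSet he hlt).eventually_le_const hv] with τ h1 h2
    exact ⟨h1, hsmall e he τ h2⟩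
  have hne : (Ioi b ∩ (Ioi b ∩ G)).Nonempty := by
    refine ⟨max ρ b + 1, ?_⟩
    have h1 : b < max ρ b + 1 := (le_max_right _ _).trans_lt (lt_add_one _)
    refine ⟨h1, h1, hsmall e he _ ?_⟩
    have : badSet w e (max ρ b + 1) = ∅ := by
      refine eq_empty_of_forall_notMem fun y hy => ?_
      have h2 := real_inner_le_norm e y
      rw [he, one_mul] at h2
      have h3 : ρ ≤ ‖y‖ := by linarith [hy.1, le_max_left ρ b]
      exact absurd hy.2.1 (not_lt.2 (H.le_one y h3))
    rw [this]
    simpa using hv.le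
  have hsub : Ioi b ⊆ Ioi b ∩ G := by
    refine isPreconnected_Ioi.subset_of_closure_inter_subset hopen hne ?_
    rintro s ⟨h1, h2⟩
    exact ⟨h2, (closure_minimal inter_subset_right hclosed) h1⟩
  have hall : Ici b ⊆ G := by
    rw [← closure_Ioi]
    exact closure_minimal (hsub.trans inter_subset_right) hclosed
  exact hall ht x hx

/-- `w` is radially nonincreasing about the barycenter of its source. -/
lemma le_of_dist_le (H : IsPlasmaPotential φ w a c L ρ) (hN : 3 ≤ N)
    (hmass : 0 < ∫ y, φ (w y)) {x y : EuclideanSpace ℝ (Fin N)}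
    (hxy : dist y (barycenter fun y => φ (w y)) ≤ dist x (barycenter fun y => φ (w y))) :
    w x ≤ w y := by
  set b := barycenter fun y => φ (w y) with hb
  rcases eq_or_ne x y with rfl | hne
  · exact le_rfl
  have hd : 0 < ‖x - y‖ := norm_pos_iff.2 (sub_ne_zero.2 hne)
  set e : EuclideanSpace ℝ (Fin N) := ‖x - y‖⁻¹ • (x - y) with he'
  have he : ‖e‖ = 1 := norm_smul_inv_norm (𝕜 := ℝ) (sub_ne_zero.2 hne)
  have hsub : x - y = ‖x - y‖ • e := by
    rw [he', smul_smul, mul_inv_cancel₀ hd.ne', one_smul]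
  set t := (inner ℝ e x + inner ℝ e y) / 2 with ht
  have hi : inner ℝ e x - inner ℝ e y = ‖x - y‖ := by
    rw [← inner_sub_right]
    conv_lhs => rw [hsub]
    rw [inner_smul_right, real_inner_self_eq_norm_sq, he]
    ring
  have href : planeReflection e t x = y := by
    have h1 : 2 * (inner ℝ e x - t) = ‖x - y‖ := by
      rw [ht]
      linarith
    rw [planeReflection, h1, ← hsub]
    abel
  have hbt : inner ℝ e b ≤ t := by
    have h1 : ‖y - b‖ ^ 2 ≤ ‖x - b‖ ^ 2 := by
      rw [← dist_eq_norm, ← dist_eq_norm]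
      gcongr
    have h2 : ‖x - b‖ ^ 2 = ‖y - b‖ ^ 2 + 2 * (‖x - y‖ * (inner ℝ e y - inner ℝ e b))
        + ‖x - y‖ ^ 2 := by
      have h3 : x - b = (y - b) + (x - y) := by abel
      rw [h3, norm_add_sq_real]
      conv_lhs => rw [hsub]
      rw [inner_smul_right, real_inner_comm, inner_sub_right, norm_smul, he, norm_norm, mul_one]
    have h4 : 0 ≤ ‖x - y‖ * (2 * (inner ℝ e y - inner ℝ e b) + ‖x - y‖) := by nlinarith
    have h5 := nonneg_of_mul_nonneg_right h4 hd
    rw [ht]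
    linarith
  have h := H.le_reflected hN hmass he hbt (x := x) (by rw [ht]; linarith)
  rwa [href] at h

end IsPlasmaPotential

lemma rpow_sub_rpow_le {p M u v : ℝ} (hp : 1 < p) (hu : 0 ≤ u) (huv : u ≤ v) (hv : v ≤ M) :
    v ^ p - u ^ p ≤ p * M ^ (p - 1) * (v - u) := by
  refine Convex.image_sub_le_mul_sub_of_deriv_le (convex_Icc 0 M)
    (continuous_rpow_const (by linarith)).continuousOn
    (fun s _ =>
      (hasDerivAt_rpow_const (Or.inr hp.le)).differentiableAt.differentiableWithinAt) ?_ u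
    ⟨hu, huv.trans hv⟩ v
    ⟨hu.trans huv, hv⟩ huv
  intro s hs
  rw [interior_Icc] at hs
  rw [(hasDerivAt_rpow_const (Or.inr hp.le)).deriv]
  have : s ^ (p - 1) ≤ M ^ (p - 1) := rpow_le_rpow hs.1.le hs.2.le (by linarith)
  gcongr

/-- A Newtonian plasma potential is radially nonincreasing about some point. -/
lemma exists_center {N : ℕ} (hN : 3 ≤ N) {p : ℝ} (hp : 1 < p)
    {w : EuclideanSpace ℝ (Fin N) → ℝ} (hw : Continuous w) {a c : ℝ} (ha : a < 1)
    (hx₁ : ∃ x₁, 1 < w x₁) (hlim : Tendsto w (cocompact _) (nhds a)) (hc : 0 < c)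
    (hrep : ∀ x, Integrable (fun y => max (w y - 1) 0 ^ p * newtonKernel (x - y)) ∧
      w x = a + c * ∫ y, max (w y - 1) 0 ^ p * newtonKernel (x - y)) :
    ∃ b, ∀ x y, dist y b ≤ dist x b → w x ≤ w y := by
  obtain ⟨ρ, hρ⟩ : ∃ ρ, ∀ x, ρ ≤ ‖x‖ → w x ≤ 1 := by
    have h1 : ∀ᶠ x in cocompact (EuclideanSpace ℝ (Fin N)), w x ≤ 1 :=
      hlim.eventually_le_const ha
    rw [← Metric.cobounded_eq_cocompact, ← comap_norm_atTop, eventually_comap,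
      eventually_atTop] at h1
    obtain ⟨ρ, h⟩ := h1
    exact ⟨ρ, fun x hx => h _ hx x rfl⟩
  obtain ⟨B, hB⟩ := (isCompact_closedBall (0 : EuclideanSpace ℝ (Fin N)) ρ).bddAbove_image
    hw.continuousOn
  have hup : ∀ x, max (w x - 1) 0 ≤ max (B - 1) 0 := fun x => by
    rcases le_total ρ ‖x‖ with h | h
    · rw [max_eq_right (by linarith [hρ x h])]
      exact le_max_right _ _
    · have : w x ≤ B := hB ⟨x, by simpa using h, rfl⟩
      gcongr
  set M := max (B - 1) 0 with hM
  have hM0 : 0 ≤ M := le_max_right _ _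
  have H : IsPlasmaPotential (fun s => max (s - 1) 0 ^ p) w a c (p * M ^ (p - 1) + 1) ρ :=
    { monotone := fun s t hst => by
        dsimp only
        gcongr
      continuous_source := by
        refine Continuous.rpow_const (by fun_prop) fun s => Or.inr (by linarith)
      eq_zero := fun s hs => by
        rw [max_eq_right (by linarith), zero_rpow (by linarith)]
      L_pos := by positivity
      sub_le := fun x y => by
        rcases le_total (w x) (w y) with h | h
        · rw [max_eq_right (sub_nonpos.2 h), mul_zero, sub_nonpos]
          gcongr
        · rw [max_eq_left (sub_nonneg.2 h)]
          have h1 : max (w y - 1) 0 ≤ max (w x - 1) 0 := by gcongr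
          have h2 : max (w x - 1) 0 - max (w y - 1) 0 ≤ w x - w y := by
            rcases le_total (w y - 1) 0 with h3 | h3
            · rw [max_eq_right h3, sub_zero]
              exact max_le (by linarith) (by linarith)
            · rw [max_eq_left h3, max_eq_left (by linarith)]
              linarith
          refine (rpow_sub_rpow_le hp (le_max_right _ _) h1 (hup x)).trans ?_
          have h4 : 0 ≤ p * M ^ (p - 1) := by positivity
          exact mul_le_mul (by linarith) h2 (sub_nonneg.2 h1) (by linarith)
      continuous_w := hw
      le_one := hρ
      c_pos := hc
      integrable := fun x => (hrep x).1
      eq_potential := fun x => (hrep x).2 }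
  have hmass : 0 < ∫ y, max (w y - 1) 0 ^ p := by
    obtain ⟨x₁, hx₁⟩ := hx₁
    refine H.continuous_source_comp.integral_pos_of_hasCompactSupport_nonneg_nonzero
      H.hasCompactSupport (fun y => H.source_nonneg _) (x := x₁) ?_
    have : 0 < max (w x₁ - 1) 0 := lt_max_of_lt_left (by linarith)
    positivity
  exact ⟨_, fun x y hxy => H.le_of_dist_le hN hmass hxy⟩

/-- The Laplacian under translation and dilation. -/
lemma lap_comp_add_smul {N : ℕ} {w : EuclideanSpace ℝ (Fin N) → ℝ} (hw : ContDiff ℝ 2 w)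
    (b : EuclideanSpace ℝ (Fin N)) (R κ d : ℝ) (x : EuclideanSpace ℝ (Fin N)) :
    lap (fun y => κ * (w (b + R • y) - d)) x = κ * R ^ 2 * lap w (b + R • x) := by
  have hA : ∀ y : EuclideanSpace ℝ (Fin N), HasFDerivAt (fun y => b + R • y)
      (R • ContinuousLinearMap.id ℝ (EuclideanSpace ℝ (Fin N))) y := fun y =>
    ((hasFDerivAt_id y).const_smul R).const_add b
  have h1 : ∀ v y : EuclideanSpace ℝ (Fin N),
      fderiv ℝ (fun y => κ * (w (b + R • y) - d)) y v = κ * R * fderiv ℝ w (b + R • y) v := by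
    intro v y
    have := ((((hw.differentiable (by norm_num)) (b + R • y)).hasFDerivAt.comp y
      (hA y)).sub_const d).const_mul κ
    simp only [Function.comp_apply] at this
    rw [this.fderiv]
    simp
    ring
  unfold lap
  rw [Finset.mul_sum]
  refine Finset.sum_congr rfl fun i _ => ?_
  simp only [h1]
  have h2 := (((contDiff_partial hw (EuclideanSpace.single i 1)).differentiable (by norm_num)
    (b + R • x)).hasFDerivAt.comp x (hA x)).const_mul (κ * R)
  simp only [Function.comp_apply] at h2
  rw [h2.fderiv]
  simp
  ring

/-- The Laplacian of a radial function, in terms of `q r = V' r / r`. -/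
lemma lap_radial {N : ℕ} {V q : ℝ → ℝ} {x : EuclideanSpace ℝ (Fin N)} (hx : x ≠ 0)
    (hV : ∀ r, 0 < r → HasDerivAt V (q r * r) r) {q' : ℝ} (hq : HasDerivAt q q' ‖x‖) :
    lap (fun y : EuclideanSpace ℝ (Fin N) => V ‖y‖) x = q' * ‖x‖ + N * q ‖x‖ := by
  have hnorm : ∀ y : EuclideanSpace ℝ (Fin N), y ≠ 0 →
      HasFDerivAt (fun y : EuclideanSpace ℝ (Fin N) => ‖y‖) (‖y‖⁻¹ • innerSL ℝ y) y := by
    intro y hy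
    have hy0 : ‖y‖ ≠ 0 := norm_ne_zero_iff.2 hy
    have h1 := ((hasStrictFDerivAt_norm_sq y).hasFDerivAt.sqrt (by positivity))
    simp only [sqrt_sq (norm_nonneg _)] at h1
    refine h1.congr_fderiv ?_
    ext z
    simp
    field_simp
  have hpart : ∀ i : Fin N, ∀ᶠ y in nhds x,
      fderiv ℝ (fun y : EuclideanSpace ℝ (Fin N) => V ‖y‖) y (EuclideanSpace.single i 1)
        = q ‖y‖ * y i := by
    intro i
    filter_upwards [isOpen_ne.mem_nhds hx] with y hy
    have hy0 : 0 < ‖y‖ := norm_pos_iff.2 hy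
    have h1 := (hV _ hy0).comp_hasFDerivAt y (hnorm y hy)
    simp only [Function.comp_def] at h1
    rw [h1.fderiv]
    simp [EuclideanSpace.inner_single_right]
    field_simp
  unfold lap
  have hterm : ∀ i : Fin N, fderiv ℝ (fun y => fderiv ℝ
      (fun y : EuclideanSpace ℝ (Fin N) => V ‖y‖) y (EuclideanSpace.single i 1)) x
      (EuclideanSpace.single i 1) = q' * ‖x‖⁻¹ * x i ^ 2 + q ‖x‖ := by
    intro i
    rw [Filter.EventuallyEq.fderiv_eq (hpart i)]
    have h1 := (hq.comp_hasFDerivAt x (hnorm x hx)).mul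
      (EuclideanSpace.proj i : EuclideanSpace ℝ (Fin N) →L[ℝ] ℝ).hasFDerivAt
    have h2 : HasFDerivAt (fun y : EuclideanSpace ℝ (Fin N) => q ‖y‖ * y i) _ x := h1
    rw [h2.fderiv]
    simp [EuclideanSpace.inner_single_right]
    ring
  rw [Finset.sum_congr rfl fun i _ => hterm i, Finset.sum_add_distrib, ← Finset.mul_sum,
    ← EuclideanSpace.real_norm_sq_eq]
  have hx0 : ‖x‖ ≠ 0 := norm_ne_zero_iff.2 hx
  simp
  field_simp

lemma eq_of_hasDerivAt_zero_of_le {F F' : ℝ → ℝ} {R : ℝ} (hF : ∀ r, R ≤ r → HasDerivAt F (F' r) r)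
    (hF' : ∀ r, R ≤ r → F' r = 0) {r : ℝ} (hr : R ≤ r) : F r = F R := by
  refine constant_of_has_deriv_right_zero (b := r)
    (fun s hs => (hF s hs.1).continuousAt.continuousWithinAt) (fun s hs => ?_) r ⟨hr, le_rfl⟩
  have := hF s hs.1
  rw [hF' s hs.1] at this
  exact this.hasDerivWithinAt

/-- Radial harmonic functions outside of a ball. -/
lemma radial_harmonic_exterior {N : ℕ} (hN : 3 ≤ N) {V V₁ V₂ : ℝ → ℝ} {R a d : ℝ} (hR : 0 < R)
    (h1 : ∀ r, HasDerivAt V (V₁ r) r) (h2 : ∀ r, HasDerivAt V₁ (V₂ r) r)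
    (hode : ∀ r, R ≤ r → V₂ r * r + (N - 1) * V₁ r = 0) (hVR : V R = d)
    (hlim : Tendsto V atTop (nhds a)) :
    V₁ R = -(((N : ℝ) - 2) * (d - a)) / R ∧
      ∀ r, R ≤ r → V r = a + (R / r) ^ ((N : ℝ) - 2) * (d - a) := by
  obtain ⟨m, rfl⟩ : ∃ m, N = m + 2 := ⟨N - 2, by omega⟩
  have hm : 0 < m := by omega
  have hm' : (0 : ℝ) < m := by exact_mod_cast hm
  have hcast : ((m + 2 : ℕ) : ℝ) - 2 = m := by push_cast; ring
  rw [hcast]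
  have hP : ∀ r, R ≤ r → r ^ (m + 1) * V₁ r = R ^ (m + 1) * V₁ R := by
    intro r hr
    refine eq_of_hasDerivAt_zero_of_le (F := fun r => r ^ (m + 1) * V₁ r)
      (fun s _ => (hasDerivAt_pow (m + 1) s).mul (h2 s)) (fun s hs => ?_) hr
    have h := hode s hs
    push_cast at h ⊢
    rw [pow_succ]
    linear_combination s ^ m * h
  have hQ : ∀ r, R ≤ r → V r + r * V₁ r / m = V R + R * V₁ R / m := by
    intro r hr
    refine eq_of_hasDerivAt_zero_of_le (F := fun r => V r + r * V₁ r / m)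
      (fun s _ => (h1 s).add (((hasDerivAt_id s).mul (h2 s)).div_const _)) (fun s hs => ?_) hr
    have h := hode s hs
    push_cast at h
    simp only [id_eq]
    field_simp
    linear_combination h
  have hrV : ∀ r, R ≤ r → r * V₁ r = R ^ (m + 1) * V₁ R * (r ^ m)⁻¹ := by
    intro r hr
    have hr0 : 0 < r := hR.trans_le hr
    rw [← hP r hr, pow_succ]
    field_simp
  have hQlim : Tendsto (fun r => V r + r * V₁ r / m) atTop
      (nhds (a + R ^ (m + 1) * V₁ R * 0 / m)) := by
    refine hlim.add (Tendsto.div_const ?_ _)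
    refine Tendsto.congr' ?_ (((tendsto_pow_atTop hm.ne').inv_tendsto_atTop).const_mul _)
    filter_upwards [eventually_ge_atTop R] with r hr
    exact (hrV r hr).symm
  have hQa : V R + R * V₁ R / m = a := by
    have h := tendsto_nhds_unique (hQlim.congr' (by
      filter_upwards [eventually_ge_atTop R] with r hr using hQ r hr)) tendsto_const_nhds
    simpa using h.symm
  have hV₁ : R * V₁ R = -(m * (d - a)) := by
    rw [hVR] at hQa
    field_simp at hQa
    linarith
  refine ⟨by rw [← hV₁]; field_simp, fun r hr => ?_⟩
  have hr0 : 0 < r := hR.trans_le hr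
  have h := hQ r hr
  rw [hQa, hrV r hr, pow_succ, mul_assoc (R ^ m), hV₁] at h
  rw [rpow_natCast, div_pow]
  field_simp at h ⊢
  linarith

/-- The level set of a function which decreases along a half line. -/
lemma exists_level {V : ℝ → ℝ} (hV : Continuous V) {a d : ℝ} (had : a < d) (h0 : d < V 0)
    (hlim : Tendsto V atTop (nhds a)) :
    ∃ R, 0 < R ∧ V R = d ∧ (∀ r, 0 ≤ r → r < R → d < V r) := by
  set A : Set ℝ := {r | 0 ≤ r ∧ V r ≤ d} with hA
  have hne : A.Nonempty := by
    obtain ⟨r, h1, h2⟩ := ((hlim.eventually_le_const had).and (eventually_ge_atTop 0)).exists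
    exact ⟨r, h2, h1⟩
  have hbdd : BddBelow A := ⟨0, fun r hr => hr.1⟩
  have hcl : IsClosed A := isClosed_Ici.inter (isClosed_le hV continuous_const)
  have hmem : sInf A ∈ A := hcl.csInf_mem hne hbdd
  have hlt : ∀ r, 0 ≤ r → r < sInf A → d < V r := by
    intro r hr0 hr
    by_contra! h
    exact notMem_of_lt_csInf hr hbdd ⟨hr0, h⟩
  have hpos : 0 < sInf A := by
    refine hmem.1.lt_of_ne fun h => ?_
    have := hmem.2
    rw [← h] at this
    linarith
  refine ⟨sInf A, hpos, le_antisymm hmem.2 ?_, hlt⟩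
  have ht : Tendsto V (nhdsWithin (sInf A) (Iio (sInf A))) (nhds (V (sInf A))) :=
    (hV.tendsto _).mono_left nhdsWithin_le_nhds
  refine ge_of_tendsto ht ?_
  filter_upwards [Ioo_mem_nhdsLT hpos] with r hr
  exact (hlt r hr.1.le hr.2).le

lemma scaling_identity {R κ p t : ℝ} (hR : 0 < R) (hp : 1 < p) (hκ : κ = R ^ (2 / (p - 1)))
    (ht : 0 ≤ t) : κ * R ^ 2 * t ^ p = (κ * t) ^ p := by
  have hp1 : p - 1 ≠ 0 := by linarith
  rw [mul_rpow (by rw [hκ]; positivity) ht, hκ, ← rpow_mul hR.le, ← rpow_natCast R 2,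
    ← rpow_add hR]
  congr 2
  push_cast
  field_simp
  ring

/-- The solution which is radial about `b` is given by the Emden profile. -/
lemma emden_form {N : ℕ} (hN : 3 ≤ N) {p : ℝ} (hp : 1 < p)
    {w : EuclideanSpace ℝ (Fin N) → ℝ} (hsmooth : ContDiff ℝ 2 w)
    (hpde : ∀ x, -lap w x = max (w x - 1) 0 ^ p) {a : ℝ} (ha : a < 1)
    (hx₁ : ∃ x₁, 1 < w x₁) (hlim : Tendsto w (cocompact _) (nhds a))
    {b : EuclideanSpace ℝ (Fin N)} (hb : ∀ x y, dist y b ≤ dist x b → w x ≤ w y) :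
    ∃ g : ℝ → ℝ,
      ContDiffOn ℝ 2 (fun x : EuclideanSpace ℝ (Fin N) => g ‖x‖) (ball 0 1) ∧
      ContinuousOn (fun x : EuclideanSpace ℝ (Fin N) => g ‖x‖) (closedBall 0 1) ∧
      (∀ x ∈ ball (0 : EuclideanSpace ℝ (Fin N)) 1,
        -lap (fun y : EuclideanSpace ℝ (Fin N) => g ‖y‖) x = g ‖x‖ ^ p) ∧
      (∀ x ∈ ball (0 : EuclideanSpace ℝ (Fin N)) 1, 0 < g ‖x‖) ∧
      g 1 = 0 ∧ DifferentiableAt ℝ g 1 ∧ deriv g 1 < 0 ∧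
      (∃ Ra : ℝ,
        Ra = (-(deriv g 1) / (((N : ℝ) - 2) * (1 - a))) ^ ((p - 1) / 2) ∧
        (∀ x, dist x b ≤ Ra → w x = 1 + Ra ^ ((2 : ℝ) / (1 - p)) * g (dist x b / Ra)) ∧
        (∀ x, Ra ≤ dist x b → w x = a + (Ra / dist x b) ^ ((N : ℝ) - 2) * (1 - a))) := by
  have hp1 : 0 < p - 1 := by linarith
  have hN2 : (0 : ℝ) < (N : ℝ) - 2 := by
    have : (3 : ℝ) ≤ N := by exact_mod_cast hN
    linarith
  set e : EuclideanSpace ℝ (Fin N) := EuclideanSpace.single ⟨0, by omega⟩ 1 with he'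
  have he : ‖e‖ = 1 := by simp [he']
  set V : ℝ → ℝ := fun r => w (b + r • e) with hVdef
  have hdist : ∀ r : ℝ, 0 ≤ r → dist (b + r • e) b = r := fun r hr => by
    rw [dist_eq_norm, add_sub_cancel_left, norm_smul, he, mul_one, norm_of_nonneg hr]
  have hwV : ∀ x, w x = V (dist x b) := fun x => by
    have h := hdist (dist x b) dist_nonneg
    exact le_antisymm (hb _ _ h.le) (hb _ _ h.ge)
  have hwV' : ∀ y, w (b + y) = V ‖y‖ := fun y => by
    rw [hwV, dist_eq_norm, add_sub_cancel_left]
  -- regularity of the profile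
  have hVsm : ContDiff ℝ 2 V := by
    refine hsmooth.comp ?_
    fun_prop
  have hV₁sm : ContDiff ℝ 1 (deriv V) := ((contDiff_succ_iff_deriv (n := 1)).1 hVsm).2.2
  have hd1 : ∀ r, HasDerivAt V (deriv V r) r := fun r =>
    (hVsm.differentiable (by norm_num) r).hasDerivAt
  have hd2 : ∀ r, HasDerivAt (deriv V) (deriv (deriv V) r) r := fun r =>
    (hV₁sm.differentiable (by norm_num) r).hasDerivAt
  have hVlim : Tendsto V atTop (nhds a) := by
    refine hlim.comp ?_
    rw [← Metric.cobounded_eq_cocompact, ← tendsto_norm_atTop_iff_cobounded]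
    refine tendsto_atTop_mono (f := fun r : ℝ => r - ‖b‖) (fun r => ?_)
      (tendsto_atTop_add_const_right _ _ tendsto_id)
    have h1 := norm_sub_le (b + r • e) b
    rw [add_sub_cancel_left, norm_smul, he, mul_one, norm_eq_abs] at h1
    linarith [le_abs_self r]
  have hV0 : 1 < V 0 := by
    obtain ⟨x₁, hx₁⟩ := hx₁
    refine hx₁.trans_le (hb _ _ ?_)
    rw [hdist 0 le_rfl]
    exact dist_nonneg
  obtain ⟨R, hR, hVR, hRlt⟩ := exists_level hVsm.continuous ha hV0 hVlim
  have hout : ∀ r, R ≤ r → V r ≤ 1 := fun r hr => by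
    rw [← hVR]
    refine hb _ _ ?_
    rwa [hdist R hR.le, hdist r (hR.le.trans hr)]
  -- the ordinary differential equation outside of the plasma
  have hode : ∀ r, R ≤ r → deriv (deriv V) r * r + (N - 1) * deriv V r = 0 := by
    intro r hr
    have hr0 : 0 < r := hR.trans_le hr
    have hnr : ‖r • e‖ = r := by rw [norm_smul, he, mul_one, norm_of_nonneg hr0.le]
    have hq : HasDerivAt (fun s => deriv V s / s)
        ((deriv (deriv V) r * r - deriv V r * 1) / r ^ 2) r :=
      (hd2 r).div (hasDerivAt_id r) hr0.ne'
    rw [← hnr] at hq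
    have h1 := lap_radial (x := r • e) (V := V) (q := fun s => deriv V s / s)
      (by rw [← norm_pos_iff, hnr]; exact hr0)
      (fun s hs => by simpa [hs.ne'] using hd1 s) hq
    have h2 := lap_comp_add_smul hsmooth b 1 1 0 (r • e)
    simp only [one_smul, sub_zero, one_mul, one_pow, hwV'] at h2
    have h3 := hpde (b + r • e)
    rw [hwV', hnr, max_eq_right (by linarith [hout r hr]), zero_rpow (by linarith)] at h3
    rw [h2, neg_eq_zero.1 h3, hnr] at h1
    field_simp at h1
    linarith
  obtain ⟨hV₁R, hext⟩ := radial_harmonic_exterior hN hR hd1 hd2 hode hVR hVlim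
  -- the rescaled profile
  set κ : ℝ := R ^ (2 / (p - 1)) with hκ
  have hκ0 : 0 < κ := rpow_pos_of_pos hR _
  set g : ℝ → ℝ := fun s => κ * (V (R * s) - 1) with hg
  have hgn : (fun y : EuclideanSpace ℝ (Fin N) => g ‖y‖) = fun y => κ * (w (b + R • y) - 1) := by
    funext y
    rw [hwV', norm_smul, norm_of_nonneg hR.le]
  have hgsm : ContDiff ℝ 2 fun y : EuclideanSpace ℝ (Fin N) => g ‖y‖ := by
    rw [hgn]
    have : ContDiff ℝ 2 fun y : EuclideanSpace ℝ (Fin N) => w (b + R • y) :=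
      hsmooth.comp (by fun_prop)
    fun_prop
  have hin : ∀ x ∈ ball (0 : EuclideanSpace ℝ (Fin N)) 1, 1 < V (R * ‖x‖) := fun x hx => by
    rw [mem_ball_zero_iff] at hx
    exact hRlt _ (by positivity) (by nlinarith)
  have hgd : HasDerivAt g (-(κ * (((N : ℝ) - 2) * (1 - a)))) 1 := by
    have h1 : HasDerivAt (fun s => R * s) R 1 := by simpa using (hasDerivAt_id (1 : ℝ)).const_mul R
    have h2 : HasDerivAt V (deriv V R) (R * 1) := by
      rw [mul_one]
      exact hd1 R
    refine (((h2.comp 1 h1).sub_const 1).const_mul κ).congr_deriv ?_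
    rw [hV₁R]
    field_simp
  have hpos : 0 < ((N : ℝ) - 2) * (1 - a) := mul_pos hN2 (by linarith)
  refine ⟨g, hgsm.contDiffOn, hgsm.continuous.continuousOn, fun x hx => ?_, fun x hx => ?_, ?_,
    hgd.differentiableAt, ?_, R, ?_, fun x hx => ?_, fun x hx => ?_⟩
  · rw [hgn, lap_comp_add_smul hsmooth, ← mul_neg, hpde]
    have h1 : w (b + R • x) = V (R * ‖x‖) := by rw [hwV', norm_smul, norm_of_nonneg hR.le]
    rw [scaling_identity hR hp hκ (le_max_right _ _), h1,
      max_eq_left (sub_nonneg.2 (hin x hx).le)]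
  · exact mul_pos hκ0 (sub_pos.2 (hin x hx))
  · simp [hg, hVR]
  · rw [hgd.deriv]
    exact neg_neg_of_pos (mul_pos hκ0 hpos)
  · rw [hgd.deriv, neg_neg, mul_div_assoc, div_self hpos.ne', mul_one, hκ, ← rpow_mul hR.le]
    have : 2 / (p - 1) * ((p - 1) / 2) = 1 := by field_simp
    rw [this, rpow_one]
  · have h1 : R ^ ((2 : ℝ) / (1 - p)) * κ = 1 := by
      rw [hκ, ← rpow_add hR]
      have : 2 / (1 - p) + 2 / (p - 1) = 0 := by
        rw [← neg_sub p 1, div_neg]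
        ring
      rw [this, rpow_zero]
    simp only [hg]
    rw [← mul_assoc, h1, mul_div_cancel₀ _ hR.ne', hwV x]
    ring
  · rw [hwV x]
    exact hext _ hx

/-- Lemma 6.3: classification of nonnegative entire solutions of `-Δw = [w-1]₊ᵖ` in `ℝᴺ`,
`N ≥ 3`, `1 < p < N/(N-2)`, with `∫[w-1]₊ᵖ < ∞`: either `w` is a constant `c ∈ [0,1]`, or,
up to a translation, `w = w_a` for some `a ∈ [0,1)`, given explicitly in terms of the unique
positive radial solution `u` (with radial profile `g`) of the Emden problem on `B₁(0)`. -/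
theorem statement10 (N : ℕ) (hN : 3 ≤ N)
    (p : ℝ) (hp : 1 < p) (hpN : p < (N : ℝ) / ((N : ℝ) - 2))
    (w : EuclideanSpace ℝ (Fin N) → ℝ)
    (hsmooth : ContDiff ℝ 2 w) (hpos : ∀ x, 0 ≤ w x)
    (hpde : ∀ x, -lap w x = max (w x - 1) 0 ^ p)
    (hint : Integrable (fun x => max (w x - 1) 0 ^ p)) :
    (∃ c : ℝ, c ∈ Set.Icc (0 : ℝ) 1 ∧ ∀ x, w x = c) ∨
    (∃ a : ℝ, a ∈ Set.Ico (0 : ℝ) 1 ∧ ∃ x₀ : EuclideanSpace ℝ (Fin N), ∃ g : ℝ → ℝ,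
      -- `g` is the radial profile of the unique positive Emden solution `u` on `B₁(0)`
      ContDiffOn ℝ 2 (fun x : EuclideanSpace ℝ (Fin N) => g ‖x‖) (ball 0 1) ∧
      ContinuousOn (fun x : EuclideanSpace ℝ (Fin N) => g ‖x‖) (closedBall 0 1) ∧
      (∀ x ∈ ball (0 : EuclideanSpace ℝ (Fin N)) 1,
        -lap (fun y : EuclideanSpace ℝ (Fin N) => g ‖y‖) x = g ‖x‖ ^ p) ∧
      (∀ x ∈ ball (0 : EuclideanSpace ℝ (Fin N)) 1, 0 < g ‖x‖) ∧
      g 1 = 0 ∧ DifferentiableAt ℝ g 1 ∧ deriv g 1 < 0 ∧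
      -- `R_a` and the explicit form of `w = w_a` centered at `x₀`
      (∃ Ra : ℝ,
        Ra = (-(deriv g 1) / (((N : ℝ) - 2) * (1 - a))) ^ ((p - 1) / 2) ∧
        (∀ x, dist x x₀ ≤ Ra → w x = 1 + Ra ^ ((2 : ℝ) / (1 - p)) * g (dist x x₀ / Ra)) ∧
        (∀ x, Ra ≤ dist x x₀ → w x = a + (Ra / dist x x₀) ^ ((N : ℝ) - 2) * (1 - a))) ∧
      -- qualitative properties characterizing `w_a`
      (∀ x, a < w x) ∧ (∀ x, w x ≤ w x₀) ∧ 1 < w x₀ ∧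
      Tendsto w (Filter.cocompact (EuclideanSpace ℝ (Fin N))) (nhds a)) := by
  rcases const_or_newton_potential hN hp hpN hsmooth hpos hpde hint with h |
    ⟨a, ha, hx₁, hlim, c, hc, hrep⟩
  · exact Or.inl h
  obtain ⟨b, hb⟩ := exists_center hN hp hsmooth.continuous ha.2 hx₁ hlim hc hrep
  obtain ⟨g, h1, h2, h3, h4, h5, h6, h7, h8⟩ := emden_form hN hp hsmooth hpde ha.2 hx₁ hlim hb
  have hmax : ∀ x, w x ≤ w b := fun x => hb x b (by simp)
  obtain ⟨x₁, hx₁⟩ := hx₁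
  refine Or.inr ⟨a, ha, b, g, h1, h2, h3, h4, h5, h6, h7, h8, ?_, hmax,
    hx₁.trans_le (hmax x₁), hlim⟩
  obtain ⟨R, hR, -, hext⟩ := h8
  have hN2 : (0 : ℝ) < (N : ℝ) - 2 := by
    have : (3 : ℝ) ≤ N := by exact_mod_cast hN
    linarith
  have hR0 : 0 < R := by
    rw [hR]
    exact rpow_pos_of_pos (div_pos (by linarith) (mul_pos hN2 (by linarith [ha.2]))) _
  have hfar : ∀ x, R ≤ dist x b → a < w x := fun x hx => by
    rw [hext x hx]
    have : 0 < R / dist x b := div_pos hR0 (hR0.trans_le hx)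
    have := mul_pos (rpow_pos_of_pos this ((N : ℝ) - 2)) (sub_pos.2 ha.2)
    linarith
  intro x
  rcases le_total R (dist x b) with hx | hx
  · exact hfar x hx
  · have hd : dist (b + R • EuclideanSpace.single (⟨0, by omega⟩ : Fin N) (1 : ℝ)) b = R := by
      rw [dist_eq_norm, add_sub_cancel_left, norm_smul, norm_of_nonneg hR0.le]
      simp
    exact (hfar _ hd.ge).trans_le (hb _ _ (by rw [hd]; exact hx))
end
end

section
/- Let (α_n,ψ_n) be a sequence of solutions of (P)_{λ_n} such that α_n < 0 and |α_n| → +∞. Then λ_n → +∞, and in particular λ_n‖ψ_n‖_∞ → +∞. -/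
open MeasureTheory Metric Filter Real Set
noncomputable section

/-- `(α, ψ)` is a solution of the problem `(P)_λ` on `Ω`. -/
structure IsSol {N : ℕ} (Ω : Set (EuclideanSpace ℝ (Fin N))) (p lam α : ℝ)
    (ψ : EuclideanSpace ℝ (Fin N) → ℝ) : Prop where
  contOn : ContinuousOn ψ (closure Ω)
  smooth : ContDiffOn ℝ 2 ψ Ω
  pde : ∀ x ∈ Ω, -lap ψ x = max (α + lam * ψ x) 0 ^ p
  bdry : ∀ x ∈ frontier Ω, ψ x = 0
  constr : ∫ x in Ω, max (α + lam * ψ x) 0 ^ p = 1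

/-- A function on an open set vanishing off a compact subset extends by zero with the same
regularity. -/
lemma contDiff_indicator_of_eq_zero_off_compact {E : Type*} [NormedAddCommGroup E]
    [NormedSpace ℝ E] {n : WithTop ℕ∞} {Ω K : Set E} (hΩ : IsOpen Ω) (hK : IsCompact K)
    (hKΩ : K ⊆ Ω) {h : E → ℝ} (hh : ContDiffOn ℝ n h Ω) (h0 : ∀ x ∈ Ω, x ∉ K → h x = 0) :
    ContDiff ℝ n (Ω.indicator h) := by
  rw [contDiff_iff_contDiffAt]
  intro x
  by_cases hx : x ∈ Ω
  · refine (hh.contDiffAt (hΩ.mem_nhds hx)).congr_of_eventuallyEq ?_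
    filter_upwards [hΩ.mem_nhds hx] with y hy
    exact indicator_of_mem hy h
  · refine (contDiffAt_const (c := (0 : ℝ))).congr_of_eventuallyEq ?_
    filter_upwards [hK.isClosed.isOpen_compl.mem_nhds (fun hxK => hx (hKΩ hxK))] with y hy
    by_cases hyΩ : y ∈ Ω
    · rw [indicator_of_mem hyΩ, h0 y hyΩ hy]
    · exact indicator_of_notMem hyΩ h

lemma tsupport_indicator_subset_of_eq_zero_off_compact {E : Type*} [TopologicalSpace E]
    [T2Space E] {Ω K : Set E} (hK : IsCompact K) {h : E → ℝ}
    (h0 : ∀ x ∈ Ω, x ∉ K → h x = 0) : tsupport (Ω.indicator h) ⊆ K := by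
  refine closure_minimal (fun x hx => ?_) hK.isClosed
  by_contra hxK
  refine hx ?_
  by_cases hxΩ : x ∈ Ω
  · rw [indicator_of_mem hxΩ, h0 x hxΩ hxK]
  · exact indicator_of_notMem hxΩ h

lemma hasCompactSupport_indicator_of_eq_zero_off_compact {E : Type*} [TopologicalSpace E]
    [T2Space E] {Ω K : Set E} (hK : IsCompact K) {h : E → ℝ}
    (h0 : ∀ x ∈ Ω, x ∉ K → h x = 0) : HasCompactSupport (Ω.indicator h) :=
  hK.of_isClosed_subset (isClosed_tsupport _)
    (tsupport_indicator_subset_of_eq_zero_off_compact hK h0)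

lemma continuous_indicator_of_eq_zero_off_compact {E : Type*} [NormedAddCommGroup E]
    [NormedSpace ℝ E] {Ω K : Set E} (hΩ : IsOpen Ω) (hK : IsCompact K)
    (hKΩ : K ⊆ Ω) {h : E → ℝ} (hh : ContinuousOn h Ω) (h0 : ∀ x ∈ Ω, x ∉ K → h x = 0) :
    Continuous (Ω.indicator h) :=
  contDiff_zero.1 (contDiff_indicator_of_eq_zero_off_compact hΩ hK hKΩ
    (contDiffOn_zero.2 hh) h0)

lemma memLp_restrict_of_eq_zero_off_compact {N : ℕ}
    {Ω K : Set (EuclideanSpace ℝ (Fin N))} (hΩ : IsOpen Ω) (hK : IsCompact K)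
    (hKΩ : K ⊆ Ω) {h : EuclideanSpace ℝ (Fin N) → ℝ} (hh : ContinuousOn h Ω)
    (h0 : ∀ x ∈ Ω, x ∉ K → h x = 0) (q : ENNReal) : MemLp h q (volume.restrict Ω) :=
  (memLp_indicator_iff_restrict hΩ.measurableSet).1
    ((continuous_indicator_of_eq_zero_off_compact hΩ hK hKΩ hh h0).memLp_of_hasCompactSupport
      (hasCompactSupport_indicator_of_eq_zero_off_compact hK h0))

lemma integral_fderiv_apply_eq_zero_of_hasCompactSupport {N : ℕ}
    {f : EuclideanSpace ℝ (Fin N) → ℝ}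
    (hf : ContDiff ℝ 1 f) (hf' : HasCompactSupport f) (v : EuclideanSpace ℝ (Fin N)) :
    Integrable (fun x => fderiv ℝ f x v) ∧ ∫ x, fderiv ℝ f x v = 0 := by
  have hcont : Continuous (fun x => fderiv ℝ f x v) :=
    (hf.continuous_fderiv one_ne_zero).clm_apply continuous_const
  have hint : Integrable (fun x => fderiv ℝ f x v) :=
    hcont.integrable_of_hasCompactSupport (hf'.fderiv_apply ℝ v)
  refine ⟨hint, ?_⟩
  have := integral_mul_fderiv_eq_neg_fderiv_mul_of_integrable (𝕜 := ℝ)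
    (μ := (volume : Measure (EuclideanSpace ℝ (Fin N)))) (f := fun _ => (1 : ℝ)) (g := f) (v := v)
    (by simp) (by simpa using hint)
    (by simpa using hf.continuous.integrable_of_hasCompactSupport hf')
    (fun x _ => differentiableAt_const _)
    (fun x _ => (hf.differentiable one_ne_zero) x)
  simpa using this

lemma isCompact_superlevel_closure {N : ℕ} {Ω : Set (EuclideanSpace ℝ (Fin N))}
    (hbdd : Bornology.IsBounded Ω)
    {ψ : EuclideanSpace ℝ (Fin N) → ℝ} (hψ : ContinuousOn ψ (closure Ω)) (c : ℝ) :
    IsCompact (closure Ω ∩ ψ ⁻¹' Ici c) :=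
  hbdd.isCompact_closure.of_isClosed_subset
    (hψ.preimage_isClosed_of_isClosed isClosed_closure isClosed_Ici) inter_subset_left

lemma superlevel_closure_subset {N : ℕ} {Ω : Set (EuclideanSpace ℝ (Fin N))} (hΩ : IsOpen Ω)
    {ψ : EuclideanSpace ℝ (Fin N) → ℝ} (hb : ∀ x ∈ frontier Ω, ψ x = 0) {c : ℝ} (hc : 0 < c) :
    closure Ω ∩ ψ ⁻¹' Ici c ⊆ Ω := by
  rintro x ⟨hx, hcx⟩
  by_contra hxΩ
  have h0 := hb x (by rw [hΩ.frontier_eq]; exact ⟨hx, hxΩ⟩)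
  have : c ≤ ψ x := hcx
  linarith

/-- The squared Euclidean norm of the gradient. -/
def gradSq {N : ℕ} (f : EuclideanSpace ℝ (Fin N) → ℝ) (x : EuclideanSpace ℝ (Fin N)) : ℝ :=
  ∑ i : Fin N, (fderiv ℝ f x (EuclideanSpace.single i 1)) ^ 2

lemma norm_sq_le_sum_apply_single_sq {N : ℕ} (L : EuclideanSpace ℝ (Fin N) →L[ℝ] ℝ) :
    ‖L‖ ^ 2 ≤ ∑ i : Fin N, (L (EuclideanSpace.single i 1)) ^ 2 := by
  have hS : 0 ≤ ∑ i : Fin N, (L (EuclideanSpace.single i 1)) ^ 2 := by positivity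
  have : ‖L‖ ≤ √(∑ i : Fin N, (L (EuclideanSpace.single i 1)) ^ 2) := by
    refine L.opNorm_le_bound (Real.sqrt_nonneg _) fun x => ?_
    have hx : L x = ∑ i, L (EuclideanSpace.single i 1) * x i := by
      conv_lhs => rw [← (EuclideanSpace.basisFun (Fin N) ℝ).sum_repr x]
      simp [map_sum, mul_comm]
    rw [hx, EuclideanSpace.norm_eq, ← Real.sqrt_mul hS, Real.norm_eq_abs]
    refine Real.abs_le_sqrt ?_
    simpa using Finset.sum_mul_sq_le_sq_mul_sq Finset.univ
      (fun i => L (EuclideanSpace.single i 1)) (fun i => x i)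
  calc ‖L‖ ^ 2 ≤ (√(∑ i : Fin N, (L (EuclideanSpace.single i 1)) ^ 2)) ^ 2 := by gcongr
    _ = _ := Real.sq_sqrt hS

/-- Testing `-Δψ` against `G ∘ ψ`, for `G` vanishing below a positive level. -/
lemma integral_deriv_mul_gradSq {N : ℕ} {Ω : Set (EuclideanSpace ℝ (Fin N))} (hΩ : IsOpen Ω)
    (hbdd : Bornology.IsBounded Ω) {ψ : EuclideanSpace ℝ (Fin N) → ℝ}
    (hψ : ContinuousOn ψ (closure Ω)) (hψ2 : ContDiffOn ℝ 2 ψ Ω)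
    (hb : ∀ x ∈ frontier Ω, ψ x = 0) {c : ℝ} (hc : 0 < c) {G G' : ℝ → ℝ}
    (hG : ∀ s, HasDerivAt G (G' s) s) (hG' : Continuous G') (hG0 : ∀ s ≤ c, G s = 0)
    (hG0' : ∀ s ≤ c, G' s = 0) :
    IntegrableOn (fun x => G' (ψ x) * gradSq ψ x) Ω ∧
    ∫ x in Ω, G' (ψ x) * gradSq ψ x = ∫ x in Ω, G (ψ x) * -lap ψ x := by
  set K := closure Ω ∩ ψ ⁻¹' Ici c with hKdef
  have hK : IsCompact K := isCompact_superlevel_closure hbdd hψ c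
  have hKΩ : K ⊆ Ω := superlevel_closure_subset hΩ hb hc
  have hle : ∀ x ∈ Ω, x ∉ K → ψ x ≤ c := by
    intro x hx hxK
    by_contra h
    exact hxK ⟨subset_closure hx, (not_le.1 h).le⟩
  have hG1 : ContDiff ℝ 1 G := by
    rw [contDiff_one_iff_deriv]
    refine ⟨fun s => (hG s).differentiableAt, ?_⟩
    rwa [show deriv G = G' from funext fun s => (hG s).deriv]
  have hd : ∀ i : Fin N, ContDiffOn ℝ 1 (fun y => fderiv ℝ ψ y (EuclideanSpace.single i 1)) Ω :=
    fun i => (hψ2.fderiv_of_isOpen hΩ (by norm_num)).clm_apply contDiffOn_const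
  set Φ : Fin N → EuclideanSpace ℝ (Fin N) → ℝ := fun i x =>
    G (ψ x) * fderiv ℝ ψ x (EuclideanSpace.single i 1) with hΦ
  have hΦ1 : ∀ i, ContDiffOn ℝ 1 (Φ i) Ω := fun i =>
    (hG1.comp_contDiffOn (hψ2.of_le (by norm_num))).mul (hd i)
  have hΦ0 : ∀ i, ∀ x ∈ Ω, x ∉ K → Φ i x = 0 := fun i x hx hxK => by
    simp [hΦ, hG0 _ (hle x hx hxK)]
  have hdiv := fun i => integral_fderiv_apply_eq_zero_of_hasCompactSupport
    (contDiff_indicator_of_eq_zero_off_compact hΩ hK hKΩ (hΦ1 i) (hΦ0 i))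
    (hasCompactSupport_indicator_of_eq_zero_off_compact hK (hΦ0 i))
    (EuclideanSpace.single i 1)
  have hsupp : ∀ i, ∀ x ∉ Ω,
      fderiv ℝ (Ω.indicator (Φ i)) x (EuclideanSpace.single i 1) = 0 := by
    intro i x hx
    have hx' : x ∉ tsupport (Ω.indicator (Φ i)) := fun h =>
      hx (hKΩ (tsupport_indicator_subset_of_eq_zero_off_compact hK (hΦ0 i) h))
    rw [fderiv_of_notMem_tsupport (𝕜 := ℝ) hx']
    simp
  have hdivΩ : ∫ x in Ω, ∑ i : Fin N,
      fderiv ℝ (Ω.indicator (Φ i)) x (EuclideanSpace.single i 1) = 0 := by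
    rw [setIntegral_eq_integral_of_forall_compl_eq_zero
      (fun x hx => Finset.sum_eq_zero fun i _ => hsupp i x hx),
      integral_finsetSum _ fun i _ => (hdiv i).1]
    exact Finset.sum_eq_zero fun i _ => (hdiv i).2
  have hform : ∀ x ∈ Ω, ∑ i : Fin N,
      fderiv ℝ (Ω.indicator (Φ i)) x (EuclideanSpace.single i 1) =
      G' (ψ x) * gradSq ψ x - G (ψ x) * -lap ψ x := by
    intro x hx
    have hψx : DifferentiableAt ℝ ψ x :=
      (hψ2.contDiffAt (hΩ.mem_nhds hx)).differentiableAt (by norm_num)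
    have hGψ : HasFDerivAt (fun y => G (ψ y)) (G' (ψ x) • fderiv ℝ ψ x) x :=
      (hG (ψ x)).comp_hasFDerivAt x hψx.hasFDerivAt
    have key : ∀ i : Fin N,
        fderiv ℝ (Ω.indicator (Φ i)) x (EuclideanSpace.single i 1) =
        G' (ψ x) * (fderiv ℝ ψ x (EuclideanSpace.single i 1)) ^ 2 +
        G (ψ x) * fderiv ℝ (fun y => fderiv ℝ ψ y (EuclideanSpace.single i 1)) x
          (EuclideanSpace.single i 1) := by
      intro i
      have he : Ω.indicator (Φ i) =ᶠ[nhds x] Φ i := by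
        filter_upwards [hΩ.mem_nhds hx] with y hy
        exact indicator_of_mem hy _
      have hdx : DifferentiableAt ℝ (fun y => fderiv ℝ ψ y (EuclideanSpace.single i 1)) x :=
        ((hd i).contDiffAt (hΩ.mem_nhds hx)).differentiableAt (by norm_num)
      have hp : HasFDerivAt (Φ i) (G (ψ x) •
          fderiv ℝ (fun y => fderiv ℝ ψ y (EuclideanSpace.single i 1)) x +
          fderiv ℝ ψ x (EuclideanSpace.single i 1) • G' (ψ x) • fderiv ℝ ψ x) x :=
        hGψ.mul hdx.hasFDerivAt
      rw [he.fderiv_eq, hp.fderiv]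
      simp only [add_apply, smul_apply, smul_eq_mul]
      ring
    simp only [key, Finset.sum_add_distrib, gradSq, lap, ← Finset.mul_sum]
    ring
  have hgradc : ContinuousOn (gradSq ψ) Ω :=
    continuousOn_finsetSum _ fun i _ => ((hd i).continuousOn).pow 2
  have hint : IntegrableOn (fun x => G' (ψ x) * gradSq ψ x) Ω :=
    memLp_one_iff_integrable.1 (memLp_restrict_of_eq_zero_off_compact hΩ hK hKΩ
      ((hG'.comp_continuousOn hψ2.continuousOn).mul hgradc)
      (fun x hx hxK => by simp [hG0' _ (hle x hx hxK)]) 1)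
  refine ⟨hint, ?_⟩
  have h2 : ∫ x in Ω, G (ψ x) * -lap ψ x = ∫ x in Ω, (G' (ψ x) * gradSq ψ x -
      ∑ i : Fin N, fderiv ℝ (Ω.indicator (Φ i)) x (EuclideanSpace.single i 1)) :=
    setIntegral_congr_fun hΩ.measurableSet fun x hx => by
      simp only [hform x hx]; ring
  rw [h2, integral_sub hint (integrable_finsetSum _ fun i _ => (hdiv i).1.integrableOn),
    hdivΩ, sub_zero]

/-- The Sobolev inequality on a set of measure one, with exponent `2κ` on the left. -/
lemma exists_sobolev_const {N : ℕ} (hN : 2 ≤ N) {Ω : Set (EuclideanSpace ℝ (Fin N))}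
    (hvol : volume Ω = 1) {κ : ℝ} (hκ : 1 ≤ κ)
    (hκN : 1 / 2 - 1 / (N : ℝ) ≤ 1 / (2 * κ)) :
    ∃ C > 0, ∀ v : EuclideanSpace ℝ (Fin N) → ℝ, ContDiff ℝ 1 v → HasCompactSupport v →
      tsupport v ⊆ Ω →
      (∫ x in Ω, |v x| ^ (2 * κ)) ^ (1 / κ) ≤ C * ∫ x in Ω, ‖fderiv ℝ v x‖ ^ 2 := by
  have hprob : IsProbabilityMeasure (volume.restrict Ω) := ⟨by simpa using hvol⟩
  have hN' : (2 : ℝ) ≤ N := by exact_mod_cast hN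
  set rr : ℝ := (1 / (2 * κ) + 1 / (N : ℝ))⁻¹ with hrr
  have hκ0 : 0 < κ := by linarith
  have hrpos : 0 < 1 / (2 * κ) + 1 / (N : ℝ) := by positivity
  have hr0 : 0 ≤ rr := by positivity
  have hr1 : 1 ≤ rr := by
    refine (one_le_inv₀ hrpos).2 ?_
    have h1 : 1 / (2 * κ) ≤ 1 / 2 := one_div_le_one_div_of_le (by norm_num) (by linarith)
    have h2 : 1 / (N : ℝ) ≤ 1 / 2 := one_div_le_one_div_of_le (by norm_num) hN'
    linarith
  have hr2 : rr ≤ 2 := by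
    refine inv_le_of_inv_le₀ (by norm_num) ?_
    linarith
  obtain ⟨r, hr⟩ : ∃ r : NNReal, (r : ℝ) = rr := ⟨⟨rr, hr0⟩, rfl⟩
  obtain ⟨q, hq⟩ : ∃ q : NNReal, (q : ℝ) = 2 * κ := ⟨⟨2 * κ, by positivity⟩, rfl⟩
  set C₀ := SNormLESNormFDerivOfEqConst ℝ
    (volume : Measure (EuclideanSpace ℝ (Fin N))) (r : ℝ) with hC₀
  refine ⟨(C₀ : ℝ) ^ 2 + 1, by positivity, fun v hv hvc hvΩ => ?_⟩
  have hsob : eLpNorm v q volume ≤ C₀ * eLpNorm (fderiv ℝ v) r volume := by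
    refine eLpNorm_le_eLpNorm_fderiv_of_eq volume hv hvc ?_ ?_ ?_
    · rw [← NNReal.coe_le_coe, hr]; exact_mod_cast hr1
    · simp; omega
    · simp only [finrank_euclideanSpace, Fintype.card_fin]
      rw [hq, NNReal.coe_inv, hr, hrr, inv_inv]; ring
  have hfc := hv.continuous_fderiv one_ne_zero
  have hfs : HasCompactSupport (fderiv ℝ v) := hvc.fderiv ℝ
  have hrestr : eLpNorm (fderiv ℝ v) r volume ≤ eLpNorm (fderiv ℝ v) 2 (volume.restrict Ω) := by
    have hsub : Function.support (fun x => ‖fderiv ℝ v x‖) ⊆ Ω := by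
      refine Subset.trans (fun x hx => ?_)
        ((subset_tsupport _).trans ((tsupport_fderiv_subset ℝ).trans hvΩ))
      simpa using hx
    have heq : eLpNorm (fderiv ℝ v) r (volume.restrict Ω) = eLpNorm (fderiv ℝ v) r volume := by
      rw [← eLpNorm_norm (fderiv ℝ v), ← eLpNorm_norm (fderiv ℝ v)]
      exact eLpNorm_restrict_eq_of_support_subset hsub
    rw [← heq]
    refine eLpNorm_le_eLpNorm_of_exponent_le ?_ hfc.aestronglyMeasurable
    have : r ≤ 2 := by rw [← NNReal.coe_le_coe, hr]; exact_mod_cast hr2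
    exact_mod_cast this
  have hsob' : eLpNorm v q (volume.restrict Ω) ≤
      C₀ * eLpNorm (fderiv ℝ v) 2 (volume.restrict Ω) :=
    (eLpNorm_mono_measure v Measure.restrict_le_self).trans (hsob.trans (by gcongr))
  have hvm : MemLp v q (volume.restrict Ω) := (hv.continuous.memLp_of_hasCompactSupport hvc)
  have hfm : MemLp (fderiv ℝ v) 2 (volume.restrict Ω) :=
    (hfc.memLp_of_hasCompactSupport hfs)
  have hq0 : q ≠ 0 := by
    rintro rfl
    rw [NNReal.coe_zero] at hq
    linarith
  rw [hvm.eLpNorm_eq_integral_rpow_norm (by exact_mod_cast hq0) ENNReal.coe_ne_top,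
    hfm.eLpNorm_eq_integral_rpow_norm (by norm_num) (by norm_num),
    ← ENNReal.ofReal_coe_nnreal (p := C₀), ← ENNReal.ofReal_mul (by positivity),
    ENNReal.ofReal_le_ofReal_iff (by positivity)] at hsob'
  have hqr : (q : ENNReal).toReal = 2 * κ := hq
  rw [hqr] at hsob'
  simp only [ENNReal.toReal_ofNat, Real.rpow_ofNat, Real.norm_eq_abs] at hsob'
  set A := ∫ x in Ω, |v x| ^ (2 * κ) with hA
  set B := ∫ x in Ω, ‖fderiv ℝ v x‖ ^ 2 with hB
  have hA0 : 0 ≤ A := integral_nonneg fun x => by positivity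
  have hB0 : 0 ≤ B := integral_nonneg fun x => by positivity
  have h1 : A ^ (1 / κ) = (A ^ (2 * κ)⁻¹) ^ 2 := by
    rw [← Real.rpow_natCast, ← Real.rpow_mul hA0]
    congr 1
    push_cast
    field_simp
  have h2 : (B ^ (2 : ℝ)⁻¹) ^ 2 = B := by
    rw [← Real.rpow_natCast, ← Real.rpow_mul hB0]
    norm_num
  calc A ^ (1 / κ) = (A ^ (2 * κ)⁻¹) ^ 2 := h1
    _ ≤ (C₀ * B ^ (2 : ℝ)⁻¹) ^ 2 := by gcongr
    _ = (C₀ : ℝ) ^ 2 * B := by rw [mul_pow, h2]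
    _ ≤ ((C₀ : ℝ) ^ 2 + 1) * B := by gcongr; linarith

lemma exists_energy_const {N : ℕ} (hN : 2 ≤ N) {Ω : Set (EuclideanSpace ℝ (Fin N))}
    (hΩ : IsOpen Ω) (hbdd : Bornology.IsBounded Ω)
    (hvol : volume Ω = 1) {κ : ℝ} (hκ : 1 ≤ κ)
    (hκN : 1 / 2 - 1 / (N : ℝ) ≤ 1 / (2 * κ)) :
    ∃ C > 0, ∀ ψ : EuclideanSpace ℝ (Fin N) → ℝ, ContinuousOn ψ (closure Ω) →
      ContDiffOn ℝ 2 ψ Ω → (∀ x ∈ frontier Ω, ψ x = 0) →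
      ∀ (c K : ℝ) (G G' H H' : ℝ → ℝ), 0 < c → (∀ s, HasDerivAt G (G' s) s) → Continuous G' →
      (∀ s ≤ c, G s = 0) → (∀ s ≤ c, G' s = 0) → (∀ s, HasDerivAt H (H' s) s) →
      Continuous H' → (∀ s ≤ c, H s = 0) → (∀ s, H' s ^ 2 ≤ K * G' s) →
      (∫ x in Ω, |H (ψ x)| ^ (2 * κ)) ^ (1 / κ) ≤ C * (K * ∫ x in Ω, G (ψ x) * -lap ψ x) := by
  obtain ⟨C, hC, hsob⟩ := exists_sobolev_const hN hvol hκ hκN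
  refine ⟨C, hC, ?_⟩
  intro ψ hψ hψ2 hb c K G G' H H' hc hG hG' hG0 hG0' hH hH' hH0 hHG
  obtain ⟨hint, heq⟩ := integral_deriv_mul_gradSq hΩ hbdd hψ hψ2 hb hc hG hG' hG0 hG0'
  have hcpt : IsCompact (closure Ω ∩ ψ ⁻¹' Ici c) := isCompact_superlevel_closure hbdd hψ c
  have hsub : closure Ω ∩ ψ ⁻¹' Ici c ⊆ Ω := superlevel_closure_subset hΩ hb hc
  have h0 : ∀ x ∈ Ω, x ∉ closure Ω ∩ ψ ⁻¹' Ici c → H (ψ x) = 0 := by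
    intro x hx hxK
    refine hH0 _ ?_
    by_contra h
    exact hxK ⟨subset_closure hx, (not_le.1 h).le⟩
  have hH1 : ContDiff ℝ 1 H := by
    rw [contDiff_one_iff_deriv]
    refine ⟨fun s => (hH s).differentiableAt, ?_⟩
    rwa [show deriv H = H' from funext fun s => (hH s).deriv]
  have hHψ : ContDiffOn ℝ 1 (fun x => H (ψ x)) Ω :=
    hH1.comp_contDiffOn (hψ2.of_le (by norm_num))
  have key := hsob (Ω.indicator fun x => H (ψ x))
    (contDiff_indicator_of_eq_zero_off_compact hΩ hcpt hsub hHψ h0)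
    (hasCompactSupport_indicator_of_eq_zero_off_compact hcpt h0)
    ((tsupport_indicator_subset_of_eq_zero_off_compact hcpt h0).trans hsub)
  have hl : ∫ x in Ω, |Ω.indicator (fun x => H (ψ x)) x| ^ (2 * κ) =
      ∫ x in Ω, |H (ψ x)| ^ (2 * κ) :=
    setIntegral_congr_fun hΩ.measurableSet fun x hx => by simp only [indicator_of_mem hx]
  rw [hl] at key
  refine key.trans (mul_le_mul_of_nonneg_left ?_ hC.le)
  rw [← heq, ← integral_const_mul]
  refine integral_mono_of_nonneg (ae_of_all _ fun x => by positivity) (hint.const_mul K) ?_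
  refine (ae_restrict_iff' hΩ.measurableSet).2 (ae_of_all _ fun x hx => ?_)
  have he : Ω.indicator (fun x => H (ψ x)) =ᶠ[nhds x] fun x => H (ψ x) := by
    filter_upwards [hΩ.mem_nhds hx] with y hy
    exact indicator_of_mem hy _
  have hψx : DifferentiableAt ℝ ψ x :=
    (hψ2.contDiffAt (hΩ.mem_nhds hx)).differentiableAt (by norm_num)
  have hd : HasFDerivAt (fun y => H (ψ y)) (H' (ψ x) • fderiv ℝ ψ x) x :=
    (hH (ψ x)).comp_hasFDerivAt x hψx.hasFDerivAt
  have hg : ‖fderiv ℝ ψ x‖ ^ 2 ≤ gradSq ψ x := norm_sq_le_sum_apply_single_sq _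
  change ‖fderiv ℝ (Ω.indicator fun x => H (ψ x)) x‖ ^ 2 ≤ K * (G' (ψ x) * gradSq ψ x)
  rw [he.fderiv_eq, hd.fderiv, norm_smul, mul_pow, Real.norm_eq_abs, sq_abs, ← mul_assoc]
  exact mul_le_mul (hHG _) hg (by positivity) ((sq_nonneg _).trans (hHG _))

/-- Interpolation of moments of a nonnegative function. -/
lemma integral_rpow_le_interpolation {X : Type*} [MeasurableSpace X] {μ : Measure X}
    {u : X → ℝ} (hu : ∀ x, 0 ≤ u x)
    (hm : ∀ a : ℝ, 0 < a → ∀ q : ENNReal, MemLp (fun x => u x ^ a) q μ) {p s θ : ℝ} (hp : 0 < p) (hs : 0 < s)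
    (hθ0 : 0 < θ) (hθ1 : θ < 1) :
    ∫ x, u x ^ ((1 - θ) * p + θ * s) ∂μ ≤
      (∫ x, u x ^ p ∂μ) ^ (1 - θ) * (∫ x, u x ^ s ∂μ) ^ θ := by
  have h1θ : 0 < 1 - θ := by linarith
  have hconj : (1 - θ)⁻¹.HolderConjugate θ⁻¹ := by
    rw [Real.holderConjugate_iff]
    exact ⟨(one_lt_inv₀ h1θ).2 (by linarith), by simp⟩
  have h := integral_mul_le_Lp_mul_Lq_of_nonneg (μ := μ) hconj
    (f := fun x => u x ^ ((1 - θ) * p)) (g := fun x => u x ^ (θ * s))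
    (ae_of_all _ fun x => Real.rpow_nonneg (hu x) _)
    (ae_of_all _ fun x => Real.rpow_nonneg (hu x) _)
    (hm _ (mul_pos h1θ hp) _) (hm _ (mul_pos hθ0 hs) _)
  have e1 : ∀ x, u x ^ ((1 - θ) * p) * u x ^ (θ * s) = u x ^ ((1 - θ) * p + θ * s) := fun x =>
    (Real.rpow_add_of_nonneg (hu x) (by positivity) (by positivity)).symm
  have e2 : ∀ x, (u x ^ ((1 - θ) * p)) ^ (1 - θ)⁻¹ = u x ^ p := fun x => by
    rw [← Real.rpow_mul (hu x)]; congr 1; field_simp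
  have e3 : ∀ x, (u x ^ (θ * s)) ^ θ⁻¹ = u x ^ s := fun x => by
    rw [← Real.rpow_mul (hu x)]; congr 1; field_simp
  simpa only [e1, e2, e3, one_div, inv_inv] using h

/-- Hölder's inequality against the indicator of the positivity set. -/
lemma integral_rpow_le_mul_measure {X : Type*} [MeasurableSpace X] {μ : Measure X}
    [IsFiniteMeasure μ] {u : X → ℝ} (hu : ∀ x, 0 ≤ u x)
    (hm : ∀ a : ℝ, 0 < a → ∀ q : ENNReal, MemLp (fun x => u x ^ a) q μ) {A : Set X} (hA : MeasurableSet A)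
    (huA : ∀ x ∉ A, u x = 0) {p s : ℝ} (hp : 0 < p) (hps : p < s) :
    ∫ x, u x ^ p ∂μ ≤ (∫ x, u x ^ s ∂μ) ^ (p / s) * μ.real A ^ (1 - p / s) := by
  have hs : 0 < s := hp.trans hps
  have hlt : p / s < 1 := (div_lt_one hs).2 hps
  have h1 : 0 < 1 - p / s := by linarith
  have hconj : (p / s)⁻¹.HolderConjugate (1 - p / s)⁻¹ := by
    rw [Real.holderConjugate_iff]
    exact ⟨(one_lt_inv₀ (by positivity)).2 hlt, by simp⟩
  have h := integral_mul_le_Lp_mul_Lq_of_nonneg (μ := μ) hconj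
    (f := fun x => u x ^ p) (g := A.indicator fun _ => 1)
    (ae_of_all _ fun x => Real.rpow_nonneg (hu x) _)
    (ae_of_all _ fun x => indicator_nonneg (fun _ _ => zero_le_one) x)
    (hm p hp _) (memLp_indicator_const _ hA 1 (Or.inr (measure_ne_top _ _)))
  have e1 : ∀ x, u x ^ p * A.indicator (fun _ => (1 : ℝ)) x = u x ^ p := fun x => by
    by_cases hx : x ∈ A
    · simp [hx]
    · simp [hx, huA x hx, Real.zero_rpow hp.ne']
  have e2 : ∀ x, (u x ^ p) ^ (p / s)⁻¹ = u x ^ s := fun x => by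
    rw [← Real.rpow_mul (hu x)]; congr 1; field_simp
  have e3 : ∀ x, A.indicator (fun _ => (1 : ℝ)) x ^ (1 - p / s)⁻¹ =
      A.indicator (fun _ => (1 : ℝ)) x := fun x => by
    by_cases hx : x ∈ A
    · simp [hx]
    · simp [hx, Real.zero_rpow (inv_pos.2 h1).ne']
  have e4 : ∫ x, A.indicator (fun _ => (1 : ℝ)) x ∂μ = μ.real A := integral_indicator_one hA
  simpa only [e1, e2, e3, e4, one_div, inv_inv] using h

lemma hasDerivAt_max_zero_pow (n : ℕ) (s : ℝ) :
    HasDerivAt (fun t : ℝ => max t 0 ^ (n + 2)) ((n + 2 : ℝ) * max s 0 ^ (n + 1)) s := by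
  rcases lt_trichotomy s 0 with hs | rfl | hs
  · rw [max_eq_right hs.le, zero_pow (by omega), mul_zero]
    refine (hasDerivAt_const s (0 : ℝ)).congr_of_eventuallyEq ?_
    filter_upwards [Iio_mem_nhds hs] with t ht
    rw [max_eq_right (le_of_lt ht), zero_pow (by omega)]
  · rw [max_self, zero_pow (by omega), mul_zero]
    rw [hasDerivAt_iff_tendsto_slope]
    have hc : Tendsto (fun t : ℝ => max t 0 ^ (n + 1)) (nhdsWithin 0 {0}ᶜ) (nhds 0) := by
      have : Continuous fun t : ℝ => max t 0 ^ (n + 1) := by fun_prop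
      simpa using (this.tendsto 0).mono_left nhdsWithin_le_nhds
    refine hc.congr' ?_
    filter_upwards [self_mem_nhdsWithin] with t ht
    have ht0 : t ≠ 0 := ht
    rw [slope_def_field]
    rcases lt_or_gt_of_ne ht0 with h | h
    · simp [max_eq_right h.le]
    · simp only [max_eq_left h.le, max_self, sub_zero, zero_pow (Nat.succ_ne_zero (n + 1))]
      field_simp
      ring
  · rw [max_eq_left hs.le]
    have h := hasDerivAt_pow (n + 2) s
    push_cast at h
    refine h.congr_of_eventuallyEq ?_
    filter_upwards [Ioi_mem_nhds hs] with t ht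
    rw [max_eq_left (le_of_lt ht)]

lemma exists_smoothTransition_deriv_bound :
    ∃ M > 0, ∀ s, 0 ≤ deriv smoothTransition s ∧ deriv smoothTransition s ≤ M := by
  have hc : Continuous (deriv smoothTransition) :=
    (smoothTransition.contDiff (n := 1)).continuous_deriv (by simp)
  obtain ⟨M, hM⟩ := (isCompact_Icc (a := (0 : ℝ)) (b := 1)).bddAbove_image hc.continuousOn
  refine ⟨max M 1, by positivity, fun s => ⟨smoothTransition.monotone.deriv_nonneg, ?_⟩⟩
  by_cases hs : s ∈ Icc (0 : ℝ) 1
  · exact (hM (mem_image_of_mem _ hs)).trans (le_max_left _ _)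
  · have h0 : deriv smoothTransition s = 0 := by
      rw [mem_Icc, not_and_or, not_le, not_le] at hs
      rcases hs with hs | hs
      · have : smoothTransition =ᶠ[nhds s] fun _ => 0 := by
          filter_upwards [Iio_mem_nhds hs] with t ht
          exact smoothTransition.zero_of_nonpos (le_of_lt ht)
        rw [this.deriv_eq, deriv_const]
      · have : smoothTransition =ᶠ[nhds s] fun _ => 1 := by
          filter_upwards [Ioi_mem_nhds hs] with t ht
          exact smoothTransition.one_of_one_le (le_of_lt ht)
        rw [this.deriv_eq, deriv_const]
    rw [h0]; positivity

namespace IsSol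

variable {N : ℕ} {Ω : Set (EuclideanSpace ℝ (Fin N))} {p lam α : ℝ}
  {ψ : EuclideanSpace ℝ (Fin N) → ℝ}

lemma integrableOn_rhs (h : IsSol Ω p lam α ψ) :
    IntegrableOn (fun x => max (α + lam * ψ x) 0 ^ p) Ω :=
  integrable_of_integral_eq_one h.constr

lemma continuousOn (h : IsSol Ω p lam α ψ) : ContinuousOn ψ Ω := h.contOn.mono subset_closure

lemma max_eq_zero_of_le (hl : 0 < lam) {s : ℝ} (hs : s ≤ -α / lam) :
    max (α + lam * s) 0 = 0 := by
  rw [le_div_iff₀ hl] at hs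
  exact max_eq_right (by linarith)

lemma memLp_rpow (h : IsSol Ω p lam α ψ) (hΩ : IsOpen Ω) (hbdd : Bornology.IsBounded Ω)
    (hl : 0 < lam) (hα : α < 0) (a : ℝ) (ha : 0 < a) (q : ENNReal) :
    MemLp (fun x => max (α + lam * ψ x) 0 ^ a) q (volume.restrict Ω) := by
  have ht : 0 < -α / lam := div_pos (by linarith) hl
  refine memLp_restrict_of_eq_zero_off_compact hΩ
    (isCompact_superlevel_closure hbdd h.contOn (-α / lam))
    (superlevel_closure_subset hΩ h.bdry ht) ?_ ?_ q
  · have hc : Continuous fun s : ℝ => max (α + lam * s) 0 ^ a :=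
      Continuous.rpow_const (by fun_prop) fun _ => Or.inr ha.le
    exact hc.comp_continuousOn h.continuousOn
  · intro x hx hxK
    have : ψ x ≤ -α / lam := by
      by_contra hlt
      exact hxK ⟨subset_closure hx, (not_le.1 hlt).le⟩
    rw [max_eq_zero_of_le hl this, Real.zero_rpow ha.ne']

lemma isOpen_positivity (h : IsSol Ω p lam α ψ) (hΩ : IsOpen Ω) :
    IsOpen (Ω ∩ {x | 0 < α + lam * ψ x}) := by
  have hc : ContinuousOn (fun x => α + lam * ψ x) Ω :=
    continuousOn_const.add (continuousOn_const.mul h.continuousOn)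
  exact hc.isOpen_inter_preimage hΩ isOpen_Ioi

lemma exists_pos (h : IsSol Ω p lam α ψ) (hΩ : IsOpen Ω) (hp : 1 ≤ p) :
    ∃ x ∈ Ω, 0 < α + lam * ψ x := by
  by_contra! hcon
  have h0 : ∫ x in Ω, max (α + lam * ψ x) 0 ^ p = ∫ x in Ω, (0 : ℝ) :=
    setIntegral_congr_fun hΩ.measurableSet fun x hx => by
      rw [max_eq_right (hcon x hx), Real.zero_rpow (by linarith)]
  have := h.constr
  rw [h0] at this
  simp at this

lemma abs_le_mul_iSup (h : IsSol Ω p lam α ψ) (hΩ : IsOpen Ω) (hbdd : Bornology.IsBounded Ω)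
    (hp : 1 ≤ p) (hl : 0 < lam) (hα : α < 0) :
    |α| ≤ lam * ⨆ x ∈ closure Ω, |ψ x| := by
  obtain ⟨x, hx, hpos⟩ := h.exists_pos hΩ hp
  obtain ⟨B, hB⟩ := hbdd.isCompact_closure.bddAbove_image h.contOn.abs
  have hbdd' : BddAbove (range fun x => ⨆ (_ : x ∈ closure Ω), |ψ x|) := by
    refine ⟨max B 0, ?_⟩
    rintro _ ⟨y, rfl⟩
    exact Real.iSup_le (fun hy => (hB (mem_image_of_mem _ hy)).trans (le_max_left _ _))
      (le_max_right _ _)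
  have hle : |ψ x| ≤ ⨆ x ∈ closure Ω, |ψ x| := by
    refine le_ciSup_of_le hbdd' x ?_
    have : Nonempty (x ∈ closure Ω) := ⟨subset_closure hx⟩
    rw [ciSup_const]
  calc |α| = -α := abs_of_neg hα
    _ ≤ lam * ψ x := by linarith
    _ ≤ lam * |ψ x| := by gcongr; exact le_abs_self _
    _ ≤ _ := by gcongr

end IsSol

lemma deriv_smoothTransition_of_nonpos {s : ℝ} (hs : s ≤ 0) : deriv smoothTransition s = 0 := by
  refine IsLocalMin.deriv_eq_zero (Eventually.of_forall fun t => ?_)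
  rw [smoothTransition.zero_of_nonpos hs]
  exact smoothTransition.nonneg t

/-- The positivity set of `α + λψ` is small when `λ / |α|` is small. -/
lemma exists_measure_positivity_le {N : ℕ} (hN : 2 ≤ N) {Ω : Set (EuclideanSpace ℝ (Fin N))}
    (hΩ : IsOpen Ω) (hbdd : Bornology.IsBounded Ω)
    (hvol : volume Ω = 1) {κ p : ℝ} (hκ : 1 ≤ κ)
    (hκN : 1 / 2 - 1 / (N : ℝ) ≤ 1 / (2 * κ)) :
    ∃ C > 0, ∀ (lam α : ℝ) (ψ : EuclideanSpace ℝ (Fin N) → ℝ), 0 < lam → α < 0 →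
      IsSol Ω p lam α ψ →
      (volume.restrict Ω).real (Ω ∩ {x | 0 < α + lam * ψ x}) ^ (1 / κ) ≤ C * (lam / |α|) := by
  obtain ⟨C, hC, henergy⟩ := exists_energy_const hN hΩ hbdd hvol hκ hκN
  obtain ⟨M, hM, hMb⟩ := exists_smoothTransition_deriv_bound
  have hprob : IsProbabilityMeasure (volume.restrict Ω) := ⟨by simpa using hvol⟩
  refine ⟨C * (2 * M), by positivity, fun lam α ψ hl hα h => ?_⟩
  set t := -α / lam with htdef
  have ht : 0 < t := div_pos (by linarith) hl
  have hsmall : ∀ s ≤ t / 2, 2 / t * s - 1 ≤ 0 := fun s hs => by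
    have : 2 / t * s ≤ 2 / t * (t / 2) := by gcongr
    have h1 : 2 / t * (t / 2) = 1 := by field_simp
    linarith
  set G : ℝ → ℝ := fun s => smoothTransition (2 / t * s - 1) with hGdef
  set G' : ℝ → ℝ := fun s => deriv smoothTransition (2 / t * s - 1) * (2 / t) with hG'def
  have hG : ∀ s, HasDerivAt G (G' s) s := fun s => by
    have h1 : HasDerivAt smoothTransition (deriv smoothTransition (2 / t * s - 1))
        (2 / t * s - 1) :=
      ((smoothTransition.contDiff (n := 1)).differentiable (by simp) _).hasDerivAt
    have h2 : HasDerivAt (fun s => 2 / t * s - 1) (2 / t) s := by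
      simpa using ((hasDerivAt_id s).const_mul (2 / t)).sub_const 1
    exact h1.comp s h2
  have hGc : Continuous G := continuous_iff_continuousAt.2 fun s => (hG s).continuousAt
  have hG'c : Continuous G' := by
    have : Continuous (deriv smoothTransition) :=
      (smoothTransition.contDiff (n := 1)).continuous_deriv (by simp)
    fun_prop
  have hG0 : ∀ s ≤ t / 2, G s = 0 := fun s hs => smoothTransition.zero_of_nonpos (hsmall s hs)
  have hG0' : ∀ s ≤ t / 2, G' s = 0 := fun s hs => by
    simp only [hG'def, deriv_smoothTransition_of_nonpos (hsmall s hs), zero_mul]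
  have hK : ∀ s, G' s ^ 2 ≤ (M * (2 / t)) * G' s := fun s => by
    have h1 := hMb (2 / t * s - 1)
    have h2 : 0 ≤ G' s := mul_nonneg h1.1 (by positivity)
    have h3 : G' s ≤ M * (2 / t) := mul_le_mul_of_nonneg_right h1.2 (by positivity)
    rw [sq]
    gcongr
  have key := henergy ψ h.contOn h.smooth h.bdry (t / 2) (M * (2 / t)) G G' G G' (by positivity)
    hG hG'c hG0 hG0' hG hG'c hG0 hK
  have hrhs : ∫ x in Ω, G (ψ x) * -lap ψ x ≤ 1 := by
    rw [← h.constr]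
    refine integral_mono_of_nonneg ?_ h.integrableOn_rhs ?_ <;>
    refine (ae_restrict_iff' hΩ.measurableSet).2 (ae_of_all _ fun x hx => ?_)
    · simp only [Pi.zero_apply, h.pde x hx]
      exact mul_nonneg (smoothTransition.nonneg _) (by positivity)
    · simp only [h.pde x hx]
      exact mul_le_of_le_one_left (by positivity) (smoothTransition.le_one _)
  have hint : IntegrableOn (fun x => |G (ψ x)| ^ (2 * κ)) Ω := by
    refine memLp_one_iff_integrable.1 (memLp_restrict_of_eq_zero_off_compact hΩ
      (isCompact_superlevel_closure hbdd h.contOn (t / 2))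
      (superlevel_closure_subset hΩ h.bdry (by positivity)) ?_ ?_ 1)
    · have : Continuous fun s => |G s| ^ (2 * κ) :=
        hGc.abs.rpow_const fun _ => Or.inr (by positivity)
      exact this.comp_continuousOn h.continuousOn
    · intro x hx hxK
      have : ψ x ≤ t / 2 := by
        by_contra hlt
        exact hxK ⟨subset_closure hx, (not_le.1 hlt).le⟩
      rw [hG0 _ this, abs_zero, Real.zero_rpow (by positivity)]
  have hmeas := (h.isOpen_positivity hΩ).measurableSet
  have hlow : (volume.restrict Ω).real (Ω ∩ {x | 0 < α + lam * ψ x}) ≤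
      ∫ x in Ω, |G (ψ x)| ^ (2 * κ) := by
    rw [← integral_indicator_one hmeas]
    refine integral_mono_of_nonneg
      (ae_of_all _ fun x => indicator_nonneg (fun _ _ => zero_le_one) x) hint
      (ae_of_all _ fun x => ?_)
    by_cases hx : x ∈ Ω ∩ {x | 0 < α + lam * ψ x}
    swap
    · rw [indicator_of_notMem hx]
      exact Real.rpow_nonneg (abs_nonneg _) _
    have hx2 : t < ψ x := by
      have : 0 < α + lam * ψ x := hx.2
      rw [htdef, div_lt_iff₀ hl]
      linarith
    have h1 : 1 ≤ 2 / t * ψ x - 1 := by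
      have h2 : 2 / t * t ≤ 2 / t * ψ x := by gcongr
      have h3 : 2 / t * t = 2 := by field_simp
      linarith
    simp [hGdef, smoothTransition.one_of_one_le h1, indicator_of_mem hx]
  calc _ ≤ (∫ x in Ω, |G (ψ x)| ^ (2 * κ)) ^ (1 / κ) := by gcongr
    _ ≤ C * ((M * (2 / t)) * ∫ x in Ω, G (ψ x) * -lap ψ x) := key
    _ ≤ C * ((M * (2 / t)) * 1) := by gcongr
    _ = C * (2 * M) * (lam / |α|) := by
      rw [abs_of_neg hα, htdef]
      have : α ≠ 0 := hα.ne
      field_simp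

/-- The energy estimate for the cube of the positive part of `α + λψ`. -/
lemma exists_moment_le {N : ℕ} (hN : 2 ≤ N) {Ω : Set (EuclideanSpace ℝ (Fin N))}
    (hΩ : IsOpen Ω) (hbdd : Bornology.IsBounded Ω)
    (hvol : volume Ω = 1) {κ p : ℝ} (hp : 1 ≤ p) (hκ : 1 ≤ κ)
    (hκN : 1 / 2 - 1 / (N : ℝ) ≤ 1 / (2 * κ)) :
    ∃ C > 0, ∀ (lam α : ℝ) (ψ : EuclideanSpace ℝ (Fin N) → ℝ), 0 < lam → α < 0 →
      IsSol Ω p lam α ψ →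
      (∫ x in Ω, max (α + lam * ψ x) 0 ^ (4 * κ)) ^ (1 / κ) ≤
        C * lam * ∫ x in Ω, max (α + lam * ψ x) 0 ^ (p + 3) := by
  obtain ⟨C, hC, henergy⟩ := exists_energy_const hN hΩ hbdd hvol hκ hκN
  refine ⟨C * (4 / 3), by positivity, fun lam α ψ hl hα h => ?_⟩
  have ht : 0 < -α / lam := div_pos (by linarith) hl
  have hD : ∀ (n : ℕ) (s : ℝ), HasDerivAt (fun s => max (α + lam * s) 0 ^ (n + 2))
      ((n + 2 : ℝ) * max (α + lam * s) 0 ^ (n + 1) * lam) s := fun n s => by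
    have h2 : HasDerivAt (fun s => α + lam * s) lam s := by
      simpa using ((hasDerivAt_id s).const_mul lam).const_add α
    exact (hasDerivAt_max_zero_pow n (α + lam * s)).comp s h2
  have h0 : ∀ s ≤ -α / lam, max (α + lam * s) 0 = 0 := fun s hs =>
    IsSol.max_eq_zero_of_le hl hs
  have key := henergy ψ h.contOn h.smooth h.bdry (-α / lam) (4 / 3 * lam) _ _ _ _ ht
    (hD 1) (by fun_prop) (fun s hs => by simp [h0 s hs]) (fun s hs => by simp [h0 s hs])
    (hD 0) (by fun_prop) (fun s hs => by simp [h0 s hs])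
    (fun s => by push_cast; apply le_of_eq; ring)
  have e1 : ∫ x in Ω, |max (α + lam * ψ x) 0 ^ (0 + 2)| ^ (2 * κ) =
      ∫ x in Ω, max (α + lam * ψ x) 0 ^ (4 * κ) := by
    congr 1
    ext x
    rw [abs_of_nonneg (by positivity), ← Real.rpow_natCast, ← Real.rpow_mul (le_max_right _ _)]
    congr 1
    push_cast
    ring
  have e2 : ∫ x in Ω, max (α + lam * ψ x) 0 ^ (1 + 2) * -lap ψ x =
      ∫ x in Ω, max (α + lam * ψ x) 0 ^ (p + 3) :=
    setIntegral_congr_fun hΩ.measurableSet fun x hx => by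
      simp only [h.pde x hx]
      rw [Real.rpow_add_of_nonneg (le_max_right _ _) (by linarith) (by norm_num), mul_comm]
      congr 1
      rw [← Real.rpow_natCast]
      norm_num
  rw [e1, e2] at key
  refine key.trans (le_of_eq ?_)
  ring

/-- For solutions with `α < 0`, a power of `λ` controls a power of `|α|`. -/
lemma exists_abs_rpow_le {N : ℕ} (hN : 2 ≤ N) {Ω : Set (EuclideanSpace ℝ (Fin N))}
    (hΩ : IsOpen Ω) (hbdd : Bornology.IsBounded Ω)
    (hvol : volume Ω = 1) {κ p : ℝ} (hp : 1 ≤ p) (hpκ : p < κ)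
    (hκN : 1 / 2 - 1 / (N : ℝ) ≤ 1 / (2 * κ)) :
    ∃ D e e' : ℝ, 0 < D ∧ 0 < e ∧ 0 < e' ∧ ∀ (lam α : ℝ) (ψ : EuclideanSpace ℝ (Fin N) → ℝ),
      0 < lam → α < 0 → IsSol Ω p lam α ψ → |α| ^ e ≤ D * lam ^ e' := by
  have hκ : 1 ≤ κ := hp.trans hpκ.le
  have hκ0 : 0 < κ := by linarith
  obtain ⟨C₁, hC₁, hmeas⟩ := exists_measure_positivity_le (p := p) hN hΩ hbdd hvol hκ hκN
  obtain ⟨C₂, hC₂, hmom⟩ := exists_moment_le hN hΩ hbdd hvol hp hκ hκN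
  have hprob : IsProbabilityMeasure (volume.restrict Ω) := ⟨by simpa using hvol⟩
  set θ : ℝ := 3 / (4 * κ - p) with hθ
  have hden : 0 < 4 * κ - p := by linarith
  have hθ0 : 0 < θ := by positivity
  have hθ1 : θ < 1 := (div_lt_one hden).2 (by linarith)
  have hδ : 0 < 1 / κ - θ := by
    rw [sub_pos, hθ, div_lt_div_iff₀ hden hκ0]
    linarith
  set δ := 1 / κ - θ with hδdef
  have hps : p < 4 * κ := by linarith
  have hr0 : 0 < p / (4 * κ) := by positivity
  have hr1 : 0 < 1 - p / (4 * κ) := by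
    have := (div_lt_one (by positivity : 0 < 4 * κ)).2 hps
    linarith
  set r := p / (4 * κ) with hr
  refine ⟨C₂ ^ (δ⁻¹ * r) * C₁ ^ (κ * (1 - r)), κ * (1 - r),
    δ⁻¹ * r + κ * (1 - r), by positivity, by positivity, by positivity, fun lam α ψ hl hα h => ?_⟩
  have hα' : 0 < |α| := abs_pos.2 hα.ne
  have hm := h.memLp_rpow hΩ hbdd hl hα
  have hu : ∀ x, 0 ≤ max (α + lam * ψ x) 0 := fun x => le_max_right _ _
  set X := ∫ x in Ω, max (α + lam * ψ x) 0 ^ (4 * κ) with hX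
  set a := (volume.restrict Ω).real (Ω ∩ {x | 0 < α + lam * ψ x}) with ha
  have ha0 : 0 ≤ a := measureReal_nonneg
  have hX0 : 0 ≤ X := integral_nonneg fun x => Real.rpow_nonneg (hu x) _
  have hA := hmeas lam α ψ hl hα h
  have hB := hmom lam α ψ hl hα h
  have hI := integral_rpow_le_interpolation (μ := volume.restrict Ω) hu hm (p := p)
    (s := 4 * κ) (by linarith) (by linarith) hθ0 hθ1
  have hexp : (1 - θ) * p + θ * (4 * κ) = p + 3 := by
    rw [hθ]; field_simp; ring
  rw [hexp, h.constr, Real.one_rpow, one_mul] at hI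
  have hone : 1 ≤ X ^ r * a ^ (1 - r) := by
    set u : EuclideanSpace ℝ (Fin N) → ℝ := Ω.indicator fun x => max (α + lam * ψ x) 0 with hudef
    have huΩ : ∀ x ∈ Ω, u x = max (α + lam * ψ x) 0 := fun x hx => indicator_of_mem hx _
    have hue : ∀ b : ℝ, ∫ x in Ω, u x ^ b = ∫ x in Ω, max (α + lam * ψ x) 0 ^ b := fun b =>
      setIntegral_congr_fun hΩ.measurableSet fun x hx => by simp only [huΩ x hx]
    have h1 := integral_rpow_le_mul_measure (μ := volume.restrict Ω) (u := u)
      (fun x => indicator_nonneg (fun y _ => hu y) x)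
      (fun b hb q => (hm b hb q).ae_eq ((ae_restrict_iff' hΩ.measurableSet).2
        (ae_of_all _ fun x hx => by simp only [huΩ x hx])))
      (h.isOpen_positivity hΩ).measurableSet
      (fun x hx => by
        by_cases hxΩ : x ∈ Ω
        · rw [huΩ x hxΩ]
          exact max_eq_right (not_lt.1 fun hlt => hx ⟨hxΩ, hlt⟩)
        · exact indicator_of_notMem hxΩ _)
      (p := p) (s := 4 * κ) (by linarith) hps
    rwa [hue, hue, h.constr] at h1
  have hXpos : 0 < X := by
    refine lt_of_le_of_ne hX0 fun h0 => ?_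
    rw [← h0, Real.zero_rpow hr0.ne', zero_mul] at hone
    linarith
  have hXle : X ≤ (C₂ * lam) ^ δ⁻¹ := by
    have h1 : X ^ δ ≤ C₂ * lam := by
      rw [hδdef, Real.rpow_sub hXpos, div_le_iff₀ (by positivity)]
      exact hB.trans (by gcongr)
    calc X = (X ^ δ) ^ δ⁻¹ := (Real.rpow_rpow_inv hX0 hδ.ne').symm
      _ ≤ _ := by gcongr
  have hale : a ≤ (C₁ * (lam / |α|)) ^ κ := by
    calc a = (a ^ (1 / κ)) ^ κ := by rw [one_div, Real.rpow_inv_rpow ha0 hκ0.ne']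
      _ ≤ _ := by gcongr
  have hfin : 1 ≤ ((C₂ * lam) ^ δ⁻¹) ^ r * ((C₁ * (lam / |α|)) ^ κ) ^ (1 - r) :=
    hone.trans (by gcongr)
  rw [← Real.rpow_mul (by positivity), ← Real.rpow_mul (by positivity),
    Real.mul_rpow hC₂.le hl.le, Real.mul_rpow hC₁.le (by positivity),
    Real.div_rpow hl.le hα'.le] at hfin
  rw [Real.rpow_add hl]
  have hαe : 0 < |α| ^ (κ * (1 - r)) := by positivity
  calc |α| ^ (κ * (1 - r)) = |α| ^ (κ * (1 - r)) * 1 := (mul_one _).symm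
    _ ≤ |α| ^ (κ * (1 - r)) * _ := mul_le_mul_of_nonneg_left hfin hαe.le
    _ = _ := by field_simp

/-- Theorem 7.1: if `(α_n, ψ_n)` solve `(P)_{λ_n}` with `α_n < 0` and `|α_n| → +∞`,
then `λ_n → +∞` and `λ_n ‖ψ_n‖_∞ → +∞`. -/
theorem statement12 (N : ℕ) (hN : 2 ≤ N) (Ω : Set (EuclideanSpace ℝ (Fin N)))
    (hopen : IsOpen Ω) (hconn : IsConnected Ω) (hbdd : Bornology.IsBounded Ω)
    (hvol : volume Ω = 1) (p : ℝ) (hp : 1 ≤ p)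
    (hpN : 2 < N → p < (N : ℝ) / ((N : ℝ) - 2))
    (lam α : ℕ → ℝ) (ψ : ℕ → EuclideanSpace ℝ (Fin N) → ℝ)
    (hlam : ∀ n, 0 < lam n) (hsol : ∀ n, IsSol Ω p (lam n) (α n) (ψ n))
    (hα : ∀ n, α n < 0) (hαinf : Tendsto (fun n => |α n|) atTop atTop) :
    Tendsto lam atTop atTop ∧
    Tendsto (fun n => lam n * ⨆ x ∈ closure Ω, |ψ n x|) atTop atTop := by
  obtain ⟨κ, hpκ, hκN⟩ : ∃ κ : ℝ, p < κ ∧ 1 / 2 - 1 / (N : ℝ) ≤ 1 / (2 * κ) := by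
    rcases hN.eq_or_lt with rfl | hN2
    · refine ⟨p + 1, by linarith, ?_⟩
      have : 0 ≤ 1 / (2 * (p + 1)) := by positivity
      norm_num at this ⊢
      linarith
    · have hN' : (2 : ℝ) < N := by exact_mod_cast hN2
      refine ⟨N / (N - 2), hpN hN2, le_of_eq ?_⟩
      have : (N : ℝ) - 2 ≠ 0 := by linarith
      field_simp
  obtain ⟨D, e, e', hD, he, he', hbound⟩ :=
    exists_abs_rpow_le hN hopen hbdd hvol hp hpκ hκN
  refine ⟨?_, tendsto_atTop_mono
    (fun n => (hsol n).abs_le_mul_iSup hopen hbdd hp (hlam n) (hα n)) hαinf⟩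
  have hpow : Tendsto (fun n => |α n| ^ e) atTop atTop := (tendsto_rpow_atTop he).comp hαinf
  rw [Filter.tendsto_atTop]
  intro b
  filter_upwards [hpow.eventually_gt_atTop (D * (max b 0) ^ e')] with n hn
  have h1 : max b 0 ^ e' < lam n ^ e' :=
    lt_of_mul_lt_mul_left (hn.trans_le (hbound _ _ _ (hlam n) (hα n) (hsol n))) hD.le
  have h2 := (Real.rpow_lt_rpow_iff (le_max_right b 0) (hlam n).le he').1 h1
  exact (le_max_left b 0).trans h2.le
end
end
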